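/- arXiv:1405.4729 — 2 statements merged into one kernel-verified Lean document; each statement's English description precedes it below -/
import Mathlib

section
/- Let P_Q be the preprojective algebra of a finite acyclic connected quiver Q. Then P_Q is finite-dimensional if and only if Q is of Dynkin (ADE) type. -/
open scoped BigOperators

/-- Data of elements of an algebra `B` satisfying the defining relations of the
preprojective algebra of the quiver with vertices `V` and arrows `E`: orthogonal idempotents
`e i` summing to `1`, images `f α` of the arrows and `g α` of the reversed arrows compatible
with the idempotents, subject to the mesh (preprojective) relations at each vertex. -/
structure PreprojectivePresentation (k : Type) [Field k] (V : Type) [Fintype V]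
    [DecidableEq V] (E : V → V → Type) [∀ i j, Fintype (E i j)]
    (B : Type) [Ring B] [Algebra k B] where
  e : V → B
  f : ∀ ⦃i j : V⦄, E i j → B
  g : ∀ ⦃i j : V⦄, E i j → B
  orth : ∀ i j, e i * e j = if i = j then e i else 0
  sum_one : ∑ i, e i = 1
  f_idem : ∀ ⦃i j⦄ (α : E i j), e j * f α * e i = f α
  g_idem : ∀ ⦃i j⦄ (α : E i j), e i * g α * e j = g α
  mesh : ∀ x : V,
    (∑ y : V, ∑ β : E y x, f β * g β) - (∑ y : V, ∑ α : E x y, g α * f α) = 0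

/-- The symmetrized Cartan matrix of a quiver: `2·Id − A − Aᵀ` where `A` counts arrows. -/
def cartanMatrix (V : Type) [Fintype V] [DecidableEq V] (E : V → V → Type)
    [∀ i j, Fintype (E i j)] : Matrix V V ℤ :=
  fun i j => (if i = j then 2 else 0) - (Fintype.card (E i j) + Fintype.card (E j i))

/-- A finite quiver is of Dynkin (ADE) type iff its symmetrized Cartan matrix is positive
definite. -/
def IsDynkin (V : Type) [Fintype V] [DecidableEq V] (E : V → V → Type)
    [∀ i j, Fintype (E i j)] : Prop :=
  ((cartanMatrix V E).map ((↑) : ℤ → ℝ)).PosDef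

/-- The quiver has no nontrivial oriented cycles. -/
def QuiverAcyclic (V : Type) (E : V → V → Type) : Prop :=
  ∀ (i : V) (p : @Quiver.Path V ⟨E⟩ i i), p = @Quiver.Path.nil V ⟨E⟩ i

/-- The underlying graph of the quiver is connected. -/
def QuiverConnected (V : Type) (E : V → V → Type) : Prop :=
  ∀ i j : V, Nonempty (@Quiver.Path V ⟨fun a b => Sum (E a b) (E b a)⟩ i j)


/-- The trace pairing of `Hom(M,N)` and `Hom(N,M)` is nondegenerate. -/
theorem eq_zero_of_trace_comp {k M N : Type} [Field k] [AddCommGroup M] [Module k M]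
    [AddCommGroup N] [Module k N] [FiniteDimensional k M] [FiniteDimensional k N]
    (u : M →ₗ[k] N) (h : ∀ w : N →ₗ[k] M, LinearMap.trace k N (u ∘ₗ w) = 0) : u = 0 := by
  ext m
  by_contra hm
  have hex : ∃ l : N →ₗ[k] k, l (u m) ≠ 0 := by
    by_contra hc
    push Not at hc
    exact hm ((Module.forall_dual_apply_eq_zero_iff k (u m)).1 hc)
  obtain ⟨l, hl⟩ := hex
  apply hl
  have := h (l.smulRight m)
  have h2 : u ∘ₗ (l.smulRight m) = l.smulRight (u m) := by
    ext x; simp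
  rw [h2, LinearMap.trace_smulRight] at this
  exact this

section Rep

set_option linter.unusedSectionVars false

variable {k : Type} [Field k] {V : Type} [Fintype V] [DecidableEq V]
  {E : V → V → Type} [∀ i j, Fintype (E i j)]
  {M : V → Type} [∀ i, AddCommGroup (M i)] [∀ i, Module k (M i)]
  [∀ i, FiniteDimensional k (M i)]

/-- The symplectic form on the space of representations of the double quiver. -/
noncomputable def sympForm (k : Type) [Field k] {V : Type} [Fintype V]
    (E : V → V → Type) [∀ i j, Fintype (E i j)]
    (M : V → Type) [∀ i, AddCommGroup (M i)] [∀ i, Module k (M i)] :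
    LinearMap.BilinForm k ((∀ i j, E i j → M i →ₗ[k] M j) × (∀ i j, E i j → M j →ₗ[k] M i)) :=
  LinearMap.mk₂ k (fun p q => ∑ i, ∑ j, ∑ α : E i j,
      (LinearMap.trace k (M j) (p.1 i j α ∘ₗ q.2 i j α)
        - LinearMap.trace k (M j) (q.1 i j α ∘ₗ p.2 i j α)))
    (by
      intro p p' q
      simp only [← Finset.sum_add_distrib]
      refine Finset.sum_congr rfl fun i _ => Finset.sum_congr rfl fun j _ =>
        Finset.sum_congr rfl fun α _ => ?_
      simp [LinearMap.add_comp, LinearMap.comp_add]; ring)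
    (by
      intro c p q
      simp only [Finset.smul_sum]
      refine Finset.sum_congr rfl fun i _ => Finset.sum_congr rfl fun j _ =>
        Finset.sum_congr rfl fun α _ => ?_
      simp [LinearMap.smul_comp, LinearMap.comp_smul]; ring)
    (by
      intro p q q'
      simp only [← Finset.sum_add_distrib]
      refine Finset.sum_congr rfl fun i _ => Finset.sum_congr rfl fun j _ =>
        Finset.sum_congr rfl fun α _ => ?_
      simp [LinearMap.add_comp, LinearMap.comp_add]; ring)
    (by
      intro c p q
      simp only [Finset.smul_sum]
      refine Finset.sum_congr rfl fun i _ => Finset.sum_congr rfl fun j _ =>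
        Finset.sum_congr rfl fun α _ => ?_
      simp [LinearMap.smul_comp, LinearMap.comp_smul]; ring)

theorem sympForm_apply (p q : (∀ i j, E i j → M i →ₗ[k] M j) × (∀ i j, E i j → M j →ₗ[k] M i)) :
    sympForm k E M p q = ∑ i, ∑ j, ∑ α : E i j,
      (LinearMap.trace k (M j) (p.1 i j α ∘ₗ q.2 i j α)
        - LinearMap.trace k (M j) (q.1 i j α ∘ₗ p.2 i j α)) := rfl

theorem sympForm_neg (p q : (∀ i j, E i j → M i →ₗ[k] M j) × (∀ i j, E i j → M j →ₗ[k] M i)) :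
    sympForm k E M p q = - sympForm k E M q p := by
  simp only [sympForm_apply, ← Finset.sum_neg_distrib, neg_sub]

theorem sympForm_sepLeft : (sympForm k E M).SeparatingLeft := by
  classical
  intro p hp
  refine Prod.ext ?_ ?_
  · funext i j α
    apply eq_zero_of_trace_comp
    intro w
    have := hp (0, Function.update 0 i (Function.update 0 j (Function.update 0 α w)))
    rw [sympForm_apply, Finset.sum_eq_single i, Finset.sum_eq_single j,
      Finset.sum_eq_single α] at this
    · simpa using this
    · intro β _ hβ; simp [hβ]
    · simp
    · intro β _ hβ; simp [hβ]
    · simp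
    · intro β _ hβ; simp [hβ]
    · simp
  · funext i j α
    apply eq_zero_of_trace_comp
    intro w
    rw [← LinearMap.trace_comp_comm']
    have := hp (Function.update 0 i (Function.update 0 j (Function.update 0 α w)), 0)
    rw [sympForm_apply, Finset.sum_eq_single i, Finset.sum_eq_single j,
      Finset.sum_eq_single α] at this
    · simpa using this
    · intro β _ hβ; simp [hβ]
    · simp
    · intro β _ hβ; simp [hβ]
    · simp
    · intro β _ hβ; simp [hβ]
    · simp

theorem sympForm_nondeg : (sympForm k E M).Nondegenerate := by
  refine ⟨sympForm_sepLeft, fun q hq => sympForm_sepLeft q fun p => ?_⟩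
  rw [sympForm_neg, hq, neg_zero]

/-- The infinitesimal action on the representation `(F, G)`. -/
def infAct (F : ∀ i j, E i j → M i →ₗ[k] M j) (G : ∀ i j, E i j → M j →ₗ[k] M i) :
    (∀ i, M i →ₗ[k] M i) →ₗ[k]
      ((∀ i j, E i j → M i →ₗ[k] M j) × (∀ i j, E i j → M j →ₗ[k] M i)) where
  toFun x := (fun i j α => x j ∘ₗ F i j α - F i j α ∘ₗ x i,
    fun i j α => x i ∘ₗ G i j α - G i j α ∘ₗ x j)
  map_add' x y := by
    refine Prod.ext ?_ ?_ <;> funext i j α <;> ext m <;> simp <;> abel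
  map_smul' c x := by
    refine Prod.ext ?_ ?_ <;> funext i j α <;> ext m <;> simp [smul_sub]

theorem trace_calc {P N : Type} [AddCommGroup P] [Module k P]
    [AddCommGroup N] [Module k N] [FiniteDimensional k P] [FiniteDimensional k N]
    (F : P →ₗ[k] N) (G : N →ₗ[k] P) (x y : P →ₗ[k] P) (x' y' : N →ₗ[k] N) :
    LinearMap.trace k N ((x' ∘ₗ F - F ∘ₗ x) ∘ₗ (y ∘ₗ G - G ∘ₗ y'))
      - LinearMap.trace k N ((y' ∘ₗ F - F ∘ₗ y) ∘ₗ (x ∘ₗ G - G ∘ₗ x'))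
    = LinearMap.trace k N ((F ∘ₗ G) ∘ₗ (x' ∘ₗ y' - y' ∘ₗ x'))
      - LinearMap.trace k P ((G ∘ₗ F) ∘ₗ (x ∘ₗ y - y ∘ₗ x)) := by
  have c1 : LinearMap.trace k N (x' ∘ₗ (F ∘ₗ y ∘ₗ G)) = LinearMap.trace k N ((F ∘ₗ y ∘ₗ G) ∘ₗ x') :=
    LinearMap.trace_comp_comm' _ _
  have c2 : LinearMap.trace k N (y' ∘ₗ (F ∘ₗ x ∘ₗ G)) = LinearMap.trace k N ((F ∘ₗ x ∘ₗ G) ∘ₗ y') :=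
    LinearMap.trace_comp_comm' _ _
  have c3 : LinearMap.trace k N (x' ∘ₗ (F ∘ₗ G ∘ₗ y')) = LinearMap.trace k N ((F ∘ₗ G ∘ₗ y') ∘ₗ x') :=
    LinearMap.trace_comp_comm' _ _
  have c4 : LinearMap.trace k N (y' ∘ₗ (F ∘ₗ G ∘ₗ x')) = LinearMap.trace k N ((F ∘ₗ G ∘ₗ x') ∘ₗ y') :=
    LinearMap.trace_comp_comm' _ _
  have c5 : LinearMap.trace k N ((F ∘ₗ x ∘ₗ y) ∘ₗ G) = LinearMap.trace k P (G ∘ₗ (F ∘ₗ x ∘ₗ y)) :=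
    LinearMap.trace_comp_comm' _ _
  have c6 : LinearMap.trace k N ((F ∘ₗ y ∘ₗ x) ∘ₗ G) = LinearMap.trace k P (G ∘ₗ (F ∘ₗ y ∘ₗ x)) :=
    LinearMap.trace_comp_comm' _ _
  simp only [LinearMap.comp_sub, LinearMap.sub_comp, map_sub, LinearMap.comp_assoc] at *
  rw [c1, c2, c3, c4, c5, c6]
  ring

theorem infAct_isotropic (F : ∀ i j, E i j → M i →ₗ[k] M j) (G : ∀ i j, E i j → M j →ₗ[k] M i)
    (mesh : ∀ x, ∑ y, ∑ β : E y x, F y x β ∘ₗ G y x β = ∑ y, ∑ α : E x y, G x y α ∘ₗ F x y α)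
    (x y : ∀ i, M i →ₗ[k] M i) :
    sympForm k E M (infAct F G x) (infAct F G y) = 0 := by
  have h1 : sympForm k E M (infAct F G x) (infAct F G y) =
      ∑ i, ∑ j, ∑ α : E i j,
       (LinearMap.trace k (M j) ((F i j α ∘ₗ G i j α) ∘ₗ (x j ∘ₗ y j - y j ∘ₗ x j))
      - LinearMap.trace k (M i) ((G i j α ∘ₗ F i j α) ∘ₗ (x i ∘ₗ y i - y i ∘ₗ x i))) := by
    rw [sympForm_apply]
    refine Finset.sum_congr rfl fun i _ => Finset.sum_congr rfl fun j _ =>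
        Finset.sum_congr rfl fun α _ => ?_
    exact trace_calc _ _ _ _ _ _
  rw [h1]
  simp only [Finset.sum_sub_distrib]
  rw [sub_eq_zero, Finset.sum_comm]
  refine Finset.sum_congr rfl fun i _ => ?_
  have := congrArg ((LinearMap.trace k (M i)) ∘ₗ
    (LinearMap.lcomp k (M i) (x i ∘ₗ y i - y i ∘ₗ x i))) (mesh i)
  simp only [map_sum] at this
  exact this

theorem rep_inequality (F : ∀ i j, E i j → M i →ₗ[k] M j) (G : ∀ i j, E i j → M j →ₗ[k] M i)
    (mesh : ∀ x, ∑ y, ∑ β : E y x, F y x β ∘ₗ G y x β = ∑ y, ∑ α : E x y, G x y α ∘ₗ F x y α) :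
    ∑ i, Module.finrank k (M i) * Module.finrank k (M i) ≤
      Module.finrank k (LinearMap.ker (infAct F G)) +
      ∑ i, ∑ j, Fintype.card (E i j) * (Module.finrank k (M i) * Module.finrank k (M j)) := by
  have hle : LinearMap.range (infAct F G) ≤
      (sympForm k E M).orthogonal (LinearMap.range (infAct F G)) := by
    rintro _ ⟨x, rfl⟩
    rw [LinearMap.BilinForm.mem_orthogonal_iff]
    rintro _ ⟨y, rfl⟩
    exact infAct_isotropic F G mesh y x
  have h1 := Submodule.finrank_mono hle
  rw [LinearMap.BilinForm.finrank_orthogonal sympForm_nondeg] at h1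
  have h2 := LinearMap.finrank_range_add_finrank_ker (infAct F G)
  have h3 : Module.finrank k (∀ i, M i →ₗ[k] M i)
      = ∑ i, Module.finrank k (M i) * Module.finrank k (M i) := by
    simp [Module.finrank_pi_fintype, Module.finrank_linearMap]
  have h4 : Module.finrank k (∀ i j, E i j → M i →ₗ[k] M j) =
      ∑ i, ∑ j, Fintype.card (E i j) * (Module.finrank k (M i) * Module.finrank k (M j)) := by
    simp [Module.finrank_pi_fintype, Module.finrank_linearMap]
  have h5 : Module.finrank k (∀ i j, E i j → M j →ₗ[k] M i) =
      ∑ i, ∑ j, Fintype.card (E i j) * (Module.finrank k (M i) * Module.finrank k (M j)) := by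
    simp only [Module.finrank_pi_fintype, Module.finrank_linearMap]
    refine Finset.sum_congr rfl fun i _ => Finset.sum_congr rfl fun j _ => ?_
    rw [Finset.sum_const, Finset.card_univ, smul_eq_mul, mul_comm (Module.finrank k (M j))]
  rw [Module.finrank_prod, h4, h5] at h1
  omega

end Rep

section ModulePart

set_option linter.unusedSectionVars false

variable {k : Type} [Field k] {V : Type} [Fintype V] [DecidableEq V]
  {E : V → V → Type} [∀ i j, Fintype (E i j)]
  {A : Type} [Ring A] [Algebra k A]

theorem PreprojectivePresentation.e_f (π : PreprojectivePresentation k V E A) {i j : V}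
    (α : E i j) : π.e j * π.f α = π.f α := by
  conv_lhs => rw [← π.f_idem α]
  rw [← mul_assoc, ← mul_assoc, π.orth, if_pos rfl, π.f_idem]

theorem PreprojectivePresentation.f_e (π : PreprojectivePresentation k V E A) {i j : V}
    (α : E i j) : π.f α * π.e i = π.f α := by
  conv_lhs => rw [← π.f_idem α]
  rw [mul_assoc, π.orth, if_pos rfl, π.f_idem]

theorem PreprojectivePresentation.e_g (π : PreprojectivePresentation k V E A) {i j : V}
    (α : E i j) : π.e i * π.g α = π.g α := by
  conv_lhs => rw [← π.g_idem α]
  rw [← mul_assoc, ← mul_assoc, π.orth, if_pos rfl, π.g_idem]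

theorem PreprojectivePresentation.g_e (π : PreprojectivePresentation k V E A) {i j : V}
    (α : E i j) : π.g α * π.e j = π.g α := by
  conv_lhs => rw [← π.g_idem α]
  rw [mul_assoc, π.orth, if_pos rfl, π.g_idem]

theorem PreprojectivePresentation.e_e (π : PreprojectivePresentation k V E A) (i : V) :
    π.e i * π.e i = π.e i := by
  rw [π.orth, if_pos rfl]

theorem PreprojectivePresentation.mesh' (π : PreprojectivePresentation k V E A) (x : V) :
    ∑ y : V, ∑ β : E y x, π.f β * π.g β = ∑ y : V, ∑ α : E x y, π.g α * π.f α :=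
  sub_eq_zero.1 (π.mesh x)

theorem adjoin_ind (π : PreprojectivePresentation k V E A)
    (hgen : Algebra.adjoin k
      (Set.range π.e ∪ {a | ∃ (i j : V) (α : E i j), a = π.f α ∨ a = π.g α}) = ⊤)
    (p : A → Prop) (he : ∀ i, p (π.e i)) (hf : ∀ i j (α : E i j), p (π.f α))
    (hg : ∀ i j (α : E i j), p (π.g α)) (hk : ∀ r : k, p (algebraMap k A r))
    (hadd : ∀ x y, p x → p y → p (x + y)) (hmul : ∀ x y, p x → p y → p (x * y)) (a : A) : p a := by
  have ha : a ∈ Algebra.adjoin k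
      (Set.range π.e ∪ {a | ∃ (i j : V) (α : E i j), a = π.f α ∨ a = π.g α}) := by
    rw [hgen]; trivial
  induction ha using Algebra.adjoin_induction with
  | mem x hx =>
    rcases hx with ⟨i, rfl⟩ | ⟨i, j, α, rfl | rfl⟩
    · exact he i
    · exact hf i j α
    · exact hg i j α
  | algebraMap r => exact hk r
  | add x y _ _ hx hy => exact hadd x y hx hy
  | mul x y _ _ hx hy => exact hmul x y hx hy

variable {M : Type} [AddCommGroup M] [Module k M] [Module A M] [IsScalarTower k A M]

/-- The vertex space `e_i M`. -/
def vspace (π : PreprojectivePresentation k V E A) (M : Type) [AddCommGroup M] [Module k M]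
    [Module A M] [IsScalarTower k A M] (i : V) : Submodule k M :=
  LinearMap.range (Algebra.lsmul k k M (π.e i))

theorem mem_vspace (π : PreprojectivePresentation k V E A) (i : V) (m : M) :
    m ∈ vspace π M i ↔ π.e i • m = m := by
  constructor
  · rintro ⟨n, rfl⟩
    simp [smul_smul, π.e_e]
  · intro h
    exact ⟨m, h⟩

/-- Projection to the vertex space. -/
def vproj (π : PreprojectivePresentation k V E A) (i : V) : M →ₗ[k] vspace π M i :=
  (Algebra.lsmul k k M (π.e i)).codRestrict _ (fun m => ⟨m, rfl⟩)

@[simp] theorem vproj_coe (π : PreprojectivePresentation k V E A) (i : V) (m : M) :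
    (vproj π i m : M) = π.e i • m := rfl

theorem e_smul_vspace (π : PreprojectivePresentation k V E A) (i j : V) (m : vspace π M j) :
    π.e i • (m : M) = if i = j then (m : M) else 0 := by
  have h := (mem_vspace π j (m : M)).1 m.2
  rw [← h, smul_smul, π.orth]
  split_ifs with hij
  · subst hij; rfl
  · simp

/-- Multiplication by a generator between vertex spaces. -/
def vmap (π : PreprojectivePresentation k V E A) (i j : V) (a : A) (ha : π.e j * a = a) :
    vspace π M i →ₗ[k] vspace π M j :=
  ((Algebra.lsmul k k M a).comp (vspace π M i).subtype).codRestrict _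
    (fun m => by
      rw [mem_vspace]
      change π.e j • a • (m : M) = a • (m : M)
      rw [smul_smul, ha])

@[simp] theorem vmap_coe (π : PreprojectivePresentation k V E A) (i j : V) (a : A)
    (ha : π.e j * a = a) (m : vspace π M i) : (vmap π i j a ha m : M) = a • (m : M) := rfl

theorem sum_e_smul (π : PreprojectivePresentation k V E A) (m : M) :
    ∑ i, π.e i • m = m := by
  rw [← Finset.sum_smul, π.sum_one, one_smul]

/-- Decomposition of a module into its vertex spaces. -/
def vdecomp (π : PreprojectivePresentation k V E A) : M ≃ₗ[k] (∀ i, vspace π M i) where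
  toFun m i := vproj π i m
  map_add' x y := by funext i; simp
  map_smul' c x := by funext i; simp
  invFun x := ∑ i, (x i : M)
  left_inv m := by simp [sum_e_smul]
  right_inv x := by
    funext i
    ext
    simp [Finset.smul_sum, e_smul_vspace]

theorem finrank_eq_sum [FiniteDimensional k M] (π : PreprojectivePresentation k V E A) :
    Module.finrank k M = ∑ i, Module.finrank k (vspace π M i) := by
  rw [(vdecomp (M := M) π).finrank_eq, Module.finrank_pi_fintype]

theorem cyclic_inequality [FiniteDimensional k M] (π : PreprojectivePresentation k V E A)
    (hgen : Algebra.adjoin k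
      (Set.range π.e ∪ {a | ∃ (i j : V) (α : E i j), a = π.f α ∨ a = π.g α}) = ⊤)
    (m0 : M) (hm0 : ∀ m : M, ∃ a : A, m = a • m0) :
    ∑ i, Module.finrank k (vspace π M i) * Module.finrank k (vspace π M i) ≤
      Module.finrank k M +
      ∑ i, ∑ j, Fintype.card (E i j) *
        (Module.finrank k (vspace π M i) * Module.finrank k (vspace π M j)) := by
  let F : ∀ i j, E i j → vspace π M i →ₗ[k] vspace π M j := fun i j α =>
    vmap π i j (π.f α) (π.e_f α)
  let G : ∀ i j, E i j → vspace π M j →ₗ[k] vspace π M i := fun i j α =>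
    vmap π j i (π.g α) (π.e_g α)
  have mesh : ∀ x, ∑ y, ∑ β : E y x, F y x β ∘ₗ G y x β
      = ∑ y, ∑ α : E x y, G x y α ∘ₗ F x y α := by
    intro x
    ext m
    have := congrArg (fun a => a • (m : M)) (π.mesh' x)
    simpa [F, G, Finset.sum_smul, mul_smul, LinearMap.sum_apply] using this
  refine (rep_inequality F G mesh).trans (Nat.add_le_add_right ?_ _)
  -- evaluation at the cyclic vector
  let ev : LinearMap.ker (infAct F G) →ₗ[k] (∀ i, vspace π M i) :=
    { toFun := fun x i => x.1 i (vproj π i m0)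
      map_add' := fun x y => by funext i; simp
      map_smul' := fun c x => by funext i; simp }
  rw [(vdecomp (M := M) π).finrank_eq]
  refine LinearMap.finrank_le_finrank_of_injective (f := ev) ?_
  rw [← LinearMap.ker_eq_bot, LinearMap.ker_eq_bot']
  rintro ⟨x, hx⟩ hev
  have hev' : ∀ i, x i (vproj π i m0) = 0 := fun i => congrFun hev i
  rw [LinearMap.mem_ker] at hx
  have hF : ∀ i j (α : E i j) (m : vspace π M i), x j (F i j α m) = F i j α (x i m) := by
    intro i j α m
    have h := congrArg (fun z => z.1 i j α m) hx
    exact sub_eq_zero.1 h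
  have hG : ∀ i j (α : E i j) (m : vspace π M j), x i (G i j α m) = G i j α (x j m) := by
    intro i j α m
    have h := congrArg (fun z => z.2 i j α m) hx
    exact sub_eq_zero.1 h
  -- the assembled endomorphism
  let X : M →ₗ[k] M := ∑ i, (vspace π M i).subtype ∘ₗ x i ∘ₗ vproj π i
  have hX : ∀ m, X m = ∑ i, (x i (vproj π i m) : M) := by
    intro m; simp [X, LinearMap.sum_apply]
  have hpe : ∀ i j (m : M), vproj π i (π.e j • m) = if i = j then vproj π i m else 0 := by
    intro i j m
    ext
    simp only [vproj_coe, smul_smul, π.orth]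
    split_ifs <;> simp
  have hXmem : ∀ i (m : M), m ∈ vspace π M i → X m = x i (vproj π i m) := by
    intro i m hm
    rw [hX, Finset.sum_eq_single i]
    · intro j _ hj
      rw [← (mem_vspace π i m).1 hm, hpe, if_neg hj]; simp
    · simp
  have key : ∀ a : A, ∀ m, X (a • m) = a • X m := by
    refine adjoin_ind π hgen _ ?_ ?_ ?_ ?_ ?_ ?_
    · intro i m
      rw [hX, hX, Finset.smul_sum]
      refine Finset.sum_congr rfl fun j _ => ?_
      rw [hpe, e_smul_vspace]
      by_cases h : j = i
      · subst h; simp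
      · simp [h, Ne.symm h]
    · intro i j α m
      have h1 : π.f α • m ∈ vspace π M j := by
        rw [mem_vspace, smul_smul, π.e_f]
      have h2 : vproj π j (π.f α • m) = F i j α (vproj π i m) := by
        ext; simp [F, smul_smul, π.e_f, π.f_e]
      rw [hXmem j _ h1, h2, hF, hX, Finset.smul_sum, Finset.sum_eq_single i]
      · rfl
      · intro l _ hl
        rw [← π.f_e, mul_smul, e_smul_vspace, if_neg (Ne.symm hl), smul_zero]
      · simp
    · intro i j α m
      have h1 : π.g α • m ∈ vspace π M i := by
        rw [mem_vspace, smul_smul, π.e_g]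
      have h2 : vproj π i (π.g α • m) = G i j α (vproj π j m) := by
        ext; simp [G, smul_smul, π.e_g, π.g_e]
      rw [hXmem i _ h1, h2, hG, hX, Finset.smul_sum, Finset.sum_eq_single j]
      · rfl
      · intro l _ hl
        rw [← π.g_e, mul_smul, e_smul_vspace, if_neg (Ne.symm hl), smul_zero]
      · simp
    · intro r m
      simp [algebraMap_smul]
    · intro a b ha hb m
      simp [add_smul, ha, hb]
    · intro a b ha hb m
      simp [mul_smul, ha, hb]
  have hX0 : X m0 = 0 := by
    rw [hX]; simp [hev']
  have hXz : ∀ m, X m = 0 := by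
    intro m
    obtain ⟨a, rfl⟩ := hm0 m
    rw [key, hX0, smul_zero]
  ext i m
  have := hXmem i m m.2
  rw [hXz] at this
  have h3 : vproj π i (m : M) = m := by
    ext; exact (mem_vspace π i _).1 m.2
  rw [h3] at this
  exact this.symm

end ModulePart

section Matrices

theorem posDef_of_positive_vector {V : Type} [Fintype V] [DecidableEq V] (C : Matrix V V ℝ)
    (hs : ∀ i j, C i j = C j i) (hneg : ∀ i j, i ≠ j → C i j ≤ 0) (d : V → ℝ)
    (hd : ∀ i, 0 < d i) (hCd : ∀ i, 0 < ∑ j, C i j * d j) : C.PosDef := by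
  refine Matrix.PosDef.of_dotProduct_mulVec_pos ?_ ?_
  · ext i j
    simp [Matrix.conjTranspose_apply, hs i j]
  · intro x hx
    have e1 : star x ⬝ᵥ C.mulVec x = ∑ i, ∑ j, x i * C i j * x j := by
      simp [dotProduct, Matrix.mulVec, Finset.mul_sum, mul_assoc]
    rw [e1]
    set z : V → ℝ := fun i => x i / d i with hz
    have hxz : ∀ i, x i = z i * d i := fun i => by
      have := (hd i).ne'
      simp only [hz]; field_simp
    have e2 : ∑ i, ∑ j, x i * C i j * x j =
        ∑ i, z i ^ 2 * d i * (∑ j, C i j * d j)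
          + (1 / 2) * ∑ i, ∑ j, (- C i j) * d i * d j * (z i - z j) ^ 2 := by
      have e3 : ∑ i, ∑ j, C i j * d i * d j * z j ^ 2 = ∑ i, ∑ j, C i j * d i * d j * z i ^ 2 := by
        rw [Finset.sum_comm]
        refine Finset.sum_congr rfl fun i _ => Finset.sum_congr rfl fun j _ => ?_
        rw [hs j i]; ring
      have e4 : ∑ i, ∑ j, (- C i j) * d i * d j * (z i - z j) ^ 2 =
          2 * ∑ i, ∑ j, x i * C i j * x j - ∑ i, ∑ j, C i j * d i * d j * z i ^ 2
            - ∑ i, ∑ j, C i j * d i * d j * z j ^ 2 := by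
        simp only [Finset.mul_sum, ← Finset.sum_sub_distrib]
        refine Finset.sum_congr rfl fun i _ => Finset.sum_congr rfl fun j _ => ?_
        rw [hxz i, hxz j]; ring
      have e5 : ∑ i, z i ^ 2 * d i * (∑ j, C i j * d j)
          = ∑ i, ∑ j, C i j * d i * d j * z i ^ 2 := by
        simp only [Finset.mul_sum]
        refine Finset.sum_congr rfl fun i _ => Finset.sum_congr rfl fun j _ => ?_
        ring
      rw [e4, e3, e5]; ring
    rw [e2]
    have p2 : 0 ≤ ∑ i, ∑ j, (- C i j) * d i * d j * (z i - z j) ^ 2 := by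
      refine Finset.sum_nonneg fun i _ => Finset.sum_nonneg fun j _ => ?_
      by_cases hij : i = j
      · subst hij; simp
      · have := hneg i j hij
        have h1 : 0 ≤ - C i j := by linarith
        exact mul_nonneg (mul_nonneg (mul_nonneg h1 (hd i).le) (hd j).le) (sq_nonneg _)
    have p1 : 0 < ∑ i, z i ^ 2 * d i * (∑ j, C i j * d j) := by
      obtain ⟨i, hi⟩ := Function.ne_iff.1 hx
      refine Finset.sum_pos' (fun i _ => ?_) ⟨i, Finset.mem_univ i, ?_⟩
      · exact mul_nonneg (mul_nonneg (sq_nonneg _) (hd i).le) (hCd i).le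
      · have : z i ≠ 0 := div_ne_zero hi (hd i).ne'
        have := hd i
        have := hCd i
        positivity
    linarith

/-- If `C` is positive definite then the region `(v,v) ≤ 2 ∑ v_i` is bounded. -/
theorem bound_of_posDef {V : Type} [Fintype V] [DecidableEq V] (C : Matrix V V ℝ)
    (hC : C.PosDef) : ∃ N : ℕ, ∀ v : V → ℝ, ∑ i, ∑ j, v i * C i j * v j ≤ 2 * ∑ i, v i →
      ∑ i, v i ≤ N := by
  set y : V → ℝ := C⁻¹.mulVec 1 with hy
  have hCy : C.mulVec y = 1 := by
    rw [hy, Matrix.mulVec_mulVec, Matrix.mul_nonsing_inv _ ((Matrix.isUnit_iff_isUnit_det _).1 hC.isUnit),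
      Matrix.one_mulVec]
  have hCy' : ∀ i, ∑ j, C i j * y j = 1 := fun i => congrFun hCy i
  have hs : ∀ i j, C i j = C j i := fun i j => by
    have := hC.isHermitian.apply j i
    simpa using this
  obtain ⟨N, hN⟩ := exists_nat_ge (2 * ∑ i, y i)
  refine ⟨N, fun v hv => le_trans ?_ hN⟩
  have h0 := hC.posSemidef.dotProduct_mulVec_nonneg (v - (2 : ℝ) • y)
  have e1 : star (v - (2 : ℝ) • y) ⬝ᵥ C.mulVec (v - (2 : ℝ) • y) =
      ∑ i, ∑ j, v i * C i j * v j - 2 * ∑ i, ∑ j, v i * (C i j * y j)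
       - 2 * ∑ i, ∑ j, v j * (C j i * y i) + 4 * ∑ i, ∑ j, y i * (C i j * y j) := by
    simp only [dotProduct, Matrix.mulVec, Finset.mul_sum, ← Finset.sum_sub_distrib,
      ← Finset.sum_add_distrib]
    refine Finset.sum_congr rfl fun i _ => Finset.sum_congr rfl fun j _ => ?_
    simp [hs j i]; ring
  rw [e1, Finset.sum_comm (f := fun i j => v j * (C j i * y i))] at h0
  simp only [← Finset.mul_sum, hCy', mul_one] at h0
  linarith

end Matrices

theorem cartan_form {V : Type} [Fintype V] [DecidableEq V] {E : V → V → Type}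
    [∀ i j, Fintype (E i j)] (v : V → ℝ) :
    ∑ i, ∑ j, v i * ((cartanMatrix V E).map ((↑) : ℤ → ℝ)) i j * v j =
      2 * ∑ i, v i * v i - 2 * ∑ i, ∑ j, (Fintype.card (E i j) : ℝ) * (v i * v j) := by
  have h1 : ∀ i j, v i * ((cartanMatrix V E).map ((↑) : ℤ → ℝ)) i j * v j =
      (if i = j then 2 * (v i * v j) else 0) - (Fintype.card (E i j) : ℝ) * (v i * v j)
        - (Fintype.card (E j i) : ℝ) * (v j * v i) := by
    intro i j
    simp only [Matrix.map_apply, cartanMatrix]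
    split_ifs <;> push_cast <;> ring
  simp only [h1, Finset.sum_sub_distrib]
  rw [Finset.sum_comm (f := fun i j => (Fintype.card (E j i) : ℝ) * (v j * v i))]
  simp only [Finset.sum_ite_eq, Finset.mem_univ, if_true, ← Finset.mul_sum]
  ring

section DynkinToFinite

open Polynomial

variable {k : Type} [Field k] {V : Type} [Fintype V] [DecidableEq V]
  {E : V → V → Type} [∀ i j, Fintype (E i j)]
  {A : Type} [Ring A] [Algebra k A]

theorem CXCX (a b : A) : (C a * X) * (C b * X) = C (a * b) * X ^ 2 := by
  rw [C_mul, pow_two, mul_assoc, ← mul_assoc X, X_mul_C]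
  simp only [mul_assoc]

/-- The presentation on `A[X]` giving the path-length grading. -/
noncomputable def gradedPres (π : PreprojectivePresentation k V E A) :
    PreprojectivePresentation k V E A[X] where
  e i := C (π.e i)
  f _ _ α := C (π.f α) * X
  g _ _ α := C (π.g α) * X
  orth i j := by
    rw [← C_mul, π.orth]; split_ifs <;> simp
  sum_one := by rw [← map_sum, π.sum_one, C_1]
  f_idem i j α := by
    rw [mul_assoc, mul_assoc, X_mul_C, ← mul_assoc, ← mul_assoc, ← C_mul, ← C_mul, π.f_idem]
  g_idem i j α := by
    rw [mul_assoc, mul_assoc, X_mul_C, ← mul_assoc, ← mul_assoc, ← C_mul, ← C_mul, π.g_idem]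
  mesh x := by
    simp only [CXCX, ← Finset.sum_mul, ← map_sum]
    rw [π.mesh', sub_self]

/-- Span of the idempotents. -/
def spanE (π : PreprojectivePresentation k V E A) : Submodule k A := Submodule.span k (Set.range π.e)

/-- Span of the arrows. -/
def spanS (π : PreprojectivePresentation k V E A) : Submodule k A :=
  Submodule.span k {a | ∃ (i j : V) (α : E i j), a = π.f α ∨ a = π.g α}

theorem spanE_fg (π : PreprojectivePresentation k V E A) : (spanE π).FG :=
  Submodule.fg_span (Set.finite_range _)

theorem spanS_fg (π : PreprojectivePresentation k V E A) : (spanS π).FG := by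
  refine Submodule.fg_span ?_
  have : {a | ∃ (i j : V) (α : E i j), a = π.f α ∨ a = π.g α} ⊆
      Set.range (fun z : Σ i j, E i j => π.f z.2.2) ∪ Set.range (fun z : Σ i j, E i j => π.g z.2.2) := by
    rintro a ⟨i, j, α, rfl | rfl⟩
    · exact Or.inl ⟨⟨i, j, α⟩, rfl⟩
    · exact Or.inr ⟨⟨i, j, α⟩, rfl⟩
  exact ((Set.finite_range _).union (Set.finite_range _)).subset this

theorem one_mem_spanE (π : PreprojectivePresentation k V E A) : (1 : A) ∈ spanE π := by
  rw [← π.sum_one]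
  exact Submodule.sum_mem _ fun i _ => Submodule.subset_span ⟨i, rfl⟩

theorem one_le_spanE (π : PreprojectivePresentation k V E A) : 1 ≤ spanE π := by
  rw [Submodule.one_le]; exact one_mem_spanE π

theorem spanE_mul_spanE (π : PreprojectivePresentation k V E A) : spanE π * spanE π = spanE π := by
  apply le_antisymm
  · rw [spanE, Submodule.span_mul_span, Submodule.span_le]
    rintro _ ⟨_, ⟨i, rfl⟩, _, ⟨j, rfl⟩, rfl⟩
    change π.e i * π.e j ∈ _
    rw [π.orth]
    split_ifs
    · exact Submodule.subset_span ⟨i, rfl⟩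
    · exact Submodule.zero_mem _
  · calc spanE π = 1 * spanE π := (one_mul _).symm
      _ ≤ _ := mul_le_mul' (one_le_spanE π) le_rfl

theorem e_mul_f (π : PreprojectivePresentation k V E A) (l : V) {i j : V} (α : E i j) :
    π.e l * π.f α = if l = j then π.f α else 0 := by
  rw [← π.e_f α, ← mul_assoc, π.orth]
  split_ifs with h
  · subst h; rfl
  · simp

theorem e_mul_g (π : PreprojectivePresentation k V E A) (l : V) {i j : V} (α : E i j) :
    π.e l * π.g α = if l = i then π.g α else 0 := by
  rw [← π.e_g α, ← mul_assoc, π.orth]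
  split_ifs with h
  · subst h; rfl
  · simp

theorem f_mul_e (π : PreprojectivePresentation k V E A) (l : V) {i j : V} (α : E i j) :
    π.f α * π.e l = if i = l then π.f α else 0 := by
  rw [← π.f_e α, mul_assoc, π.orth]
  split_ifs with h
  · rfl
  · simp

theorem g_mul_e (π : PreprojectivePresentation k V E A) (l : V) {i j : V} (α : E i j) :
    π.g α * π.e l = if j = l then π.g α else 0 := by
  rw [← π.g_e α, mul_assoc, π.orth]
  split_ifs with h
  · rfl
  · simp

theorem spanE_mul_spanS (π : PreprojectivePresentation k V E A) : spanE π * spanS π = spanS π := by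
  apply le_antisymm
  · rw [spanE, spanS, Submodule.span_mul_span, Submodule.span_le]
    rintro _ ⟨_, ⟨l, rfl⟩, _, ⟨i, j, α, rfl | rfl⟩, rfl⟩
    · change π.e l * π.f α ∈ _
      rw [e_mul_f]
      split_ifs
      · exact Submodule.subset_span ⟨i, j, α, Or.inl rfl⟩
      · exact Submodule.zero_mem _
    · change π.e l * π.g α ∈ _
      rw [e_mul_g]
      split_ifs
      · exact Submodule.subset_span ⟨i, j, α, Or.inr rfl⟩
      · exact Submodule.zero_mem _
  · calc spanS π = 1 * spanS π := (one_mul _).symm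
      _ ≤ _ := mul_le_mul' (one_le_spanE π) le_rfl

theorem spanS_mul_spanE (π : PreprojectivePresentation k V E A) : spanS π * spanE π = spanS π := by
  apply le_antisymm
  · rw [spanE, spanS, Submodule.span_mul_span, Submodule.span_le]
    rintro _ ⟨_, ⟨i, j, α, rfl | rfl⟩, _, ⟨l, rfl⟩, rfl⟩
    · change π.f α * π.e l ∈ _
      rw [f_mul_e]
      split_ifs
      · exact Submodule.subset_span ⟨i, j, α, Or.inl rfl⟩
      · exact Submodule.zero_mem _
    · change π.g α * π.e l ∈ _
      rw [g_mul_e]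
      split_ifs
      · exact Submodule.subset_span ⟨i, j, α, Or.inr rfl⟩
      · exact Submodule.zero_mem _
  · calc spanS π = spanS π * 1 := (mul_one _).symm
      _ ≤ _ := mul_le_mul' le_rfl (one_le_spanE π)

/-- The degree `m` component. -/
def degComp (π : PreprojectivePresentation k V E A) (m : ℕ) : Submodule k A :=
  spanE π * spanS π ^ m

theorem degComp_mul (π : PreprojectivePresentation k V E A) (a b : ℕ) :
    degComp π a * degComp π b = degComp π (a + b) := by
  have hc : Commute (spanE π) (spanS π) := by
    rw [Commute, SemiconjBy, spanE_mul_spanS, spanS_mul_spanE]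
  have hca := (hc.pow_right a).eq
  simp only [degComp]
  calc spanE π * spanS π ^ a * (spanE π * spanS π ^ b)
      = spanE π * (spanS π ^ a * spanE π) * spanS π ^ b := by simp only [mul_assoc]
    _ = (spanE π * spanE π) * (spanS π ^ a * spanS π ^ b) := by
        rw [← hca]; simp only [mul_assoc]
    _ = _ := by rw [spanE_mul_spanE, pow_add]

theorem degComp_fg (π : PreprojectivePresentation k V E A) (m : ℕ) : (degComp π m).FG :=
  (spanE_fg π).mul ((spanS_fg π).pow m)

theorem finite_of_posDef
    (π : PreprojectivePresentation k V E A)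
    (hgen : Algebra.adjoin k
      (Set.range π.e ∪ {a | ∃ (i j : V) (α : E i j), a = π.f α ∨ a = π.g α}) = ⊤)
    (ψ : A →ₐ[k] A[X]) (he : ∀ i, ψ (π.e i) = C (π.e i))
    (hf : ∀ (i j : V) (α : E i j), ψ (π.f α) = C (π.f α) * X)
    (hg : ∀ (i j : V) (α : E i j), ψ (π.g α) = C (π.g α) * X)
    (hdyn : IsDynkin V E) : FiniteDimensional k A := by
  classical
  -- left inverse of ψ
  have hinj : ∀ a, ψ a = 0 → a = 0 := by
    have : ∀ a, eval₂RingHom' (RingHom.id A) 1 (fun a => Commute.one_right _) (ψ a) = a := by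
      refine adjoin_ind π hgen _ ?_ ?_ ?_ ?_ ?_ ?_
      · intro i; rw [he]; simp [eval₂RingHom']
      · intro i j α; rw [hf]; simp [eval₂RingHom']
      · intro i j α; rw [hg]; simp [eval₂RingHom']
      · intro r
        rw [AlgHom.commutes, Polynomial.algebraMap_apply]; simp [eval₂RingHom']
      · intro x y hx hy; rw [map_add, map_add, hx, hy]
      · intro x y hx hy; rw [map_mul, map_mul, hx, hy]
    intro a ha
    rw [← this a, ha, map_zero]
  -- coefficients lie in finite dimensional spaces
  have hcoef : ∀ a, ∀ m, (ψ a).coeff m ∈ degComp π m := by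
    have hE : ∀ x ∈ spanE π, ∀ m, (C x : A[X]).coeff m ∈ degComp π m := by
      intro x hx m
      rw [coeff_C]
      split_ifs with h
      · subst h; simpa [degComp] using hx
      · exact Submodule.zero_mem _
    have hS : ∀ x ∈ spanS π, ∀ m, (C x * X : A[X]).coeff m ∈ degComp π m := by
      intro x hx m
      rw [coeff_C_mul_X]
      split_ifs with h
      · subst h; simpa [degComp, spanE_mul_spanS] using hx
      · exact Submodule.zero_mem _
    refine adjoin_ind π hgen _ ?_ ?_ ?_ ?_ ?_ ?_
    · intro i; rw [he]; exact hE _ (Submodule.subset_span ⟨i, rfl⟩)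
    · intro i j α; rw [hf]; exact hS _ (Submodule.subset_span ⟨i, j, α, Or.inl rfl⟩)
    · intro i j α; rw [hg]; exact hS _ (Submodule.subset_span ⟨i, j, α, Or.inr rfl⟩)
    · intro r
      rw [AlgHom.commutes, Polynomial.algebraMap_apply]
      refine hE _ ?_
      rw [Algebra.algebraMap_eq_smul_one]
      exact Submodule.smul_mem _ _ (one_mem_spanE π)
    · intro x y hx hy m
      rw [map_add, coeff_add]; exact Submodule.add_mem _ (hx m) (hy m)
    · intro x y hx hy m
      rw [map_mul, coeff_mul]
      refine Submodule.sum_mem _ fun p hp => ?_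
      rw [← Finset.HasAntidiagonal.mem_antidiagonal.1 hp, ← degComp_mul]
      exact Submodule.mul_mem_mul (hx _) (hy _)
  -- the filtration
  let r : ℕ → Submodule A A := fun n =>
    { carrier := {a | ∀ m < n, (ψ a).coeff m = 0}
      add_mem' := by
        intro a b ha hb m hm
        rw [map_add, coeff_add, ha m hm, hb m hm, add_zero]
      zero_mem' := by intro m _; simp
      smul_mem' := by
        intro c a ha m hm
        rw [smul_eq_mul, map_mul, coeff_mul]
        refine Finset.sum_eq_zero fun p hp => ?_
        have := Finset.HasAntidiagonal.mem_antidiagonal.1 hp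
        rw [ha p.2 (by omega), mul_zero] }
  have hr : ∀ n a, a ∈ r n ↔ ∀ m < n, (ψ a).coeff m = 0 := fun n a => Iff.rfl
  have hfd : ∀ n, FiniteDimensional k (A ⧸ r n) := by
    intro n
    haveI : ∀ m, FiniteDimensional k (degComp π m) := fun m =>
      Module.Finite.iff_fg.2 (degComp_fg π m)
    let T : A →ₗ[k] (∀ m : Fin n, degComp π m) :=
      { toFun := fun a m => ⟨(ψ a).coeff m, hcoef a m⟩
        map_add' := fun a b => by funext m; ext; simp
        map_smul' := fun c a => by funext m; ext; simp }
    have hker : LinearMap.ker T = (r n).restrictScalars k := by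
      ext a
      rw [LinearMap.mem_ker, Submodule.restrictScalars_mem, hr]
      constructor
      · intro h m hm
        have := congrArg Subtype.val (congrFun h ⟨m, hm⟩)
        exact this
      · intro h
        funext m; ext
        exact h m m.2
    haveI : FiniteDimensional k (A ⧸ LinearMap.ker T) :=
      Module.Finite.equiv T.quotKerEquivRange.symm
    rw [hker] at this
    exact Module.Finite.equiv (Submodule.Quotient.restrictScalarsEquiv k (r n))
  obtain ⟨N, hN⟩ := bound_of_posDef _ hdyn
  have hbound : ∀ n, Module.finrank k (A ⧸ r n) ≤ N := by
    intro n
    haveI := hfd n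
    have h1 := cyclic_inequality (M := A ⧸ r n) π hgen (Submodule.Quotient.mk 1) (by
      intro m
      obtain ⟨a, rfl⟩ := Submodule.Quotient.mk_surjective _ m
      exact ⟨a, by rw [← Submodule.Quotient.mk_smul, smul_eq_mul, mul_one]⟩)
    rw [finrank_eq_sum (M := A ⧸ r n) π] at h1 ⊢
    have h2 := hN (fun i => (Module.finrank k (vspace π (A ⧸ r n) i) : ℝ)) ?_
    · exact_mod_cast h2
    rw [cartan_form]
    have h3 : (∑ i, (Module.finrank k (vspace π (A ⧸ r n) i) : ℝ) *
        Module.finrank k (vspace π (A ⧸ r n) i)) ≤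
        ∑ i, (Module.finrank k (vspace π (A ⧸ r n) i) : ℝ) +
        ∑ i, ∑ j, (Fintype.card (E i j) : ℝ) * (Module.finrank k (vspace π (A ⧸ r n) i) *
          Module.finrank k (vspace π (A ⧸ r n) j)) := by
      exact_mod_cast h1
    linarith
  have hrank : Module.rank k A ≤ N := by
    refine rank_le fun s hs => ?_
    set n := s.sup (fun a => (ψ a).natDegree) + 1 with hn
    haveI := hfd n
    have hdis : Disjoint (Submodule.span k (Set.range (fun i : s => (i : A))))
        (LinearMap.ker ((r n).mkQ.restrictScalars k)) := by
      rw [Submodule.disjoint_def]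
      intro x hx hx0
      have hxr : x ∈ r n := by
        rw [LinearMap.mem_ker] at hx0
        exact (Submodule.Quotient.mk_eq_zero _).1 hx0
      have hdeg : ∀ m, n ≤ m → (ψ x).coeff m = 0 := by
        clear hx0 hxr
        intro m hm
        induction hx using Submodule.span_induction with
        | mem x h =>
          obtain ⟨i, rfl⟩ := h
          apply coeff_eq_zero_of_natDegree_lt
          have := Finset.le_sup (f := fun a => (ψ a).natDegree) i.2
          simp only at this ⊢
          omega
        | zero => simp
        | add x y _ _ hx hy => rw [map_add, coeff_add, hx, hy, add_zero]
        | smul c x _ hx => rw [map_smul, coeff_smul, hx, smul_zero]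
      apply hinj
      ext m
      rcases lt_or_ge m n with h | h
      · simpa using hxr m h
      · simpa using hdeg m h
    have h1 := hs.map hdis
    have h2 := h1.fintype_card_le_finrank
    rw [Fintype.card_coe] at h2
    exact h2.trans (hbound n)
  exact Module.rank_lt_aleph0_iff.1 (hrank.trans_lt (Cardinal.natCast_lt_aleph0))

end DynkinToFinite

section FiniteToDynkin

set_option linter.unusedSectionVars false

variable {k : Type} [Field k] {V : Type} [Fintype V] [DecidableEq V]
  {E : V → V → Type} [∀ i j, Fintype (E i j)]
  {A : Type} [Ring A] [Algebra k A]

/-- The operator `(c, m) ↦ (l c, c w + a m)` on `k × M`, linear in `(l, w, a)`. -/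
def triOp (k A M : Type) [Field k] [Ring A] [Algebra k A] [AddCommGroup M] [Module k M]
    [Module A M] [IsScalarTower k A M] : (k × M × A) →ₗ[k] Module.End k (k × M) where
  toFun t :=
    { toFun := fun z => (t.1 * z.1, z.1 • t.2.1 + t.2.2 • z.2)
      map_add' := fun z z' => by
        refine Prod.ext ?_ ?_
        · simp [mul_add]
        · simp only [Prod.fst_add, Prod.snd_add, add_smul, smul_add]; abel
      map_smul' := fun c z => by
        refine Prod.ext ?_ ?_
        · simp; ring
        · simp only [Prod.smul_fst, Prod.smul_snd, smul_add, RingHom.id_apply, smul_assoc]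
          rw [smul_algebra_smul_comm c t.2.2] }
  map_add' t t' := by
    refine LinearMap.ext fun z => Prod.ext ?_ ?_
    · simp [add_mul]
    · simp [add_smul]; abel
  map_smul' c t := by
    refine LinearMap.ext fun z => Prod.ext ?_ ?_
    · simp; ring
    · change z.1 • (c • t.2.1) + (c • t.2.2) • z.2 = c • (z.1 • t.2.1 + t.2.2 • z.2)
      rw [smul_add, smul_assoc, smul_comm]

theorem triOp_apply {M : Type} [AddCommGroup M] [Module k M]
    [Module A M] [IsScalarTower k A M] (l : k) (w : M) (a : A) (c : k) (m : M) :
    triOp k A M (l, w, a) (c, m) = (l * c, c • w + a • m) := rfl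

theorem triOp_mul {M : Type} [AddCommGroup M] [Module k M]
    [Module A M] [IsScalarTower k A M] (l l' : k) (w w' : M) (a a' : A) :
    triOp k A M (l, w, a) * triOp k A M (l', w', a') =
      triOp k A M (l * l', l' • w + a • w', a * a') := by
  refine LinearMap.ext fun z => ?_
  obtain ⟨c, m⟩ := z
  rw [Module.End.mul_apply, triOp_apply, triOp_apply, triOp_apply]
  refine Prod.ext ?_ ?_
  · simp; ring
  · simp only [smul_add, mul_smul]
    rw [add_assoc, smul_comm l' c w, smul_algebra_smul_comm c a w']

theorem triOp_one {M : Type} [AddCommGroup M] [Module k M]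
    [Module A M] [IsScalarTower k A M] : triOp k A M (1, 0, 1) = 1 := by
  refine LinearMap.ext fun z => ?_
  obtain ⟨c, m⟩ := z
  rw [triOp_apply]; simp

/-- Arrows of the double quiver starting at `j`. -/
abbrev Ar (E : V → V → Type) (j : V) : Type := (Σ y, E j y) ⊕ (Σ y, E y j)

/-- The target of an arrow. -/
def Ar.t {j : V} : Ar E j → V
  | Sum.inl z => z.1
  | Sum.inr z => z.1

/-- The element of an arrow. -/
def Ar.el (π : PreprojectivePresentation k V E A) {j : V} : Ar E j → A
  | Sum.inl z => π.f z.2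
  | Sum.inr z => π.g z.2

/-- The signed element of the opposite arrow. -/
def Ar.bar (π : PreprojectivePresentation k V E A) {j : V} : Ar E j → A
  | Sum.inl z => - π.g z.2
  | Sum.inr z => π.f z.2

theorem Ar.e_el (π : PreprojectivePresentation k V E A) {j : V} (a : Ar E j) :
    π.e (Ar.t a) * Ar.el π a = Ar.el π a := by
  rcases a with z | z
  · exact π.e_f _
  · exact π.e_g _

theorem Ar.el_e (π : PreprojectivePresentation k V E A) {j : V} (a : Ar E j) :
    Ar.el π a * π.e j = Ar.el π a := by
  rcases a with z | z
  · exact π.f_e _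
  · exact π.g_e _

theorem Ar.e_bar (π : PreprojectivePresentation k V E A) {j : V} (a : Ar E j) :
    π.e j * Ar.bar π a = Ar.bar π a := by
  rcases a with z | z
  · simp [Ar.bar, π.e_g]
  · exact π.e_f _

theorem Ar.bar_e (π : PreprojectivePresentation k V E A) {j : V} (a : Ar E j) :
    Ar.bar π a * π.e (Ar.t a) = Ar.bar π a := by
  rcases a with z | z
  · simp [Ar.bar, Ar.t, π.g_e]
  · exact π.f_e _

open Classical in
/-- Generator corresponding to a forward arrow. -/
noncomputable def genU (π : PreprojectivePresentation k V E A) (j : V) {i l : V} (α : E i l) :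
    Ar E j → A
  | Sum.inl z => if (⟨j, z⟩ : Σ i, Σ l, E i l) = ⟨i, l, α⟩ then π.e z.1 else 0
  | Sum.inr _ => 0

open Classical in
/-- Generator corresponding to a backward arrow. -/
noncomputable def genW (π : PreprojectivePresentation k V E A) (j : V) {i l : V} (α : E i l) :
    Ar E j → A
  | Sum.inl _ => 0
  | Sum.inr z => if (⟨z.1, j, z.2⟩ : Σ i, Σ l, E i l) = ⟨i, l, α⟩ then π.e z.1 else 0

theorem genU_ne (π : PreprojectivePresentation k V E A) (j : V) {i l : V} (α : E i l)
    (h : i ≠ j) : genU π j α = 0 := by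
  funext a
  rcases a with z | z
  · simp only [genU]
    rw [if_neg]; rfl
    intro h2
    exact h (congrArg Sigma.fst h2).symm
  · rfl

theorem genW_ne (π : PreprojectivePresentation k V E A) (j : V) {i l : V} (α : E i l)
    (h : l ≠ j) : genW π j α = 0 := by
  funext a
  rcases a with z | z
  · rfl
  · simp only [genW]
    rw [if_neg]; rfl
    intro h2
    exact h (congrArg (fun z : (Σ i, Σ l, E i l) => z.2.1) h2).symm

theorem e_genU (π : PreprojectivePresentation k V E A) (j : V) {i l : V} (α : E i l) :
    π.e l • genU π j α = genU π j α := by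
  funext a
  rcases a with z | z
  · simp only [Pi.smul_apply, genU]
    split_ifs with h
    · have : z.1 = l := congrArg (fun z : (Σ i, Σ l, E i l) => z.2.1) h
      rw [this, smul_eq_mul, π.e_e]
    · simp
  · simp [genU]

theorem e_genW (π : PreprojectivePresentation k V E A) (j : V) {i l : V} (α : E i l) :
    π.e i • genW π j α = genW π j α := by
  funext a
  rcases a with z | z
  · simp [genW]
  · simp only [Pi.smul_apply, genW]
    split_ifs with h
    · have : z.1 = i := congrArg Sigma.fst h
      rw [this, smul_eq_mul, π.e_e]
    · simp

/-- The relation submodule. -/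
def relSub (π : PreprojectivePresentation k V E A) (j : V) : Submodule A (Ar E j → A) :=
  Submodule.span A {Ar.bar π}

theorem mesh_gen (π : PreprojectivePresentation k V E A) (j x : V) :
    (∑ y, ∑ β : E y x, π.f β • genW π j β) - ∑ y, ∑ α : E x y, π.g α • genU π j α
      ∈ relSub π j := by
  classical
  by_cases hx : x = j
  · subst hx
    have : (∑ y, ∑ β : E y x, π.f β • genW π x β) - ∑ y, ∑ α : E x y, π.g α • genU π x α
        = Ar.bar π := by
      funext a
      rw [Pi.sub_apply, Finset.sum_apply, Finset.sum_apply]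
      simp only [Finset.sum_apply, Pi.smul_apply]
      rcases a with ⟨y, γ⟩ | ⟨y, γ⟩
      · simp only [genW, genU, smul_zero, Finset.sum_const_zero, zero_sub, Ar.bar]
        rw [Finset.sum_eq_single y, Finset.sum_eq_single γ]
        · simp [π.g_e]
        · intro δ _ hδ
          rw [if_neg, smul_zero]
          intro h
          simp at h
          exact hδ h.symm
        · simp
        · intro y' _ hy'
          refine Finset.sum_eq_zero fun δ _ => ?_
          rw [if_neg, smul_zero]
          intro h
          exact hy' (congrArg (fun z : (Σ i, Σ l, E i l) => z.2.1) h).symm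
        · simp
      · simp only [genW, genU, smul_zero, Finset.sum_const_zero, sub_zero, Ar.bar]
        rw [Finset.sum_eq_single y, Finset.sum_eq_single γ]
        · simp [π.f_e]
        · intro δ _ hδ
          rw [if_neg, smul_zero]
          intro h
          simp at h
          exact hδ h.symm
        · simp
        · intro y' _ hy'
          refine Finset.sum_eq_zero fun δ _ => ?_
          rw [if_neg, smul_zero]
          intro h
          exact hy' (congrArg Sigma.fst h).symm
        · simp
    rw [this]
    exact Submodule.mem_span_singleton_self _
  · have h1 : ∀ y (β : E y x), genW π j β = 0 := fun y β => genW_ne π j β hx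
    have h2 : ∀ y (α : E x y), genU π j α = 0 := fun y α => genU_ne π j α hx
    simp [h1, h2]

/-- The module over the preprojective algebra extending the simple at `j`. -/
noncomputable def extPres (π : PreprojectivePresentation k V E A) (j : V) :
    PreprojectivePresentation k V E
      (Module.End k (k × ((Ar E j → A) ⧸ relSub π j))) where
  e i := triOp k A _ (if i = j then 1 else 0, 0, π.e i)
  f _ _ α := triOp k A _ (0, (relSub π j).mkQ (genU π j α), π.f α)
  g _ _ α := triOp k A _ (0, (relSub π j).mkQ (genW π j α), π.g α)
  orth i l := by
    rw [triOp_mul, π.orth]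
    by_cases h : i = l
    · subst h
      by_cases h1 : i = j <;> simp [h1]
    · rw [if_neg h, if_neg h]
      have : ((if i = j then 1 else 0) * (if l = j then 1 else 0) : k) = 0 := by
        by_cases h1 : i = j
        · rw [if_neg (fun h2 : l = j => h (h1.trans h2.symm)), mul_zero]
        · rw [if_neg h1, zero_mul]
      rw [this, smul_zero, smul_zero, add_zero]
      exact map_zero (triOp k A _)
  sum_one := by
    rw [← map_sum, ← triOp_one (k := k) (A := A)]
    congr 1
    refine Prod.ext ?_ (Prod.ext ?_ ?_)
    · simp [Prod.fst_sum]
    · simp [Prod.fst_sum, Prod.snd_sum]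
    · simp [Prod.snd_sum, π.sum_one]
  f_idem i l α := by
    rw [triOp_mul, triOp_mul, π.f_idem, mul_zero, zero_mul, smul_zero, smul_zero,
      zero_add, add_zero, ← map_smul, e_genU]
    by_cases h : i = j
    · rw [if_pos h, one_smul]
    · rw [if_neg h, zero_smul, genU_ne π j α h, map_zero]
  g_idem i l α := by
    rw [triOp_mul, triOp_mul, π.g_idem, mul_zero, zero_mul, smul_zero, smul_zero,
      zero_add, add_zero, ← map_smul, e_genW]
    by_cases h : l = j
    · rw [if_pos h, one_smul]
    · rw [if_neg h, zero_smul, genW_ne π j α h, map_zero]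
  mesh x := by
    simp only [triOp_mul, ← map_sum, ← map_sub]
    have h0 := (Submodule.Quotient.mk_eq_zero _).2 (mesh_gen π j x)
    have h1 : (relSub π j).mkQ ((∑ y, ∑ β : E y x, π.f β • genW π j β)
      - ∑ y, ∑ α : E x y, π.g α • genU π j α) = 0 := h0
    rw [map_sub, map_sum, map_sum] at h1
    simp only [map_sum, map_smul] at h1
    rw [← map_zero (triOp k A _)]
    congr 1
    refine Prod.ext ?_ (Prod.ext ?_ ?_)
    · simp [Prod.fst_sum]
    · simpa [Prod.fst_sum, Prod.snd_sum] using h1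
    · simpa [Prod.fst_sum, Prod.snd_sum] using π.mesh x

/-- The projective `A e_i`. -/
def proj (π : PreprojectivePresentation k V E A) (i : V) : Submodule k A :=
  LinearMap.range (LinearMap.mulRight k (π.e i))

theorem mem_proj (π : PreprojectivePresentation k V E A) (i : V) (a : A) :
    a ∈ proj π i ↔ a * π.e i = a := by
  constructor
  · rintro ⟨b, rfl⟩
    simp [mul_assoc, π.e_e]
  · intro h; exact ⟨a, h⟩

/-- Right multiplication map between projectives. -/
def projMap (π : PreprojectivePresentation k V E A) (i l : V) (b : A) (hb : b * π.e l = b) :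
    proj π i →ₗ[k] proj π l :=
  ((LinearMap.mulRight k b).comp (proj π i).subtype).codRestrict _ (fun a => by
    rw [mem_proj]
    change (a : A) * b * π.e l = a * b
    rw [mul_assoc, hb])

@[simp] theorem projMap_coe (π : PreprojectivePresentation k V E A) (i l : V) (b : A)
    (hb : b * π.e l = b) (a : proj π i) : (projMap π i l b hb a : A) = a * b := rfl

theorem proj_inequality [FiniteDimensional k A] (π : PreprojectivePresentation k V E A)
    (hgen : Algebra.adjoin k
      (Set.range π.e ∪ {a | ∃ (i j : V) (α : E i j), a = π.f α ∨ a = π.g α}) = ⊤)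
    (j : V) (ψ : A →ₐ[k] Module.End k (k × ((Ar E j → A) ⧸ relSub π j)))
    (he : ∀ i, ψ (π.e i) = (extPres π j).e i)
    (hf : ∀ (i l : V) (α : E i l), ψ (π.f α) = (extPres π j).f α)
    (hg : ∀ (i l : V) (α : E i l), ψ (π.g α) = (extPres π j).g α) :
    ∑ a : Ar E j, Module.finrank k (proj π (Ar.t a)) + 1 ≤ 2 * Module.finrank k (proj π j) := by
  classical
  have hψ : ∀ a : A, ∃ l w, ψ a = triOp k A _ (l, w, a) := by
    refine adjoin_ind π hgen _ ?_ ?_ ?_ ?_ ?_ ?_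
    · intro i; exact ⟨_, _, he i⟩
    · intro i l α; exact ⟨_, _, hf i l α⟩
    · intro i l α; exact ⟨_, _, hg i l α⟩
    · intro r
      refine ⟨r, 0, ?_⟩
      rw [AlgHom.commutes, Algebra.algebraMap_eq_smul_one, ← triOp_one (k := k) (A := A),
        ← map_smul]
      congr 1
      refine Prod.ext ?_ (Prod.ext ?_ ?_)
      · simp
      · simp
      · simp [Algebra.algebraMap_eq_smul_one]
    · rintro x y ⟨l, w, hx⟩ ⟨l', w', hy⟩
      exact ⟨l + l', w + w', by rw [map_add, hx, hy, ← map_add]; rfl⟩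
    · rintro x y ⟨l, w, hx⟩ ⟨l', w', hy⟩
      exact ⟨_, _, by rw [map_mul, hx, hy, triOp_mul]⟩
  have hψ0 : ∀ (a : A) m, ψ a (0, m) = (0, a • m) := by
    intro a m
    obtain ⟨l, w, h⟩ := hψ a
    rw [h, triOp_apply]; simp
  have hel : ∀ a : Ar E j, ψ (Ar.el π a) (1, 0) =
      (0, (relSub π j).mkQ (Pi.single a (π.e (Ar.t a)))) := by
    rintro (⟨y, γ⟩ | ⟨y, γ⟩)
    · change ψ (π.f γ) (1, 0) = _
      rw [hf]
      change triOp k A _ (0, (relSub π j).mkQ (genU π j γ), π.f γ) (1, 0) = _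
      rw [triOp_apply]
      have : genU π j γ = Pi.single (Sum.inl ⟨y, γ⟩) (π.e y) := by
        funext a
        rcases a with ⟨y', γ'⟩ | ⟨y', γ'⟩
        · simp only [genU, Pi.single_apply]
          by_cases h : (⟨y', γ'⟩ : Σ y, E j y) = ⟨y, γ⟩
          · cases h; simp
          · rw [if_neg, if_neg]
            · simpa using h
            · simpa using h
        · simp [genU]
      rw [this]; simp [Ar.t]
    · change ψ (π.g γ) (1, 0) = _
      rw [hg]
      change triOp k A _ (0, (relSub π j).mkQ (genW π j γ), π.g γ) (1, 0) = _
      rw [triOp_apply]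
      have : genW π j γ = Pi.single (Sum.inr ⟨y, γ⟩) (π.e y) := by
        funext a
        rcases a with ⟨y', γ'⟩ | ⟨y', γ'⟩
        · simp [genW]
        · simp only [genW, Pi.single_apply]
          by_cases h : (⟨y', γ'⟩ : Σ y, E y j) = ⟨y, γ⟩
          · cases h; simp
          · rw [if_neg, if_neg]
            · simpa using h
            · intro h2
              apply h
              have h3 := congrArg Sigma.fst h2
              simp only at h3
              subst h3
              simpa using h2
      rw [this]; simp [Ar.t]
  let Φ : (∀ a : Ar E j, proj π (Ar.t a)) →ₗ[k] proj π j :=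
    ∑ a, (projMap π (Ar.t a) j (Ar.el π a) (Ar.el_e π a)) ∘ₗ LinearMap.proj a
  have hΦ : ∀ x, (Φ x : A) = ∑ a, (x a : A) * Ar.el π a := by
    intro x; simp [Φ, LinearMap.sum_apply]
  have hψΦ : ∀ x, ψ (Φ x) (1, 0) = (0, (relSub π j).mkQ (fun a => (x a : A))) := by
    intro x
    have h1 : (fun a => (x a : A)) = ∑ a, (x a : A) • Pi.single a (π.e (Ar.t a)) := by
      funext b
      rw [Finset.sum_apply, Finset.sum_eq_single b]
      · simp [(mem_proj π _ _).1 (x b).2]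
      · intro c _ hc; simp [hc.symm]
      · simp
    rw [hΦ, map_sum, LinearMap.sum_apply, h1, map_sum]
    simp only [map_mul, Module.End.mul_apply, hel, hψ0, map_smul]
    refine Prod.ext ?_ ?_
    · simp [Prod.fst_sum]
    · simp [Prod.snd_sum]
  let Ψ : proj π j →ₗ[k] (∀ a : Ar E j, proj π (Ar.t a)) :=
    LinearMap.pi fun a => projMap π j (Ar.t a) (Ar.bar π a) (Ar.bar_e π a)
  have hker : LinearMap.ker Φ ≤ LinearMap.range Ψ := by
    intro x hx
    rw [LinearMap.mem_ker] at hx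
    have h1 := hψΦ x
    rw [hx] at h1
    have h2 : (relSub π j).mkQ (fun a => (x a : A)) = 0 := by
      have := congrArg Prod.snd h1
      simpa using this.symm
    have h3 : (fun a => (x a : A)) ∈ relSub π j := (Submodule.Quotient.mk_eq_zero _).1 h2
    obtain ⟨y, hy⟩ := Submodule.mem_span_singleton.1 h3
    refine ⟨⟨y * π.e j, (mem_proj π j _).2 (by rw [mul_assoc, π.e_e])⟩, ?_⟩
    funext a
    ext
    have := congrFun hy a
    simp only [Pi.smul_apply, smul_eq_mul] at this
    change y * π.e j * Ar.bar π a = _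
    rw [mul_assoc, Ar.e_bar, this]
  have hlt : LinearMap.range Φ < ⊤ := by
    rw [lt_top_iff_ne_top]
    intro htop
    have : (⟨π.e j, (mem_proj π j _).2 (π.e_e j)⟩ : proj π j) ∈ LinearMap.range Φ := by
      rw [htop]; trivial
    obtain ⟨x, hx⟩ := this
    have h1 := hψΦ x
    rw [hx] at h1
    change ψ (π.e j) (1, 0) = _ at h1
    rw [he] at h1
    change triOp k A _ (if j = j then 1 else 0, 0, π.e j) (1, 0) = _ at h1
    rw [triOp_apply] at h1
    have := congrArg Prod.fst h1
    simp at this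
  have r1 := LinearMap.finrank_range_add_finrank_ker Φ
  have r2 := Submodule.finrank_mono hker
  have r3 := LinearMap.finrank_range_le Ψ
  have r4 := Submodule.finrank_lt hlt.ne
  rw [Module.finrank_pi_fintype] at r1
  omega

theorem dynkin_of_ineq (d : V → ℕ)
    (h : ∀ j, ∑ a : Ar E j, d (Ar.t a) + 1 ≤ 2 * d j) : IsDynkin V E := by
  unfold IsDynkin
  refine posDef_of_positive_vector _ ?_ ?_ (fun i => (d i : ℝ)) ?_ ?_
  · intro i j
    simp only [Matrix.map_apply, cartanMatrix, eq_comm (a := i) (b := j)]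
    push_cast; ring
  · intro i j hij
    simp only [Matrix.map_apply, cartanMatrix, if_neg hij]
    push_cast
    have h1 : (0 : ℝ) ≤ Fintype.card (E i j) := Nat.cast_nonneg _
    have h2 : (0 : ℝ) ≤ Fintype.card (E j i) := Nat.cast_nonneg _
    linarith
  · intro i
    have := h i
    have h2 : 0 < d i := by omega
    exact_mod_cast h2
  · intro i
    have hi := h i
    rw [Fintype.sum_sum_type, Fintype.sum_sigma, Fintype.sum_sigma] at hi
    simp only [Ar.t, Finset.sum_const, Finset.card_univ, smul_eq_mul] at hi
    have hi' : ∑ y, (Fintype.card (E i y) : ℝ) * d y + ∑ y, (Fintype.card (E y i) : ℝ) * d y + 1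
        ≤ 2 * d i := by exact_mod_cast hi
    have e1 : ∑ j, ((cartanMatrix V E).map ((↑) : ℤ → ℝ)) i j * (d j : ℝ) =
        2 * d i - ∑ y, (Fintype.card (E i y) : ℝ) * d y
          - ∑ y, (Fintype.card (E y i) : ℝ) * d y := by
      have : ∀ j, ((cartanMatrix V E).map ((↑) : ℤ → ℝ)) i j * (d j : ℝ) =
          (if i = j then 2 * (d j : ℝ) else 0) - (Fintype.card (E i j) : ℝ) * d j
            - (Fintype.card (E j i) : ℝ) * d j := by
        intro j
        simp only [Matrix.map_apply, cartanMatrix]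
        split_ifs <;> push_cast <;> ring
      simp only [this, Finset.sum_sub_distrib]
      simp
    rw [e1]; linarith

end FiniteToDynkin

/-- Let `P_Q = A` be the preprojective algebra of a finite acyclic connected
quiver `Q = (V, E)` (presented by the double quiver modulo mesh relations, expressed via the
universal property `hU` and generation `hgen`).  Then `A` is finite-dimensional if and only
if `Q` is of Dynkin (ADE) type. -/
theorem preprojective_finiteDimensional_iff_dynkin
    (k : Type) [Field k]
    (V : Type) [Fintype V] [DecidableEq V]
    (E : V → V → Type) [∀ i j, Fintype (E i j)]
    (hacyclic : QuiverAcyclic V E) (hconn : QuiverConnected V E)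
    (A : Type) [Ring A] [Algebra k A]
    (π : PreprojectivePresentation k V E A)
    (hgen : Algebra.adjoin k
      (Set.range π.e ∪ {a | ∃ (i j : V) (α : E i j), a = π.f α ∨ a = π.g α}) = ⊤)
    (hU : ∀ (B : Type) [Ring B] [Algebra k B]
      (ρ : PreprojectivePresentation k V E B),
      ∃! ψ : A →ₐ[k] B, (∀ i, ψ (π.e i) = ρ.e i) ∧
        (∀ (i j : V) (α : E i j), ψ (π.f α) = ρ.f α) ∧
        (∀ (i j : V) (α : E i j), ψ (π.g α) = ρ.g α)) :
    FiniteDimensional k A ↔ IsDynkin V E := by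
  constructor
  · intro hfin
    refine dynkin_of_ineq (fun i => Module.finrank k (proj π i)) fun j => ?_
    obtain ⟨ψ, ⟨he, hf, hg⟩, -⟩ := hU _ (extPres π j)
    exact proj_inequality π hgen j ψ he hf hg
  · intro hdyn
    obtain ⟨ψ, ⟨he, hf, hg⟩, -⟩ := hU _ (gradedPres π)
    exact finite_of_posDef π hgen ψ he hf hg hdyn
end

section
/- If Q is a Dynkin quiver then the preprojective algebra P_Q is self-injective, and if Q is not of Dynkin type then P_Q has global dimension two. -/
open scoped BigOperators

open CategoryTheory CategoryTheory.Limits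

/-- An object has projective dimension at most `n`: it admits a projective resolution
vanishing in degrees above `n`. -/
def pdLe {C : Type 1} [Category C] [Abelian C] (n : ℕ) (M : C) : Prop :=
  ∃ P : ProjectiveResolution M, ∀ i : ℕ, n < i → IsZero (P.complex.X i)

open scoped TensorProduct

section
open scoped ZeroObject
variable {C : Type 1} [Category C] [Abelian C]

noncomputable def res2X (P0 P1 P2 : C) : ℕ → C
  | 0 => P0
  | 1 => P1
  | 2 => P2
  | _ => 0

noncomputable def res2d {P0 P1 P2 : C} (d2 : P2 ⟶ P1) (d1 : P1 ⟶ P0) :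
    ∀ n, res2X P0 P1 P2 (n + 1) ⟶ res2X P0 P1 P2 n
  | 0 => d1
  | 1 => d2
  | _ + 2 => (0 : (0 : C) ⟶ _)

theorem res2d_sq {P0 P1 P2 : C} (d2 : P2 ⟶ P1) (d1 : P1 ⟶ P0) (w : d2 ≫ d1 = 0) :
    ∀ n, res2d d2 d1 (n + 1) ≫ res2d d2 d1 n = 0
  | 0 => w
  | 1 => zero_comp
  | _ + 2 => zero_comp

noncomputable def res2C {P0 P1 P2 : C} (d2 : P2 ⟶ P1) (d1 : P1 ⟶ P0) (w : d2 ≫ d1 = 0) :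
    ChainComplex C ℕ := ChainComplex.of (res2X P0 P1 P2) (res2d d2 d1) (res2d_sq d2 d1 w)

theorem res2C_d {P0 P1 P2 : C} (d2 : P2 ⟶ P1) (d1 : P1 ⟶ P0) (w : d2 ≫ d1 = 0) (n : ℕ) :
    (res2C d2 d1 w).d (n + 1) n = res2d d2 d1 n := ChainComplex.of_d _ _ _

theorem pdLe_two_of {M P0 P1 P2 : C} [Projective P0] [Projective P1] [Projective P2]
    (d2 : P2 ⟶ P1) (d1 : P1 ⟶ P0) (f : P0 ⟶ M) (w : d2 ≫ d1 = 0) (w' : d1 ≫ f = 0)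
    [Mono d2] [Epi f] (h1 : (ShortComplex.mk d2 d1 w).Exact)
    (h0 : (ShortComplex.mk d1 f w').Exact) : pdLe 2 M := by
  refine ⟨{ complex := res2C d2 d1 w
            projective := ?_
            π := (ChainComplex.toSingle₀Equiv _ _).symm ⟨f, ?_⟩
            quasiIso := ⟨fun n => ?_⟩ }, ?_⟩
  · rintro (_ | _ | _ | n)
    · exact (inferInstance : Projective P0)
    · exact (inferInstance : Projective P1)
    · exact (inferInstance : Projective P2)
    · exact (inferInstance : Projective (0 : C))
  · rw [res2C_d]; exact w'
  · cases n with
    | zero =>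
      rw [ChainComplex.quasiIsoAt₀_iff, ShortComplex.quasiIso_iff_of_zeros']
      · have : ∀ (a : (res2C d2 d1 w).X 1 ⟶ (res2C d2 d1 w).X 0) (b : (res2C d2 d1 w).X 0 ⟶ M)
          (hab : a ≫ b = 0), a = d1 → b = f → (ShortComplex.mk a b hab).Exact ∧ Epi b := by
          intro a b hab ha hb; replace ha := ha.symm; replace hb := hb.symm; subst ha hb; exact ⟨h0, by assumption⟩
        exact this _ _ _ (res2C_d _ _ _ 0) (ChainComplex.toSingle₀Equiv_symm_apply_f_zero _ _)
      all_goals rfl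
    | succ n =>
      rw [quasiIsoAt_iff_exactAt']
      · rw [HomologicalComplex.exactAt_iff' _ (n + 1 + 1) (n + 1) n (by simp) (by simp)]
        have : ∀ (a : (res2C d2 d1 w).X (n + 1 + 1) ⟶ (res2C d2 d1 w).X (n + 1))
          (b : (res2C d2 d1 w).X (n + 1) ⟶ (res2C d2 d1 w).X n) (hab : a ≫ b = 0),
          a = res2d d2 d1 (n + 1) → b = res2d d2 d1 n → (ShortComplex.mk a b hab).Exact := by
          rcases n with _ | _ | n
          · intro a b hab ha hb; replace ha := ha.symm; replace hb := hb.symm; subst ha hb; exact h1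
          · intro a b hab ha hb; replace ha := ha.symm; replace hb := hb.symm; subst ha hb
            rw [ShortComplex.exact_iff_mono _ rfl]
            exact ‹Mono d2›
          · intro a b hab ha hb
            apply ShortComplex.exact_of_isZero_X₂
            exact isZero_zero C
        exact this _ _ _ (res2C_d _ _ _ _) (res2C_d _ _ _ _)
      · apply ChainComplex.exactAt_succ_single_obj
  · rintro (_ | _ | _ | n) hn
    · omega
    · omega
    · omega
    · exact isZero_zero C
end



structure DQ (k V D : Type) [Field k] where
  s : D → V
  t : D → V
  st : D → D
  st_st : ∀ d, st (st d) = d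
  s_st : ∀ d, s (st d) = t d
  ε : D → k
  ε_ne : ∀ d, ε d ≠ 0

theorem DQ.t_st {k V D : Type} [Field k] (q : DQ k V D) (d : D) : q.t (q.st d) = q.s d := by
  rw [← q.s_st, q.st_st]

structure DRel {k V D : Type} [Field k] [Fintype V] [DecidableEq V] [Fintype D]
    (q : DQ k V D) (B : Type) [Ring B] [Algebra k B] where
  e : V → B
  a : D → B
  orth : ∀ i j, e i * e j = if i = j then e i else 0
  sum_one : ∑ i, e i = 1
  ht : ∀ d, e (q.t d) * a d = a d
  hs : ∀ d, a d * e (q.s d) = a d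
  mesh : ∑ d, q.ε d • (a d * a (q.st d)) = 0

structure DUni {k V D : Type} [Field k] [Fintype V] [DecidableEq V] [Fintype D]
    (q : DQ k V D) (A : Type) [Ring A] [Algebra k A] extends DRel q A where
  gen : Algebra.adjoin k (Set.range e ∪ Set.range a) = ⊤
  univ : ∀ (B : Type) [Ring B] [Algebra k B] (ρ : DRel q B),
    ∃ ψ : A →ₐ[k] B, (∀ i, ψ (e i) = ρ.e i) ∧ (∀ d, ψ (a d) = ρ.a d)

section
variable {k V D : Type} [Field k] [Fintype V] [DecidableEq V] [Fintype D]
  {q : DQ k V D} {A : Type} [Ring A] [Algebra k A]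

theorem DRel.e_a (U : DRel q A) (i : V) (d : D) :
    U.e i * U.a d = if q.t d = i then U.a d else 0 := by
  rw [← U.ht d, ← mul_assoc, U.orth]
  by_cases h : i = q.t d
  · simp [h]
  · simp [h, Ne.symm h]

theorem DRel.a_e (U : DRel q A) (i : V) (d : D) :
    U.a d * U.e i = if q.s d = i then U.a d else 0 := by
  rw [← U.hs d, mul_assoc, U.orth]
  by_cases h : q.s d = i
  · simp [h]
  · simp [h]

theorem DUni.indR (U : DUni q A) (W : Submodule k A) (h1 : 1 ∈ W)
    (he : ∀ x ∈ W, ∀ i, x * U.e i ∈ W) (ha : ∀ x ∈ W, ∀ d, x * U.a d ∈ W) (x : A) : x ∈ W := by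
  have hx : x ∈ Algebra.adjoin k (Set.range U.e ∪ Set.range U.a) := by rw [U.gen]; trivial
  have : ∀ w ∈ W, w * x ∈ W := by
    induction hx using Algebra.adjoin_induction with
    | mem y hy =>
      rcases hy with ⟨i, rfl⟩ | ⟨d, rfl⟩
      · exact fun w hw => he w hw i
      · exact fun w hw => ha w hw d
    | algebraMap r =>
      intro w hw
      rw [← Algebra.commutes, ← Algebra.smul_def]
      exact W.smul_mem _ hw
    | add y z _ _ h1 h2 => intro w hw; rw [mul_add]; exact W.add_mem (h1 w hw) (h2 w hw)
    | mul y z _ _ h1 h2 => intro w hw; rw [← mul_assoc]; exact h2 _ (h1 w hw)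
  simpa using this 1 h1

theorem DUni.indL (U : DUni q A) (W : Submodule k A) (h1 : 1 ∈ W)
    (he : ∀ x ∈ W, ∀ i, U.e i * x ∈ W) (ha : ∀ x ∈ W, ∀ d, U.a d * x ∈ W) (x : A) : x ∈ W := by
  have hx : x ∈ Algebra.adjoin k (Set.range U.e ∪ Set.range U.a) := by rw [U.gen]; trivial
  have : ∀ w ∈ W, x * w ∈ W := by
    induction hx using Algebra.adjoin_induction with
    | mem y hy =>
      rcases hy with ⟨i, rfl⟩ | ⟨d, rfl⟩
      · exact fun w hw => he w hw i
      · exact fun w hw => ha w hw d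
    | algebraMap r =>
      intro w hw
      rw [← Algebra.smul_def]
      exact W.smul_mem _ hw
    | add y z _ _ h1 h2 => intro w hw; rw [add_mul]; exact W.add_mem (h1 w hw) (h2 w hw)
    | mul y z _ _ h1 h2 => intro w hw; rw [mul_assoc]; exact h1 _ (h2 w hw)
  simpa using this 1 h1

/-- The extension construction: a module extension of `M` by `N`. -/
theorem DUni.ext_module (U : DUni q A) (N M : Type) [AddCommGroup N] [Module k N] [Module A N]
    [IsScalarTower k A N] [AddCommGroup M] [Module k M]
    (ρ : DRel q (Module.End k M)) (β : D → M →ₗ[k] N)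
    (ht : ∀ d m, U.e (q.t d) • β d m = β d m)
    (hs : ∀ d m, β d (ρ.e (q.s d) m) = β d m)
    (hm : ∀ m, ∑ d, q.ε d • (U.a d • β (q.st d) m + β d (ρ.a (q.st d) m)) = 0) :
    ∃ δ : A →ₗ[k] M →ₗ[k] N,
      (∀ i m, δ (U.e i) m = 0) ∧
      (∀ y d m, δ (y * U.a d) m = y • β d m + δ y (ρ.a d m)) ∧
      (∀ y i m, δ (y * U.e i) m = δ y (ρ.e i m)) := by
  let L : A →ₐ[k] Module.End k N := Algebra.lsmul k k N
  let R : DRel q (Module.End k (N × M)) :=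
    { e := fun i => LinearMap.prodMap (L (U.e i)) (ρ.e i)
      a := fun d => LinearMap.prod
        ((L (U.a d)).comp (LinearMap.fst k N M) + (β d).comp (LinearMap.snd k N M))
        ((ρ.a d).comp (LinearMap.snd k N M))
      orth := by
        intro i j
        have h1 := U.orth i j
        have h2 := ρ.orth i j
        refine LinearMap.ext fun x => Prod.ext ?_ ?_
        · change U.e i • U.e j • x.1 = _
          rw [smul_smul, h1]; split_ifs <;> simp [L]
        · change (ρ.e i * ρ.e j) x.2 = _
          rw [h2]; split_ifs <;> simp
      sum_one := by
        refine LinearMap.ext fun x => Prod.ext ?_ ?_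
        · simp only [LinearMap.sum_apply, LinearMap.prodMap_apply, Prod.fst_sum]
          change ∑ i, U.e i • x.1 = x.1
          rw [← Finset.sum_smul, U.sum_one, one_smul]
        · simp only [LinearMap.sum_apply, LinearMap.prodMap_apply, Prod.snd_sum]
          rw [← LinearMap.sum_apply, ρ.sum_one]; rfl
      ht := by
        intro d
        refine LinearMap.ext fun x => Prod.ext ?_ ?_
        · change U.e (q.t d) • (U.a d • x.1 + β d x.2) = U.a d • x.1 + β d x.2
          rw [smul_add, smul_smul, U.ht, ht]
        · change (ρ.e (q.t d) * ρ.a d) x.2 = _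
          rw [ρ.ht]; rfl
      hs := by
        intro d
        refine LinearMap.ext fun x => Prod.ext ?_ ?_
        · change U.a d • (U.e (q.s d) • x.1) + β d (ρ.e (q.s d) x.2) = U.a d • x.1 + β d x.2
          rw [smul_smul, U.hs, hs]
        · change (ρ.a d * ρ.e (q.s d)) x.2 = _
          rw [ρ.hs]; rfl
      mesh := by
        refine LinearMap.ext fun x => Prod.ext ?_ ?_
        · simp only [LinearMap.sum_apply, Prod.fst_sum, LinearMap.smul_apply]
          change ∑ d, q.ε d • (U.a d • (U.a (q.st d) • x.1 + β (q.st d) x.2)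
            + β d (ρ.a (q.st d) x.2)) = 0
          have h1 : ∑ d, q.ε d • (U.a d • U.a (q.st d) • x.1) = 0 := by
            have := congrArg (· • x.1) U.mesh
            simpa [Finset.sum_smul, smul_smul] using this
          have h2 := hm x.2
          rw [← add_zero (0 : N)]
          nth_rewrite 1 [← h1]
          rw [← h2, ← Finset.sum_add_distrib]
          refine Finset.sum_congr rfl fun d _ => ?_
          simp only [smul_add, add_assoc]
        · simp only [LinearMap.sum_apply, Prod.snd_sum, LinearMap.smul_apply]
          change ∑ d, q.ε d • ((ρ.a d * ρ.a (q.st d)) x.2) = 0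
          have := congrArg (fun f => f x.2) ρ.mesh
          simpa using this }
  obtain ⟨ψ, hψe, hψa⟩ := U.univ _ R
  have key : ∀ x : A, ∀ n : N, ψ x (n, 0) = (x • n, 0) := by
    intro x
    let W : Submodule k A :=
      { carrier := {x | ∀ n : N, ψ x (n, 0) = (x • n, 0)}
        add_mem' := by
          intro a b ha hb n
          simp only [Set.mem_ofPred_eq] at ha hb
          rw [map_add, LinearMap.add_apply, ha, hb, add_smul]; simp
        zero_mem' := by intro n; simp; rfl
        smul_mem' := by
          intro c a ha n
          simp only [Set.mem_ofPred_eq] at ha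
          rw [map_smul, LinearMap.smul_apply, ha, smul_assoc]; simp }
    refine U.indL W ?_ ?_ ?_ x
    · intro n; simp
    · intro x hx i n
      have hx' : ψ x (n, 0) = (x • n, 0) := hx n
      rw [map_mul, Module.End.mul_apply, hx', hψe]
      refine Prod.ext ?_ ?_
      · change U.e i • x • n = _
        rw [smul_smul]
      · change ρ.e i 0 = 0
        simp
    · intro x hx i n
      have hx' : ψ x (n, 0) = (x • n, 0) := hx n
      rw [map_mul, Module.End.mul_apply, hx', hψa]
      refine Prod.ext ?_ ?_
      · change U.a i • x • n + β i 0 = _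
        rw [smul_smul]; simp
      · change ρ.a i 0 = 0
        simp
  refine ⟨LinearMap.mk₂ k (fun x m => (ψ x (0, m)).1) ?_ ?_ ?_ ?_, ?_, ?_, ?_⟩
  · intros; simp
  · intros; simp
  · intro x m m'
    have : ((0 : N), m + m') = (0, m) + (0, m') := by simp
    rw [this, map_add]; rfl
  · intro c x m
    have : ((0 : N), c • m) = c • (0, m) := by simp
    rw [this, map_smul]; rfl
  · intro i m
    change (ψ (U.e i) (0, m)).1 = 0
    rw [hψe]
    change U.e i • (0 : N) = 0
    simp
  · intro y d m
    change (ψ (y * U.a d) (0, m)).1 = y • β d m + (ψ y (0, ρ.a d m)).1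
    rw [map_mul, Module.End.mul_apply, hψa]
    have : R.a d (0, m) = (β d m, 0) + (0, ρ.a d m) := by
      refine Prod.ext ?_ ?_
      · change U.a d • (0 : N) + β d m = β d m + 0
        simp
      · change ρ.a d m = 0 + ρ.a d m
        simp
    rw [this, map_add, key]; rfl
  · intro y i m
    change (ψ (y * U.e i) (0, m)).1 = (ψ y (0, ρ.e i m)).1
    rw [map_mul, Module.End.mul_apply, hψe]
    have : R.e i (0, m) = (0, ρ.e i m) := by
      refine Prod.ext ?_ ?_
      · change U.e i • (0 : N) = 0
        simp
      · rfl
    rw [this]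

/-- Exactness at the middle for the simple modules. -/
theorem DUni.exact_mid [DecidableEq D] (U : DUni q A) (y : D → A)
    (hy : ∀ d, y d * U.e (q.s d) = y d)
    (h : ∑ d, q.ε d • (y d * U.a (q.st d)) = 0) : ∃ z, ∀ d, y d = z * U.a d := by
  let W : Submodule A (D → A) :=
    { carrier := {w | ∃ z, ∀ d, w d * U.e (q.s d) = q.ε d • (z * U.a d)}
      add_mem' := by
        rintro a b ⟨z, hz⟩ ⟨z', hz'⟩
        exact ⟨z + z', fun d => by simp [add_mul, hz, hz']⟩
      zero_mem' := ⟨0, by simp⟩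
      smul_mem' := by
        rintro c a ⟨z, hz⟩
        exact ⟨c * z, fun d => by simp [mul_assoc, hz]⟩ }
  let b : D → (D → A) ⧸ W := fun d => W.mkQ (Pi.single d 1)
  let ρ : DRel q (Module.End k (V → k)) :=
    { e := fun i => LinearMap.single k (fun _ => k) i ∘ₗ LinearMap.proj i
      a := fun _ => 0
      orth := by
        intro i j
        refine LinearMap.ext fun c => funext fun l => ?_
        by_cases h : i = j
        · subst h; simp
        · simp [h]
      sum_one := by
        refine LinearMap.ext fun c => funext fun l => ?_
        simp [Finset.sum_apply, Pi.single_apply]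
      ht := by simp
      hs := by simp
      mesh := by simp }
  have hb : ∀ d, U.e (q.s d) • b d = b d := by
    intro d
    change W.mkQ (U.e (q.s d) • Pi.single d 1) = W.mkQ (Pi.single d 1)
    rw [← sub_eq_zero, ← map_sub, Submodule.mkQ_apply, Submodule.Quotient.mk_eq_zero]
    refine ⟨0, fun d' => ?_⟩
    by_cases hd : d' = d
    · subst hd; simp [sub_mul, U.orth]
    · simp [hd]
  have hr : ∀ c : V → k, ∑ d, (q.ε d * c (q.t d)) • (U.a d • b d) = 0 := by
    intro c
    have : ∑ d, (q.ε d * c (q.t d)) • (U.a d • b d)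
        = W.mkQ (∑ d, (q.ε d * c (q.t d)) • (U.a d • Pi.single d 1)) := by
      rw [map_sum]; rfl
    rw [this, Submodule.mkQ_apply, Submodule.Quotient.mk_eq_zero]
    refine ⟨∑ i, c i • U.e i, fun d' => ?_⟩
    simp [Finset.sum_apply, Finset.sum_mul, Pi.single_apply, U.e_a, U.hs, smul_smul]
  obtain ⟨δ, -, hδ, -⟩ := U.ext_module ((D → A) ⧸ W) (V → k) ρ
    (fun d => (LinearMap.toSpanSingleton k _ (b (q.st d))).comp (LinearMap.proj (q.s d)))
    (by
      intro d m
      simp only [LinearMap.comp_apply, LinearMap.toSpanSingleton_apply, LinearMap.proj_apply]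
      rw [smul_comm, ← q.s_st, hb])
    (by
      intro d m
      simp [ρ])
    (by
      intro m
      rw [← hr m]
      refine Finset.sum_congr rfl fun d _ => ?_
      simp only [LinearMap.comp_apply, LinearMap.toSpanSingleton_apply, LinearMap.proj_apply,
        q.s_st, q.st_st]
      simp only [ρ, LinearMap.zero_apply, Pi.zero_apply, zero_smul, add_zero, mul_smul]
      rw [smul_comm (U.a d)])
  have h2 : ∑ d, q.ε d • (y d • b d) = 0 := by
    have := congrArg (fun x => δ x 1) h
    simp only [map_sum, map_smul, LinearMap.sum_apply, LinearMap.smul_apply, hδ, map_zero,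
      LinearMap.zero_apply] at this
    simpa [ρ, q.st_st] using this
  have h3 : ∑ d, q.ε d • (y d • (Pi.single d 1 : D → A)) ∈ W := by
    rw [← Submodule.Quotient.mk_eq_zero, ← Submodule.mkQ_apply, ← h2, map_sum]; rfl
  obtain ⟨z, hz⟩ := h3
  refine ⟨z, fun d => ?_⟩
  have := hz d
  simp only [Finset.sum_apply, Pi.smul_apply, Pi.single_apply, smul_eq_mul, mul_ite, mul_one,
    mul_zero, smul_ite, smul_zero, Finset.sum_ite_eq, Finset.mem_univ, if_true, smul_mul_assoc,
    hy] at this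
  exact smul_right_injective A (q.ε_ne d) this

end


section
variable {k V D : Type} [Field k] [Fintype V] [DecidableEq V] [Fintype D]
  {q : DQ k V D} {A : Type} [Ring A] [Algebra k A]

theorem DUni.exists_grading (U : DUni q A) : ∃ γ : A →ₐ[k] Polynomial A,
    (∀ i, γ (U.e i) = Polynomial.C (U.e i)) ∧
    (∀ d, γ (U.a d) = Polynomial.C (U.a d) * Polynomial.X) := by
  let R : DRel q (Polynomial A) :=
    { e := fun i => Polynomial.C (U.e i)
      a := fun d => Polynomial.C (U.a d) * Polynomial.X
      orth := by
        intro i j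
        rw [← Polynomial.C_mul, U.orth]; split_ifs <;> simp
      sum_one := by
        rw [← map_sum, U.sum_one]; simp
      ht := by intro d; rw [← mul_assoc, ← Polynomial.C_mul, U.ht]
      hs := by
        intro d
        rw [mul_assoc, Polynomial.X_mul_C, ← mul_assoc, ← Polynomial.C_mul, U.hs]
      mesh := by
        have : ∀ d, q.ε d • (Polynomial.C (U.a d) * Polynomial.X *
            (Polynomial.C (U.a (q.st d)) * Polynomial.X)) =
            Polynomial.C (q.ε d • (U.a d * U.a (q.st d))) * Polynomial.X ^ 2 := by
          intro d
          rw [← Polynomial.smul_C, Polynomial.C_mul, smul_mul_assoc]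
          congr 1
          rw [mul_assoc, ← mul_assoc Polynomial.X, Polynomial.X_mul_C, mul_assoc, mul_assoc, sq]
        simp_rw [this]
        rw [← Finset.sum_mul, ← map_sum, U.mesh]; simp }
  obtain ⟨γ, h1, h2⟩ := U.univ _ R
  exact ⟨γ, h1, h2⟩

noncomputable def DUni.γ (U : DUni q A) : A →ₐ[k] Polynomial A := U.exists_grading.choose

theorem DUni.γ_e (U : DUni q A) (i : V) : U.γ (U.e i) = Polynomial.C (U.e i) :=
  U.exists_grading.choose_spec.1 i

theorem DUni.γ_a (U : DUni q A) (d : D) :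
    U.γ (U.a d) = Polynomial.C (U.a d) * Polynomial.X :=
  U.exists_grading.choose_spec.2 d

noncomputable def DUni.p (U : DUni q A) (n : ℕ) : A →ₗ[k] A where
  toFun x := (U.γ x).coeff n
  map_add' := by intros; simp
  map_smul' := by intros; simp

theorem DUni.p_def (U : DUni q A) (n : ℕ) (x : A) : U.p n x = (U.γ x).coeff n := rfl

theorem DUni.p_one (U : DUni q A) (n : ℕ) : U.p n 1 = if n = 0 then 1 else 0 := by
  rw [U.p_def, map_one, Polynomial.coeff_one]

theorem DUni.p_mul_e (U : DUni q A) (n : ℕ) (x : A) (i : V) :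
    U.p n (x * U.e i) = U.p n x * U.e i := by
  rw [U.p_def, map_mul, U.γ_e, Polynomial.coeff_mul_C, U.p_def]

theorem DUni.p_e_mul (U : DUni q A) (n : ℕ) (x : A) (i : V) :
    U.p n (U.e i * x) = U.e i * U.p n x := by
  rw [U.p_def, map_mul, U.γ_e, Polynomial.coeff_C_mul, U.p_def]

theorem DUni.p_e (U : DUni q A) (n : ℕ) (i : V) :
    U.p n (U.e i) = if n = 0 then U.e i else 0 := by
  have := U.p_mul_e n 1 i
  rw [one_mul, U.p_one] at this
  rw [this]; split_ifs <;> simp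

theorem DUni.p_succ_mul_a (U : DUni q A) (n : ℕ) (x : A) (d : D) :
    U.p (n + 1) (x * U.a d) = U.p n x * U.a d := by
  rw [U.p_def, map_mul, U.γ_a, ← mul_assoc, Polynomial.coeff_mul_X, Polynomial.coeff_mul_C,
    U.p_def]

theorem DUni.p_zero_mul_a (U : DUni q A) (x : A) (d : D) : U.p 0 (x * U.a d) = 0 := by
  rw [U.p_def, map_mul, U.γ_a, ← mul_assoc, Polynomial.coeff_mul_X_zero]

theorem DUni.p_succ_a_mul (U : DUni q A) (n : ℕ) (x : A) (d : D) :
    U.p (n + 1) (U.a d * x) = U.a d * U.p n x := by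
  rw [U.p_def, map_mul, U.γ_a, mul_assoc, Polynomial.X_mul, ← mul_assoc, Polynomial.coeff_mul_X,
    Polynomial.coeff_C_mul, U.p_def]

theorem DUni.p_zero_a_mul (U : DUni q A) (x : A) (d : D) : U.p 0 (U.a d * x) = 0 := by
  rw [U.p_def, map_mul, U.γ_a, mul_assoc, Polynomial.X_mul, ← mul_assoc,
    Polynomial.coeff_mul_X_zero]

theorem DUni.eval_γ (U : DUni q A) (x : A) : (U.γ x).eval 1 = x := by
  let W : Submodule k A :=
    { carrier := {x | (U.γ x).eval 1 = x}
      add_mem' := by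
        intro a b ha hb
        have ha : (U.γ a).eval 1 = a := ha
        have hb : (U.γ b).eval 1 = b := hb
        change (U.γ (a + b)).eval 1 = a + b
        rw [map_add, Polynomial.eval_add, ha, hb]
      zero_mem' := by change (U.γ 0).eval 1 = 0; simp
      smul_mem' := by
        intro c a ha
        have ha : (U.γ a).eval 1 = a := ha
        change (U.γ (c • a)).eval 1 = c • a
        rw [map_smul, Polynomial.eval_smul, ha] }
  refine U.indL W ?_ ?_ ?_ x
  · change (U.γ 1).eval 1 = 1
    simp
  · intro x hx i
    have hx : (U.γ x).eval 1 = x := hx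
    change (U.γ _).eval 1 = _
    rw [map_mul, U.γ_e, Polynomial.eval_C_mul, hx]
  · intro x hx d
    have hx : (U.γ x).eval 1 = x := hx
    change (U.γ _).eval 1 = _
    rw [map_mul, U.γ_a, mul_assoc, Polynomial.X_mul, Polynomial.eval_C_mul, Polynomial.eval_mul_X,
      mul_one, hx]

theorem DUni.sum_p (U : DUni q A) (x : A) :
    ∃ N, (∀ n, N ≤ n → U.p n x = 0) ∧ ∑ n ∈ Finset.range N, U.p n x = x := by
  refine ⟨(U.γ x).natDegree + 1, fun n hn => ?_, ?_⟩
  · rw [U.p_def]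
    exact Polynomial.coeff_eq_zero_of_natDegree_lt (by omega)
  · conv_rhs => rw [← U.eval_γ x, Polynomial.eval_eq_sum_range]
    simp [U.p_def]

theorem DUni.eq_zero_of_p (U : DUni q A) (x : A) (h : ∀ n, U.p n x = 0) : x = 0 := by
  obtain ⟨N, -, h2⟩ := U.sum_p x
  rw [← h2]; simp [h]

theorem DUni.p_p (U : DUni q A) (m n : ℕ) (x : A) :
    U.p m (U.p n x) = if m = n then U.p n x else 0 := by
  let W : Submodule k A :=
    { carrier := {x | ∀ m n, U.p m (U.p n x) = if m = n then U.p n x else 0}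
      add_mem' := by
        intro a b ha hb m n
        rw [map_add, map_add, ha, hb]; split_ifs <;> simp
      zero_mem' := by intro m n; simp
      smul_mem' := by
        intro c a ha m n
        rw [map_smul, map_smul, ha]; split_ifs <;> simp }
  refine U.indL W ?_ ?_ ?_ x m n
  · intro m n
    rw [U.p_one]
    split_ifs <;> simp_all [U.p_one]
  · intro x hx i m n
    rw [U.p_e_mul, U.p_e_mul, hx m n]; split_ifs <;> simp
  · intro x hx d m n
    rcases n with _ | n
    · rw [U.p_zero_a_mul]; simp
    · rw [U.p_succ_a_mul]
      rcases m with _ | m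
      · rw [U.p_zero_a_mul]; simp
      · rw [U.p_succ_a_mul, hx m n]; simp only [add_left_inj]; split_ifs <;> simp

theorem DUni.decomp (U : DUni q A) (x : A) :
    ∃ (c : V → k) (y : D → A), x = ∑ i, c i • U.e i + ∑ d, y d * U.a d := by
  classical
  let W : Submodule k A :=
    { carrier := {x | ∃ (c : V → k) (y : D → A), x = ∑ i, c i • U.e i + ∑ d, y d * U.a d}
      add_mem' := by
        rintro a b ⟨c, y, rfl⟩ ⟨c', y', rfl⟩
        refine ⟨c + c', y + y', ?_⟩
        simp only [Pi.add_apply, add_smul, add_mul, Finset.sum_add_distrib]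
        abel
      zero_mem' := ⟨0, 0, by simp⟩
      smul_mem' := by
        rintro r a ⟨c, y, rfl⟩
        exact ⟨r • c, r • y, by simp [Finset.smul_sum, smul_smul]⟩ }
  refine U.indR W ?_ ?_ ?_ x
  · exact ⟨1, 0, by simp [U.sum_one]⟩
  · rintro x ⟨c, y, rfl⟩ i
    refine ⟨Pi.single i (c i), fun d => if q.s d = i then y d else 0, ?_⟩
    rw [add_mul, Finset.sum_mul, Finset.sum_mul]
    congr 1
    · refine Finset.sum_congr rfl fun j _ => ?_
      rw [smul_mul_assoc, U.orth, Pi.single_apply]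
      by_cases h : j = i
      · subst h; simp
      · simp [h]
    · refine Finset.sum_congr rfl fun d _ => ?_
      rw [mul_assoc, U.a_e]
      by_cases h : q.s d = i <;> simp [h]
  · rintro x hx d
    exact ⟨0, Pi.single d x, by simp [Pi.single_apply, ite_mul]⟩

theorem DUni.p_zero_eq (U : DUni q A) (x : A) : ∃ c : V → k, U.p 0 x = ∑ i, c i • U.e i := by
  obtain ⟨c, y, rfl⟩ := U.decomp x
  refine ⟨c, ?_⟩
  simp [map_add, map_sum, U.p_e, U.p_zero_mul_a]

theorem DUni.p_succ_eq (U : DUni q A) (n : ℕ) (x : A) :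
    ∃ y : D → A, U.p (n + 1) x = ∑ d, U.p n (y d) * U.a d := by
  obtain ⟨c, y, rfl⟩ := U.decomp x
  refine ⟨y, ?_⟩
  simp [map_add, map_sum, U.p_e, U.p_succ_mul_a]

theorem DUni.finite_p (U : DUni q A) (n : ℕ) : (LinearMap.range (U.p n)).FG := by
  classical
  induction n with
  | zero =>
    refine Submodule.FG.of_le (Submodule.fg_span (Set.finite_range U.e)) ?_
    rintro _ ⟨x, rfl⟩
    obtain ⟨c, hc⟩ := U.p_zero_eq x
    rw [hc]
    exact Submodule.sum_mem _ fun i _ => Submodule.smul_mem _ _ (Submodule.subset_span ⟨i, rfl⟩)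
  | succ n ih =>
    have : (⨆ d : D, (LinearMap.range (U.p n)).map (LinearMap.mulRight k (U.a d))).FG :=
      Submodule.fg_iSup _ fun d => ih.map _
    refine Submodule.FG.of_le this ?_
    rintro _ ⟨x, rfl⟩
    obtain ⟨y, hy⟩ := U.p_succ_eq n x
    rw [hy]
    refine Submodule.sum_mem _ fun d _ => ?_
    refine Submodule.mem_iSup_of_mem d ⟨U.p n (y d), ⟨y d, rfl⟩, rfl⟩

theorem DUni.exists_aug (U : DUni q A) : ∃ ψ : A →ₐ[k] (V → k),
    (∀ i, ψ (U.e i) = Pi.single i 1) ∧ (∀ d, ψ (U.a d) = 0) := by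
  let R : DRel q (V → k) :=
    { e := fun i => Pi.single i 1
      a := fun d => 0
      orth := by
        intro i j
        funext l
        by_cases h : i = j
        · subst h; simp [Pi.single_apply]
        · simp only [h, Pi.mul_apply, Pi.single_apply, if_false, Pi.zero_apply]
          split_ifs <;> simp_all
      sum_one := by funext l; simp [Pi.single_apply]
      ht := by simp
      hs := by simp
      mesh := by simp }
  exact U.univ _ R

theorem DUni.e_ne (U : DUni q A) (i : V) : U.e i ≠ 0 := by
  obtain ⟨ψ, h, -⟩ := U.exists_aug
  intro h0
  have := congrFun (h i) i
  simp [h0] at this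

theorem DUni.a_ne (U : DUni q A) (d : D) : U.a d ≠ 0 := by
  classical
  intro h0
  obtain ⟨z, hz⟩ := U.exact_mid (Pi.single (q.st d) (U.e (q.t d)))
    (by
      intro d'
      by_cases h : d' = q.st d
      · subst h; simp [q.s_st, U.orth]
      · simp [h])
    (by
      refine Finset.sum_eq_zero fun d' _ => ?_
      by_cases h : d' = q.st d
      · subst h; simp [q.st_st, h0]
      · simp [h])
  have := congrArg (U.p 0) (hz (q.st d))
  rw [U.p_zero_mul_a, Pi.single_eq_same, U.p_e] at this
  exact U.e_ne _ (by simpa using this)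

end


section
variable {k V D : Type} [Field k] [Fintype V] [DecidableEq V] [Fintype D]
  {q : DQ k V D} {A : Type} [Ring A] [Algebra k A]

/-- The degree `n` part of row `j`. -/
noncomputable def DUni.H (U : DUni q A) (j : V) (n : ℕ) : Submodule k A where
  carrier := {x | U.p n x = x ∧ U.e j * x = x}
  add_mem' := by
    rintro a b ⟨h1, h2⟩ ⟨h3, h4⟩
    exact ⟨by rw [map_add, h1, h3], by rw [mul_add, h2, h4]⟩
  zero_mem' := ⟨by simp, by simp⟩
  smul_mem' := by
    rintro c a ⟨h1, h2⟩
    exact ⟨by rw [map_smul, h1], by rw [mul_smul_comm, h2]⟩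

theorem DUni.mem_H (U : DUni q A) (j : V) (n : ℕ) (x : A) :
    x ∈ U.H j n ↔ U.p n x = x ∧ U.e j * x = x := Iff.rfl

theorem DUni.proj_mem_H (U : DUni q A) (j : V) (n : ℕ) (x : A) :
    U.e j * U.p n x ∈ U.H j n := by
  refine ⟨?_, ?_⟩
  · rw [U.p_e_mul, U.p_p, if_pos rfl]
  · rw [← mul_assoc, U.orth, if_pos rfl]

theorem DUni.H_mul_e (U : DUni q A) {j : V} {n : ℕ} {x : A} (hx : x ∈ U.H j n) (i : V) :
    x * U.e i ∈ U.H j n :=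
  ⟨by rw [U.p_mul_e, hx.1], by rw [← mul_assoc, hx.2]⟩

theorem DUni.H_mul_a (U : DUni q A) {j : V} {n : ℕ} {x : A} (hx : x ∈ U.H j n) (d : D) :
    x * U.a d ∈ U.H j (n + 1) :=
  ⟨by rw [U.p_succ_mul_a, hx.1], by rw [← mul_assoc, hx.2]⟩

theorem DUni.H_succ (U : DUni q A) {j : V} {n : ℕ} {x : A} (hx : x ∈ U.H j (n + 1)) :
    ∃ y : D → A, (∀ d, y d ∈ U.H j n ∧ y d * U.e (q.t d) = y d) ∧ x = ∑ d, y d * U.a d := by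
  obtain ⟨y, hy⟩ := U.p_succ_eq n x
  refine ⟨fun d => U.e j * U.p n (y d) * U.e (q.t d), fun d => ⟨?_, ?_⟩, ?_⟩
  · exact U.H_mul_e (U.proj_mem_H j n _) _
  · rw [mul_assoc, U.orth, if_pos rfl]
  · conv_lhs => rw [← hx.2, ← hx.1, hy, Finset.mul_sum]
    refine Finset.sum_congr rfl fun d _ => ?_
    rw [mul_assoc _ (U.e (q.t d)), U.ht, mul_assoc]

theorem DUni.H_zero (U : DUni q A) {j : V} {x : A} (hx : x ∈ U.H j 0) :
    ∃ c : k, x = c • U.e j := by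
  obtain ⟨c, hc⟩ := U.p_zero_eq x
  refine ⟨c j, ?_⟩
  rw [← hx.2, ← hx.1, hc, Finset.mul_sum, Finset.sum_eq_single j]
  · rw [mul_smul_comm, U.orth, if_pos rfl]
  · intro i _ hi
    rw [mul_smul_comm, U.orth, if_neg (Ne.symm hi), smul_zero]
  · simp

theorem DUni.e_mem_H (U : DUni q A) (j : V) : U.e j ∈ U.H j 0 :=
  ⟨by rw [U.p_e, if_pos rfl], by rw [U.orth, if_pos rfl]⟩

def DUni.Soc (U : DUni q A) (j : V) (n : ℕ) : Prop :=
  ∃ x ∈ U.H j n, x ≠ 0 ∧ ∀ d, x * U.a d = 0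

def DUni.Brick (U : DUni q A) (j : V) (n : ℕ) : Prop :=
  ∀ φ ψ : A →ₗ[k] A,
    (∀ x ∈ U.H j n, φ x ∈ U.H j n) → (∀ x ∈ U.H j (n + 1), ψ x ∈ U.H j (n + 1)) →
    (∀ x ∈ U.H j n, ∀ i, φ (x * U.e i) = φ x * U.e i) →
    (∀ x ∈ U.H j (n + 1), ∀ i, ψ (x * U.e i) = ψ x * U.e i) →
    (∀ x ∈ U.H j n, ∀ d, ψ (x * U.a d) = φ x * U.a d) →
    ∃ c : k, (∀ x ∈ U.H j n, φ x = c • x) ∧ (∀ x ∈ U.H j (n + 1), ψ x = c • x)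

/-- graded exactness -/
theorem DUni.exact_H (U : DUni q A) {j : V} {n : ℕ} (y : D → A)
    (hH : ∀ d, y d ∈ U.H j (n + 1))
    (hy : ∀ d, y d * U.e (q.s d) = y d)
    (h : ∑ d, q.ε d • (y d * U.a (q.st d)) = 0) : ∃ z ∈ U.H j n, ∀ d, y d = z * U.a d := by
  classical
  obtain ⟨z, hz⟩ := U.exact_mid y hy h
  refine ⟨U.e j * U.p n z, U.proj_mem_H j n z, fun d => ?_⟩
  rw [mul_assoc, ← U.p_succ_mul_a, ← hz, (hH d).1, (hH d).2]

theorem DUni.exact_H_zero (U : DUni q A) {j : V} (y : D → A)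
    (hH : ∀ d, y d ∈ U.H j 0)
    (hy : ∀ d, y d * U.e (q.s d) = y d)
    (h : ∑ d, q.ε d • (y d * U.a (q.st d)) = 0) : ∀ d, y d = 0 := by
  classical
  obtain ⟨z, hz⟩ := U.exact_mid y hy h
  intro d
  rw [← (hH d).1, hz, U.p_zero_mul_a]

theorem DUni.eq_zero_of_notSoc (U : DUni q A) {j : V} {n : ℕ} (h : ¬ U.Soc j n) {x : A}
    (hx : x ∈ U.H j n) (hx0 : ∀ d, x * U.a d = 0) : x = 0 := by
  by_contra h0
  exact h ⟨x, hx, h0, hx0⟩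

theorem DUni.brick (U : DUni q A) (j : V) (n : ℕ) (hn : ∀ m < n, ¬ U.Soc j m) :
    U.Brick j n := by
  induction n with
  | zero =>
    intro φ ψ h1 h2 h3 h4 h5
    obtain ⟨c, hc⟩ := U.H_zero (h1 _ (U.e_mem_H j))
    have h6 : ∀ x ∈ U.H j 0, φ x = c • x := by
      intro x hx
      obtain ⟨r, rfl⟩ := U.H_zero hx
      rw [map_smul, hc, smul_comm]
    refine ⟨c, h6, ?_⟩
    intro x hx
    obtain ⟨y, hy, rfl⟩ := U.H_succ hx
    rw [map_sum, Finset.smul_sum]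
    refine Finset.sum_congr rfl fun d _ => ?_
    rw [h5 _ (hy d).1, h6 _ (hy d).1, smul_mul_assoc]
  | succ n ih =>
    intro φ ψ h1 h2 h3 h4 h5
    have ih := ih fun m hm => hn m (by omega)
    have hs := hn n (by omega)
    let R : A →ₗ[k] (D → A) := LinearMap.pi fun d => LinearMap.mulRight k (U.a d)
    have hR : LinearMap.ker (R.comp (U.H j n).subtype) = ⊥ := by
      rw [LinearMap.ker_eq_bot']
      rintro ⟨x, hx⟩ hx0
      have : x = 0 := U.eq_zero_of_notSoc hs hx fun d => congrFun hx0 d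
      simp [this]
    obtain ⟨L, hL⟩ := LinearMap.exists_leftInverse_of_injective _ hR
    let L' : (D → A) →ₗ[k] A := (U.H j n).subtype.comp L
    have hL' : ∀ z ∈ U.H j n, L' (fun d => z * U.a d) = z := by
      intro z hz
      exact congrArg Subtype.val (LinearMap.congr_fun hL ⟨z, hz⟩)
    let θ : A →ₗ[k] A := L'.comp (LinearMap.pi fun d => φ.comp (LinearMap.mulRight k (U.a d)))
    have hθ' : ∀ x, θ x = L' (fun d => φ (x * U.a d)) := fun x => rfl
    have hθ : ∀ x ∈ U.H j n, θ x ∈ U.H j n ∧ ∀ d, φ (x * U.a d) = θ x * U.a d := by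
      intro x hx
      obtain ⟨z, hz, hzd⟩ := U.exact_H (fun d => φ (x * U.a d))
        (fun d => h1 _ (U.H_mul_a hx d))
        (fun d => by
          rw [← h3 _ (U.H_mul_a hx d), mul_assoc, U.hs])
        (by
          have h6 : ∀ d, q.ε d • (φ (x * U.a d) * U.a (q.st d))
              = ψ (x * (q.ε d • (U.a d * U.a (q.st d)))) := by
            intro d
            rw [← h5 _ (U.H_mul_a hx d), mul_smul_comm, map_smul, mul_assoc]
          rw [Finset.sum_congr rfl fun d _ => h6 d, ← map_sum, ← Finset.mul_sum, U.mesh]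
          simp)
      have : θ x = z := by
        rw [hθ']; simp only [hzd]; exact hL' z hz
      rw [this]
      exact ⟨hz, hzd⟩
    obtain ⟨c, hc1, hc2⟩ := ih θ φ (fun x hx => (hθ x hx).1) h1
      (by
        intro x hx i
        rw [← sub_eq_zero]
        refine U.eq_zero_of_notSoc hs ?_ ?_
        · exact Submodule.sub_mem _ (hθ _ (U.H_mul_e hx i)).1 (U.H_mul_e (hθ x hx).1 i)
        · intro d
          rw [sub_mul, ← (hθ _ (U.H_mul_e hx i)).2, mul_assoc, mul_assoc, U.e_a]
          split_ifs
          · rw [(hθ x hx).2, sub_self]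
          · simp)
      h3 (fun x hx d => (hθ x hx).2 d)
    refine ⟨c, hc2, ?_⟩
    intro x hx
    obtain ⟨y, hy, rfl⟩ := U.H_succ hx
    rw [map_sum, Finset.smul_sum]
    refine Finset.sum_congr rfl fun d _ => ?_
    rw [h5 _ (hy d).1, hc2 _ (hy d).1, smul_mul_assoc]

theorem DUni.H_vanish (U : DUni q A) {j : V} {n : ℕ} (h : ∀ x ∈ U.H j n, x = 0) (m : ℕ)
    (hm : n ≤ m) : ∀ x ∈ U.H j m, x = 0 := by
  induction m, hm using Nat.le_induction with
  | base => exact h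
  | succ m _ ih =>
    intro x hx
    obtain ⟨y, hy, rfl⟩ := U.H_succ hx
    refine Finset.sum_eq_zero fun d _ => ?_
    rw [ih _ (hy d).1, zero_mul]

theorem DUni.death (U : DUni q A) (j : V) (n : ℕ) (hn : ∀ m < n, ¬ U.Soc j m)
    (hs : U.Soc j n) : ∃ (i : V) (x : A), x ∈ U.H j n ∧ x ≠ 0 ∧ x * U.e i = x ∧
      (∀ y ∈ U.H j n, ∃ c : k, y = c • x) ∧ ∀ m, n < m → ∀ y ∈ U.H j m, y = 0 := by
  obtain ⟨x', hx', hx0', hxa'⟩ := hs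
  have : ∃ i, x' * U.e i ≠ 0 := by
    by_contra! h
    apply hx0'
    rw [← mul_one x', ← U.sum_one, Finset.mul_sum]
    exact Finset.sum_eq_zero fun i _ => h i
  obtain ⟨i, hi⟩ := this
  set x := x' * U.e i with hxdef
  have hx : x ∈ U.H j n := U.H_mul_e hx' i
  have hxe : x * U.e i = x := by rw [hxdef, mul_assoc, U.orth, if_pos rfl]
  have hxel : ∀ l, l ≠ i → x * U.e l = 0 := by
    intro l hl
    rw [hxdef, mul_assoc, U.orth, if_neg (Ne.symm hl), mul_zero]
  have hxa : ∀ d, x * U.a d = 0 := by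
    intro d
    rw [hxdef, mul_assoc, U.e_a]
    split_ifs
    · exact hxa' d
    · simp
  obtain ⟨χ, hχ⟩ : ∃ χ : A →ₗ[k] k, χ x = 1 := by
    obtain ⟨χ, hχ⟩ := LinearMap.exists_extend_of_notMem (p := (⊥ : Submodule k A)) (v := x) 0
      (by simpa using hi) (1 : k)
    exact ⟨χ, hχ.2⟩
  let φ : A →ₗ[k] A := (LinearMap.toSpanSingleton k A x).comp
    (χ.comp (LinearMap.mulRight k (U.e i)))
  have hφ : ∀ y, φ y = χ (y * U.e i) • x := fun y => rfl
  obtain ⟨c, hc1, hc2⟩ := U.brick j n hn φ 0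
    (fun y _ => by rw [hφ]; exact Submodule.smul_mem _ _ hx)
    (fun y _ => by simp)
    (fun y _ l => by
      rw [hφ, hφ, mul_assoc, U.orth, smul_mul_assoc]
      by_cases h : l = i
      · subst h; simp [hxe]
      · simp [h, hxel l h])
    (fun y _ l => by simp)
    (fun y _ d => by rw [hφ, smul_mul_assoc, hxa]; simp)
  have hc : c = 1 := by
    have := hc1 x hx
    rw [hφ, hxe, hχ] at this
    by_contra hne
    have h2 : (c - 1) • x = 0 := by rw [sub_smul, ← this]; simp
    rcases smul_eq_zero.1 h2 with h | h
    · exact hne (sub_eq_zero.1 h)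
    · exact hi h
  subst hc
  refine ⟨i, x, hx, hi, hxe, ?_, ?_⟩
  · intro y hy
    refine ⟨χ (y * U.e i), ?_⟩
    rw [← hφ, hc1 y hy, one_smul]
  · intro m hm
    refine U.H_vanish ?_ m hm
    intro y hy
    have := hc2 y hy
    simpa using this.symm

/-- entries -/
noncomputable def DUni.Hi (U : DUni q A) (j : V) (n : ℕ) (i : V) : Submodule k A where
  carrier := {x | x ∈ U.H j n ∧ x * U.e i = x}
  add_mem' := by
    rintro a b ⟨h1, h2⟩ ⟨h3, h4⟩
    exact ⟨Submodule.add_mem _ h1 h3, by rw [add_mul, h2, h4]⟩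
  zero_mem' := ⟨Submodule.zero_mem _, by simp⟩
  smul_mem' := by
    rintro c a ⟨h1, h2⟩
    exact ⟨Submodule.smul_mem _ _ h1, by rw [smul_mul_assoc, h2]⟩

theorem DUni.finite_Hi (U : DUni q A) (j : V) (n : ℕ) (i : V) :
    Module.Finite k (U.Hi j n i) := by
  have : (U.Hi j n i).FG := Submodule.FG.of_le (U.finite_p n) (fun x hx => ⟨x, hx.1.1⟩)
  exact Module.Finite.iff_fg.2 this

noncomputable def DUni.h (U : DUni q A) (j : V) (n : ℕ) (i : V) : ℕ :=
  Module.finrank k (U.Hi j n i)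

noncomputable def DUni.Φ (U : DUni q A) (j : V) (n : ℕ) (i : V) :
    ((d : {d : D // q.t d = i}) → U.Hi j n (q.s d)) →ₗ[k] U.Hi j (n + 1) i :=
  LinearMap.codRestrict _
    (∑ d : {d : D // q.t d = i}, q.ε d • (LinearMap.mulRight k (U.a (q.st d))).comp
      ((U.Hi j n (q.s d)).subtype.comp (LinearMap.proj d))) (by
    intro y
    rw [LinearMap.sum_apply]
    refine Submodule.sum_mem _ fun d _ => ?_
    rw [LinearMap.smul_apply]
    refine Submodule.smul_mem _ _ ⟨U.H_mul_a (y d).2.1 _, ?_⟩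
    change (y d : A) * U.a (q.st d) * U.e i = (y d : A) * U.a (q.st d)
    rw [mul_assoc, U.a_e, q.s_st, if_pos d.2])

theorem DUni.Φ_apply (U : DUni q A) (j : V) (n : ℕ) (i : V) (y) :
    (U.Φ j n i y : A) = ∑ d : {d : D // q.t d = i}, q.ε d • ((y d : A) * U.a (q.st d)) := by
  simp [DUni.Φ, LinearMap.sum_apply]

theorem DUni.Φ_surj (U : DUni q A) (j : V) (n : ℕ) (i : V) :
    Function.Surjective (U.Φ j n i) := by
  rintro ⟨x, hx, hxe⟩
  obtain ⟨y, hy, rfl⟩ := U.H_succ hx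
  refine ⟨fun d => ⟨(q.ε d)⁻¹ • y (q.st d), Submodule.smul_mem _ _ ⟨(hy _).1, ?_⟩⟩, ?_⟩
  · have := (hy (q.st d)).2
    rwa [q.t_st] at this
  · apply Subtype.ext
    rw [U.Φ_apply]
    simp only [smul_mul_assoc, smul_smul, mul_inv_cancel₀ (q.ε_ne _), one_smul]
    rw [← hxe, Finset.sum_mul]
    simp only [mul_assoc, U.a_e, mul_ite, mul_zero]
    rw [← Finset.sum_filter]
    have h1 : ∑ d : {d : D // q.t d = i}, y (q.st d) * U.a (q.st d)
        = ∑ d ∈ Finset.univ.filter (fun d => q.t d = i), y (q.st d) * U.a (q.st d) :=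
      (Finset.sum_subtype _ (by simp) (fun d => y (q.st d) * U.a (q.st d))).symm
    rw [h1]
    refine Finset.sum_nbij' q.st q.st ?_ ?_ ?_ ?_ ?_
    · intro d hd; simpa [q.s_st] using hd
    · intro d hd; simpa [q.t_st] using hd
    · intro d _; exact q.st_st d
    · intro d _; exact q.st_st d
    · intro d _; rfl

theorem DUni.sum_h (U : DUni q A) (j : V) (n : ℕ) (i : V) :
    Module.finrank k ((d : {d : D // q.t d = i}) → U.Hi j n (q.s d))
      = ∑ d ∈ Finset.univ.filter (fun d => q.t d = i), U.h j n (q.s d) := by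
  have := fun i => U.finite_Hi j n i
  rw [Module.finrank_pi_fintype]
  exact (Finset.sum_subtype _ (by simp) (fun d => U.h j n (q.s d))).symm

/-- extend a kernel element to all arrows -/
theorem DUni.Φ_ker (U : DUni q A) (j : V) (n : ℕ) (i : V)
    (y : (d : {d : D // q.t d = i}) → U.Hi j n (q.s d)) (hy : U.Φ j n i y = 0) :
    ∃ y' : D → A, (∀ d, y' d ∈ U.H j n) ∧ (∀ d, y' d * U.e (q.s d) = y' d) ∧
      (∑ d, q.ε d • (y' d * U.a (q.st d)) = 0) ∧ (∀ d, y' d.1 = y d) := by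
  refine ⟨fun d => if hd : q.t d = i then y ⟨d, hd⟩ else 0, ?_, ?_, ?_, ?_⟩
  · intro d
    by_cases hd : q.t d = i
    · simp only [hd, dif_pos]; exact (y ⟨d, hd⟩).2.1
    · simp [hd]
  · intro d
    by_cases hd : q.t d = i
    · simp only [hd, dif_pos]; exact (y ⟨d, hd⟩).2.2
    · simp [hd]
  · have h0 := congrArg Subtype.val hy
    rw [U.Φ_apply] at h0
    rw [← Finset.sum_filter_add_sum_filter_not Finset.univ (fun d => q.t d = i)]
    rw [Finset.sum_subtype (p := fun d => q.t d = i) _ (by simp)]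
    have h2 : ∑ d ∈ Finset.univ.filter (fun d => ¬ q.t d = i),
        q.ε d • ((if hd : q.t d = i then (y ⟨d, hd⟩ : A) else 0) * U.a (q.st d)) = 0 := by
      refine Finset.sum_eq_zero fun d hd => ?_
      simp [(Finset.mem_filter.1 hd).2]
    rw [h2, add_zero]
    refine Eq.trans ?_ h0
    refine Finset.sum_congr rfl fun d _ => ?_
    simp [d.2]
  · intro d
    simp [d.2]

theorem DUni.h_one (U : DUni q A) (j : V) (i : V) :
    U.h j 1 i = ∑ d ∈ Finset.univ.filter (fun d => q.t d = i), U.h j 0 (q.s d) := by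
  have hf := fun i => U.finite_Hi j 0 i
  rw [← U.sum_h]
  have hinj : Function.Injective (U.Φ j 0 i) := by
    rw [← LinearMap.ker_eq_bot, LinearMap.ker_eq_bot']
    intro y hy
    obtain ⟨y', h1, h2, h3, h4⟩ := U.Φ_ker j 0 i y hy
    funext d
    apply Subtype.ext
    rw [← h4, U.exact_H_zero y' h1 h2 h3]; rfl
  exact (LinearEquiv.ofBijective _ ⟨hinj, U.Φ_surj j 0 i⟩).finrank_eq.symm

theorem DUni.h_succ (U : DUni q A) (j : V) (n : ℕ) (hs : ¬ U.Soc j n) (i : V) :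
    U.h j (n + 2) i + U.h j n i =
      ∑ d ∈ Finset.univ.filter (fun d => q.t d = i), U.h j (n + 1) (q.s d) := by
  have hf := fun i => U.finite_Hi j (n + 1) i
  rw [← U.sum_h, ← LinearMap.finrank_range_add_finrank_ker (U.Φ j (n + 1) i),
    LinearMap.range_eq_top.2 (U.Φ_surj j (n + 1) i), finrank_top]
  congr 1
  let f : U.Hi j n i →ₗ[k] ((d : {d : D // q.t d = i}) → U.Hi j (n + 1) (q.s d)) :=
    LinearMap.pi fun d => LinearMap.codRestrict _
      ((LinearMap.mulRight k (U.a d)).comp (U.Hi j n i).subtype) (by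
        intro x
        refine ⟨U.H_mul_a x.2.1 _, ?_⟩
        change (x : A) * U.a d * U.e (q.s d) = (x : A) * U.a d
        rw [mul_assoc, U.hs])
  have hfa : ∀ x d, (f x d : A) = x * U.a d := fun x d => rfl
  have hfinj : Function.Injective f := by
    rw [← LinearMap.ker_eq_bot, LinearMap.ker_eq_bot']
    rintro ⟨x, hx, hxe⟩ h0
    apply Subtype.ext
    refine U.eq_zero_of_notSoc hs hx fun d => ?_
    by_cases hd : q.t d = i
    · exact congrArg Subtype.val (congrFun h0 ⟨d, hd⟩)
    · change x * U.a d = 0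
      rw [← hxe, mul_assoc, U.e_a, if_neg hd, mul_zero]
  have hr : LinearMap.range f = LinearMap.ker (U.Φ j (n + 1) i) := by
    apply le_antisymm
    · rintro _ ⟨x, rfl⟩
      rw [LinearMap.mem_ker]
      apply Subtype.ext
      rw [U.Φ_apply]
      have h1 : ∀ d : {d : D // q.t d = i}, q.ε d • ((f x d : A) * U.a (q.st d))
          = (x : A) * (q.ε d • (U.a d * U.a (q.st d))) := by
        intro d; rw [hfa, mul_smul_comm, mul_assoc]
      rw [Finset.sum_congr rfl fun d _ => h1 d]
      have h2 : ∑ d, (x : A) * (q.ε d • (U.a d * U.a (q.st d))) = 0 := by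
        rw [← Finset.mul_sum, U.mesh, mul_zero]
      rw [← Finset.sum_filter_add_sum_filter_not Finset.univ (fun d => q.t d = i)] at h2
      rw [Finset.sum_subtype (p := fun d => q.t d = i) _ (by simp)] at h2
      have h3 : ∑ d ∈ Finset.univ.filter (fun d => ¬ q.t d = i),
          (x : A) * (q.ε d • (U.a d * U.a (q.st d))) = 0 := by
        refine Finset.sum_eq_zero fun d hd => ?_
        have hxe : (x : A) * U.e i = x := x.2.2
        rw [← hxe, mul_assoc, mul_smul_comm, ← mul_assoc, U.e_a, if_neg (Finset.mem_filter.1 hd).2]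
        simp
      rw [h3, add_zero] at h2
      exact h2
    · intro y hy
      obtain ⟨y', h1, h2, h3, h4⟩ := U.Φ_ker j (n + 1) i y hy
      obtain ⟨z, hz, hzd⟩ := U.exact_H y' h1 h2 h3
      refine ⟨⟨z * U.e i, U.H_mul_e hz i, by rw [mul_assoc, U.orth, if_pos rfl]⟩, ?_⟩
      funext d
      apply Subtype.ext
      rw [hfa, ← h4, hzd, mul_assoc, U.e_a, if_pos d.2]
  rw [← hr, LinearMap.finrank_range_of_inj hfinj]; rfl

theorem DUni.h_zero (U : DUni q A) (j i : V) : U.h j 0 i = if i = j then 1 else 0 := by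
  by_cases hij : i = j
  · subst hij
    rw [if_pos rfl, DUni.h, finrank_eq_one_iff']
    refine ⟨⟨U.e i, U.e_mem_H i, by rw [U.orth, if_pos rfl]⟩, ?_, ?_⟩
    · intro h; exact U.e_ne i (congrArg Subtype.val h)
    · rintro ⟨x, hx, -⟩
      obtain ⟨c, rfl⟩ := U.H_zero hx
      exact ⟨c, rfl⟩
  · rw [if_neg hij, DUni.h]
    have : U.Hi j 0 i = ⊥ := by
      rw [eq_bot_iff]
      rintro x ⟨hx, hxe⟩
      obtain ⟨c, rfl⟩ := U.H_zero hx
      rw [smul_mul_assoc, U.orth, if_neg (Ne.symm hij), smul_zero] at hxe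
      exact hxe.symm
    rw [this]; simp

theorem DUni.h_eq_zero (U : DUni q A) (j : V) (n : ℕ) (h : ∀ x ∈ U.H j n, x = 0) (i : V) :
    U.h j n i = 0 := by
  have : U.Hi j n i = ⊥ := by
    rw [eq_bot_iff]
    rintro x ⟨hx, -⟩
    exact h x hx
  rw [DUni.h, this]; simp

theorem DUni.h_top (U : DUni q A) (j : V) (n : ℕ) (i : V) (x : A) (hx : x ∈ U.H j n)
    (hx0 : x ≠ 0) (hxe : x * U.e i = x) (h : ∀ y ∈ U.H j n, ∃ c : k, y = c • x) (l : V) :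
    U.h j n l = if l = i then 1 else 0 := by
  by_cases hij : l = i
  · subst hij
    rw [if_pos rfl, DUni.h, finrank_eq_one_iff']
    refine ⟨⟨x, hx, hxe⟩, ?_, ?_⟩
    · intro h; exact hx0 (congrArg Subtype.val h)
    · rintro ⟨y, hy, -⟩
      obtain ⟨c, rfl⟩ := h y hy
      exact ⟨c, rfl⟩
  · rw [if_neg hij, DUni.h]
    have : U.Hi j n l = ⊥ := by
      rw [eq_bot_iff]
      rintro y ⟨hy, hye⟩
      obtain ⟨c, rfl⟩ := h y hy
      rw [← hxe, smul_mul_assoc, mul_assoc, U.orth, if_neg (Ne.symm hij)] at hye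
      simpa [hxe] using hye.symm
    rw [this]; simp

theorem DUni.h_pos (U : DUni q A) (j : V) (n : ℕ) (hn : ∀ m < n, ¬ U.Soc j m) :
    ∃ i, 1 ≤ U.h j n i := by
  have h1 : ∃ x ∈ U.H j n, x ≠ 0 := by
    induction n with
    | zero => exact ⟨_, U.e_mem_H j, U.e_ne j⟩
    | succ n ih =>
      obtain ⟨x, hx, hx0⟩ := ih fun m hm => hn m (by omega)
      by_contra! hc
      exact hx0 (U.eq_zero_of_notSoc (hn n (by omega)) hx fun d => hc _ (U.H_mul_a hx d))
  obtain ⟨x, hx, hx0⟩ := h1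
  have : ∃ i, x * U.e i ≠ 0 := by
    by_contra! h
    apply hx0
    rw [← mul_one x, ← U.sum_one, Finset.mul_sum]
    exact Finset.sum_eq_zero fun i _ => h i
  obtain ⟨i, hi⟩ := this
  refine ⟨i, ?_⟩
  have := U.finite_Hi j n i
  have hm : x * U.e i ∈ U.Hi j n i := ⟨U.H_mul_e hx i, by rw [mul_assoc, U.orth, if_pos rfl]⟩
  have : Nontrivial (U.Hi j n i) := ⟨⟨⟨_, hm⟩, 0, fun h => hi (congrArg Subtype.val h)⟩⟩
  exact Module.finrank_pos

end


section
variable {k V D : Type} [Field k] [Fintype V] [DecidableEq V] [Fintype D]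

/-- neighbour sum -/
noncomputable def DQ.C (q : DQ k V D) : (V → ℝ) →ₗ[ℝ] (V → ℝ) where
  toFun x i := ∑ d ∈ Finset.univ.filter (fun d => q.t d = i), x (q.s d)
  map_add' x y := by funext i; simp [Finset.sum_add_distrib]
  map_smul' c x := by funext i; simp [Finset.mul_sum]

theorem DQ.C_apply (q : DQ k V D) (x : V → ℝ) (i : V) :
    q.C x i = ∑ d ∈ Finset.univ.filter (fun d => q.t d = i), x (q.s d) := rfl

theorem DQ.sum_C (q : DQ k V D) (x y : V → ℝ) :
    ∑ i, y i * q.C x i = ∑ d, y (q.t d) * x (q.s d) := by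
  simp only [q.C_apply, Finset.mul_sum]
  rw [← Finset.sum_fiberwise Finset.univ q.t (fun d => y (q.t d) * x (q.s d))]
  refine Finset.sum_congr rfl fun i _ => Finset.sum_congr rfl fun d hd => ?_
  rw [(Finset.mem_filter.1 hd).2]

theorem DQ.sum_st (q : DQ k V D) (f : V → V → ℝ) :
    ∑ d, f (q.t d) (q.s d) = ∑ d, f (q.s d) (q.t d) := by
  refine Finset.sum_nbij' q.st q.st ?_ ?_ ?_ ?_ ?_
  · simp
  · simp
  · intro d _; exact q.st_st d
  · intro d _; exact q.st_st d
  · intro d _; rw [q.s_st, q.t_st]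

theorem DQ.C_symm (q : DQ k V D) (x y : V → ℝ) :
    ∑ i, y i * q.C x i = ∑ i, x i * q.C y i := by
  rw [q.sum_C, q.sum_C, q.sum_st (fun i j => y i * x j)]
  exact Finset.sum_congr rfl fun d _ => mul_comm _ _

/-- positive definiteness -/
def DQ.Pos (q : DQ k V D) : Prop :=
  ∀ x : V → ℝ, x ≠ 0 → 0 < ∑ i, x i * (2 * x i - q.C x i)

def DQ.Conn (q : DQ k V D) : Prop :=
  ∀ P : V → Prop, (∀ d, P (q.t d) → P (q.s d)) → ∀ i j, P i → P j

theorem DQ.vinberg (q : DQ k V D) (hc : q.Conn) (T : V → ℝ) (j : V) (h0 : ∀ i, 0 ≤ T i)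
    (hj : 0 < T j) (hM : ∀ i, 0 ≤ 2 * T i - q.C T i) (hMj : 0 < 2 * T j - q.C T j) :
    q.Pos := by
  have hT : ∀ i, 0 < T i := by
    intro i
    by_contra hi
    have := hc (fun i => T i = 0) (by
      intro d hd
      have h1 := hM (q.t d)
      rw [hd, q.C_apply] at h1
      have h2 := Finset.single_le_sum (f := fun d => T (q.s d)) (fun d _ => h0 (q.s d))
        (Finset.mem_filter.2 ⟨Finset.mem_univ d, rfl⟩ :
          d ∈ Finset.univ.filter (fun d' => q.t d' = q.t d))
      linarith [h0 (q.s d)]) i j (le_antisymm (not_lt.1 hi) (h0 i))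
    linarith
  intro x hx
  obtain ⟨y, hy⟩ : ∃ y : V → ℝ, ∀ i, x i = T i * y i :=
    ⟨fun i => x i / T i, fun i => by field_simp [(hT i).ne']⟩
  have key : ∑ i, x i * (2 * x i - q.C x i)
      = ∑ i, (2 * T i - q.C T i) * T i * y i ^ 2
        + (1/2) * ∑ d, T (q.t d) * T (q.s d) * (y (q.t d) - y (q.s d)) ^ 2 := by
    have e1 : ∑ i, x i * (2 * x i - q.C x i) = ∑ i, 2 * (x i)^2 - ∑ d, x (q.t d) * x (q.s d) := by
      rw [← q.sum_C, ← Finset.sum_sub_distrib]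
      exact Finset.sum_congr rfl fun i _ => by ring
    have e2 : ∑ i, (2 * T i - q.C T i) * T i * y i ^ 2
        = ∑ i, 2 * (x i)^2 - ∑ d, T (q.t d) * y (q.t d)^2 * T (q.s d) := by
      rw [← q.sum_C T (fun i => T i * y i ^ 2), ← Finset.sum_sub_distrib]
      exact Finset.sum_congr rfl fun i _ => by rw [hy]; ring
    have e3 := q.sum_st (fun i j => T i * y i ^2 * T j)
    have e4 : ∑ d, T (q.t d) * T (q.s d) * (y (q.t d) - y (q.s d)) ^ 2
        = ∑ d, T (q.t d) * y (q.t d)^2 * T (q.s d) + ∑ d, T (q.s d) * y (q.s d)^2 * T (q.t d)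
          - 2 * ∑ d, x (q.t d) * x (q.s d) := by
      rw [Finset.mul_sum, ← Finset.sum_add_distrib, ← Finset.sum_sub_distrib]
      exact Finset.sum_congr rfl fun d _ => by rw [hy, hy]; ring
    rw [e1, e2, e4, ← e3]; ring
  have p1 : ∀ i, 0 ≤ (2 * T i - q.C T i) * T i * y i ^ 2 := fun i =>
    mul_nonneg (mul_nonneg (hM i) (h0 i)) (sq_nonneg _)
  have p2 : ∀ d, 0 ≤ T (q.t d) * T (q.s d) * (y (q.t d) - y (q.s d)) ^ 2 := fun d =>
    mul_nonneg (mul_nonneg (h0 _) (h0 _)) (sq_nonneg _)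
  have s1 := Finset.sum_nonneg fun i (_ : i ∈ Finset.univ) => p1 i
  have s2 := Finset.sum_nonneg fun d (_ : d ∈ Finset.univ) => p2 d
  rw [key]
  by_contra hneg
  have z1 : ∑ i, (2 * T i - q.C T i) * T i * y i ^ 2 = 0 := by linarith
  have z2 : ∑ d, T (q.t d) * T (q.s d) * (y (q.t d) - y (q.s d)) ^ 2 = 0 := by linarith
  rw [Finset.sum_eq_zero_iff_of_nonneg (fun i _ => p1 i)] at z1
  rw [Finset.sum_eq_zero_iff_of_nonneg (fun i _ => p2 i)] at z2
  have yj : y j = 0 := by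
    have := z1 j (Finset.mem_univ _)
    simpa [hMj.ne', hj.ne'] using this
  have yd : ∀ d, y (q.t d) = 0 → y (q.s d) = 0 := by
    intro d hd
    have := z2 d (Finset.mem_univ _)
    simpa [(hT _).ne', hd] using this
  apply hx
  funext i
  rw [hy, hc (fun i => y i = 0) yd j i yj]; simp

theorem DQ.Pos.exists_u {q : DQ k V D} (h : q.Pos) :
    ∃ u : V → ℝ, (∀ i, 0 ≤ u i) ∧ ∀ i, 2 * u i - q.C u i = 1 := by
  let M : (V → ℝ) →ₗ[ℝ] (V → ℝ) := (2 : ℝ) • LinearMap.id - q.C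
  have hM : ∀ x i, M x i = 2 * x i - q.C x i := fun x i => rfl
  have hinj : Function.Injective M := by
    rw [← LinearMap.ker_eq_bot, LinearMap.ker_eq_bot']
    intro x hx
    by_contra hx0
    have := h x hx0
    simp only [← hM, hx] at this
    simp at this
  obtain ⟨u, hu⟩ := (LinearMap.injective_iff_surjective.1 hinj) (fun _ => 1)
  have hu' : ∀ i, 2 * u i - q.C u i = 1 := fun i => by rw [← hM, hu]
  refine ⟨u, ?_, hu'⟩
  let w : V → ℝ := fun i => max (- u i) 0
  have hw0 : ∀ i, 0 ≤ w i := fun i => le_max_right _ _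
  have huw : ∀ i, 0 ≤ (u + w) i := fun i => by
    have : - u i ≤ w i := le_max_left _ _
    simp only [Pi.add_apply]; linarith
  have hw1 : ∀ i, w i * (u + w) i = 0 := by
    intro i
    simp only [Pi.add_apply, w]
    rcases le_total (- u i) 0 with h | h
    · rw [max_eq_right h]; simp
    · rw [max_eq_left h]; simp
  suffices hw : w = 0 by
    intro i
    have := huw i
    rw [hw] at this
    simpa using this
  by_contra hw
  have h1 := h w hw
  have h2 : ∑ i, w i * (2 * w i - q.C w i)
      = ∑ i, 2 * (w i * (u + w) i) - ∑ i, w i * q.C (u + w) i - ∑ i, w i * (2 * u i - q.C u i) := by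
    rw [← Finset.sum_sub_distrib, ← Finset.sum_sub_distrib]
    refine Finset.sum_congr rfl fun i _ => ?_
    rw [map_add]; simp only [Pi.add_apply]; ring
  rw [h2] at h1
  simp only [hw1, hu'] at h1
  rw [q.sum_C] at h1
  have h3 : 0 ≤ ∑ d, w (q.t d) * (u + w) (q.s d) :=
    Finset.sum_nonneg fun d _ => mul_nonneg (hw0 _) (huw _)
  have h4 : 0 ≤ ∑ i, w i * 1 := Finset.sum_nonneg fun i _ => by simpa using hw0 i
  simp only [mul_zero, Finset.sum_const_zero] at h1
  linarith

variable {q : DQ k V D} {A : Type} [Ring A] [Algebra k A]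

noncomputable def DUni.hr (U : DUni q A) (j : V) (n : ℕ) : V → ℝ := fun i => U.h j n i

noncomputable def DUni.T (U : DUni q A) (j : V) (N : ℕ) : V → ℝ :=
  ∑ m ∈ Finset.range (N + 1), U.hr j m

theorem DUni.hr_nonneg (U : DUni q A) (j : V) (N : ℕ) (i : V) : 0 ≤ U.hr j N i := Nat.cast_nonneg _

theorem DUni.T_apply (U : DUni q A) (j : V) (N : ℕ) (i : V) :
    U.T j N i = ∑ m ∈ Finset.range (N + 1), U.hr j m i := by
  simp [DUni.T]

theorem DUni.hr_one (U : DUni q A) (j : V) : U.hr j 1 = q.C (U.hr j 0) := by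
  funext i
  simp only [DUni.hr, q.C_apply, U.h_one, Nat.cast_sum]

theorem DUni.hr_succ (U : DUni q A) (j : V) (n : ℕ) (hs : ¬ U.Soc j n) :
    U.hr j (n + 2) + U.hr j n = q.C (U.hr j (n + 1)) := by
  funext i
  have := U.h_succ j n hs i
  simp only [DUni.hr, q.C_apply, Pi.add_apply]
  exact_mod_cast this

theorem DUni.T_rec (U : DUni q A) (j : V) (N : ℕ) (hN : ∀ m < N, ¬ U.Soc j m) (i : V) :
    2 * U.T j N i - q.C (U.T j N) i
      = (if i = j then 1 else 0) + U.hr j N i - U.hr j (N + 1) i := by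
  induction N with
  | zero =>
    have : U.T j 0 = U.hr j 0 := by simp [DUni.T]
    rw [this, ← U.hr_one]
    simp only [DUni.hr, U.h_zero]
    push_cast; ring
  | succ N ih =>
    have h1 : U.T j (N + 1) = U.T j N + U.hr j (N + 1) := by
      simp [DUni.T, Finset.sum_range_succ _ (N + 1)]
    rw [h1, map_add, ← U.hr_succ j N (hN N (by omega))]
    have := ih fun m hm => hN m (by omega)
    simp only [Pi.add_apply]
    linarith

theorem DUni.pos_of_soc (U : DUni q A) (hc : q.Conn) (j : V) (hs : ∃ n, U.Soc j n) : q.Pos := by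
  classical
  have hmin := fun m => Nat.find_min hs (m := m)
  obtain ⟨i, x, hx, -, -, -, hv⟩ := U.death j (Nat.find hs) (fun m hm => hmin m hm)
    (Nat.find_spec hs)
  set n := Nat.find hs
  have hrec := U.T_rec j n (fun m hm => hmin m hm)
  have h0 : ∀ i, U.hr j (n + 1) i = 0 := fun i => by
    simp [DUni.hr, U.h_eq_zero j (n + 1) (hv _ (by omega)) i]
  have hTj : 1 ≤ U.T j n j := by
    rw [U.T_apply]
    refine le_trans ?_ (Finset.single_le_sum (fun m _ => U.hr_nonneg j m j)
      (Finset.mem_range.2 (Nat.succ_pos n)))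
    simp [DUni.hr, U.h_zero]
  refine q.vinberg hc (U.T j n) j ?_ (by linarith) ?_ ?_
  · intro i; rw [U.T_apply]; exact Finset.sum_nonneg fun m _ => U.hr_nonneg j m i
  · intro i; rw [hrec, h0]
    have := U.hr_nonneg j n i
    split_ifs <;> linarith
  · rw [hrec, h0, if_pos rfl]
    have := U.hr_nonneg j n j
    linarith

theorem DUni.soc_of_pos (U : DUni q A) (hp : q.Pos) (j : V) : ∃ n, U.Soc j n := by
  by_contra! hs
  obtain ⟨u, hu0, hu⟩ := hp.exists_u
  let g : ℕ → ℝ := fun N => ∑ i, u i * U.hr j N i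
  have hg0 : ∀ N, 0 ≤ g N := fun N =>
    Finset.sum_nonneg fun i _ => mul_nonneg (hu0 i) (U.hr_nonneg j N i)
  have hT : ∀ N : ℕ, ((N : ℝ) + 1) ≤ ∑ i, U.T j N i := by
    intro N
    simp only [U.T_apply]
    rw [Finset.sum_comm]
    have : ∀ m ∈ Finset.range (N + 1), (1 : ℝ) ≤ ∑ i, U.hr j m i := by
      intro m _
      obtain ⟨i, hi⟩ := U.h_pos j m (fun m _ => hs m)
      refine le_trans ?_ (Finset.single_le_sum (fun i _ => U.hr_nonneg j m i) (Finset.mem_univ i))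
      simp only [DUni.hr]; exact_mod_cast hi
    have h2 := Finset.card_nsmul_le_sum _ _ _ this
    simpa using h2
  have hstep : ∀ N, ∑ i, U.T j N i = u j + g N - g (N + 1) := by
    intro N
    have e1 : ∑ i, u i * (2 * U.T j N i - q.C (U.T j N) i)
        = ∑ i, U.T j N i * (2 * u i - q.C u i) := by
      simp only [mul_sub, Finset.sum_sub_distrib]
      rw [q.C_symm]
      congr 1
      exact Finset.sum_congr rfl fun i _ => by ring
    simp only [hu, mul_one] at e1
    rw [← e1]
    simp only [U.T_rec j N (fun m _ => hs m), mul_add, mul_sub, Finset.sum_add_distrib,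
      Finset.sum_sub_distrib]
    simp [g]
  have hbd : ∀ N : ℕ, g N ≤ g 0 + N * u j - N * (N + 1) / 2 := by
    intro N
    induction N with
    | zero => simp
    | succ N ih =>
      have := hstep N
      have := hT N
      push_cast
      nlinarith
  have hg00 : g 0 = u j := by simp [g, DUni.hr, U.h_zero]
  obtain ⟨N, hN⟩ := exists_nat_gt (2 * (u j + 1))
  have h1 := hbd N
  have h2 := hg0 N
  have h3 := hu0 j
  rw [hg00] at h1
  nlinarith

/-- death data -/
structure DUni.Death (U : DUni q A) (j : V) (n : ℕ) (i : V) (x : A) : Prop where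
  low : ∀ m < n, ¬ U.Soc j m
  mem : x ∈ U.H j n
  ne : x ≠ 0
  xe : x * U.e i = x
  top : ∀ y ∈ U.H j n, ∃ c : k, y = c • x
  van : ∀ m, n < m → ∀ y ∈ U.H j m, y = 0

theorem DUni.exists_death (U : DUni q A) (hp : q.Pos) (j : V) :
    ∃ n i x, U.Death j n i x := by
  classical
  have hs := U.soc_of_pos hp j
  obtain ⟨i, x, h1, h2, h3, h4, h5⟩ := U.death j (Nat.find hs) (fun m => Nat.find_min hs)
    (Nat.find_spec hs)
  exact ⟨_, i, x, fun m => Nat.find_min hs, h1, h2, h3, h4, h5⟩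

theorem DUni.Death.hr_top {U : DUni q A} {j n i x} (h : U.Death j n i x) :
    U.hr j n = fun l => if l = i then 1 else 0 := by
  funext l
  simp only [DUni.hr, U.h_top j n i x h.mem h.ne h.xe h.top l]
  push_cast; rfl

theorem DUni.Death.hr_van {U : DUni q A} {j n i x} (h : U.Death j n i x) :
    U.hr j (n + 1) = 0 := by
  funext l
  simp [DUni.hr, U.h_eq_zero j (n + 1) (h.van _ (by omega)) l]

theorem DUni.hr_ne (U : DUni q A) (j : V) (n : ℕ) (hn : ∀ m < n, ¬ U.Soc j m) : U.hr j n ≠ 0 := by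
  obtain ⟨i, hi⟩ := U.h_pos j n hn
  intro h
  have := congrFun h i
  simp only [DUni.hr, Pi.zero_apply, Nat.cast_eq_zero] at this
  omega

theorem DUni.Death.inj_aux {U : DUni q A} {j n l m i : _} {x y : A} (h : U.Death j n i x)
    (h' : U.Death l m i y) (hnm : n ≤ m) : j = l := by
  have key : ∀ r ≤ n, U.hr j (n - r) = U.hr l (m - r) ∧
      U.hr j (n - r + 1) = U.hr l (m - r + 1) := by
    intro r hr
    induction r with
    | zero =>
      simp only [Nat.sub_zero]
      rw [h.hr_top, h'.hr_top, h.hr_van, h'.hr_van]; exact ⟨rfl, rfl⟩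
    | succ r ih =>
      obtain ⟨h1, h2⟩ := ih (by omega)
      have e1 : n - r = n - (r + 1) + 1 := by omega
      have e2 : m - r = m - (r + 1) + 1 := by omega
      rw [e1, e2] at h1 h2
      refine ⟨?_, h1⟩
      have r1 := U.hr_succ j (n - (r + 1)) (h.low _ (by omega))
      have r2 := U.hr_succ l (m - (r + 1)) (h'.low _ (by omega))
      rw [h1, h2, ← r2] at r1
      exact add_left_cancel r1
  obtain ⟨k1, k2⟩ := key n le_rfl
  rw [Nat.sub_self] at k1 k2
  rcases hnm.lt_or_eq with hlt | heq
  · exfalso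
    have e2 : m - n = m - (n + 1) + 1 := by omega
    rw [e2] at k1 k2
    have r2 := U.hr_succ l (m - (n + 1)) (h'.low _ (by omega))
    rw [← k2, ← k1, zero_add, U.hr_one] at r2
    exact U.hr_ne l (m - (n + 1)) (fun m' hm' => h'.low _ (by omega)) (by simpa using r2)
  · subst heq
    rw [Nat.sub_self] at k1
    have := congrFun k1 j
    simp only [DUni.hr, U.h_zero] at this
    by_contra hne
    simp [hne] at this

theorem DUni.Death.inj {U : DUni q A} {j n l m i : _} {x y : A} (h : U.Death j n i x)
    (h' : U.Death l m i y) : j = l := by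
  rcases le_total n m with hle | hle
  · exact h.inj_aux h' hle
  · exact (h'.inj_aux h hle).symm

end


section
variable {k V D : Type} [Field k] [Fintype V] [DecidableEq V] [Fintype D]
  {q : DQ k V D} {A : Type} [Ring A] [Algebra k A]

theorem DRel.sum_e_mul (U : DRel q A) (x : A) : ∑ j, U.e j * x = x := by
  rw [← Finset.sum_mul, U.sum_one, one_mul]

theorem DRel.sum_mul_e (U : DRel q A) (x : A) : ∑ j, x * U.e j = x := by
  rw [← Finset.mul_sum, U.sum_one, mul_one]

theorem DUni.Death.reach_aux {U : DUni q A} {j n i x} (h : U.Death j n i x) (r : ℕ) :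
    ∀ (m : ℕ) (w : A), m + r = n → U.e j * w = w → (∀ m' < m, U.p m' w = 0) → U.p m w ≠ 0 →
      ∃ y, w * y = x := by
  induction r with
  | zero =>
    intro m w hm hw hl h0
    rw [add_zero] at hm
    subst hm
    have hH : ∀ l, U.p l w ∈ U.H j l := fun l =>
      ⟨by rw [U.p_p, if_pos rfl], by rw [← U.p_e_mul, hw]⟩
    have hwp : w = U.p m w := by
      rw [← sub_eq_zero]
      apply U.eq_zero_of_p
      intro l
      rw [map_sub, U.p_p]
      rcases lt_trichotomy l m with hlt | heq | hgt
      · rw [hl l hlt, if_neg (by omega), sub_zero]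
      · rw [if_pos heq, heq, sub_self]
      · rw [h.van l hgt _ (hH l), if_neg (by omega), sub_zero]
    obtain ⟨c, hc⟩ := h.top _ (hH m)
    have hc0 : c ≠ 0 := by
      rintro rfl
      rw [zero_smul] at hc
      exact h0 hc
    refine ⟨c⁻¹ • 1, ?_⟩
    rw [hwp, hc, mul_smul_comm, mul_one, smul_smul, inv_mul_cancel₀ hc0, one_smul]
  | succ r ih =>
    intro m w hm hw hl h0
    have hH : U.p m w ∈ U.H j m :=
      ⟨by rw [U.p_p, if_pos rfl], by rw [← U.p_e_mul, hw]⟩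
    have : ∃ d, U.p m w * U.a d ≠ 0 := by
      by_contra! hc
      exact h0 (U.eq_zero_of_notSoc (h.low m (by omega)) hH hc)
    obtain ⟨d, hd⟩ := this
    obtain ⟨y, hy⟩ := ih (m + 1) (w * U.a d) (by omega) (by rw [← mul_assoc, hw])
      (by
        intro m' hm'
        cases m' with
        | zero => exact U.p_zero_mul_a _ _
        | succ m' => rw [U.p_succ_mul_a, hl m' (by omega), zero_mul])
      (by rw [U.p_succ_mul_a]; exact hd)
    exact ⟨U.a d * y, by rw [← mul_assoc, hy]⟩

theorem DUni.Death.reach {U : DUni q A} {j n i x} (h : U.Death j n i x) (w : A)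
    (hw : U.e j * w = w) (h0 : w ≠ 0) : ∃ y, w * y = x := by
  classical
  have hex : ∃ m, U.p m w ≠ 0 := by
    by_contra! hc
    exact h0 (U.eq_zero_of_p w hc)
  have hle : Nat.find hex ≤ n := by
    by_contra hlt
    refine Nat.find_spec hex (h.van _ (not_le.1 hlt) _ ?_)
    exact ⟨by rw [U.p_p, if_pos rfl], by rw [← U.p_e_mul, hw]⟩
  refine h.reach_aux (n - Nat.find hex) (Nat.find hex) w (by omega) hw ?_ (Nat.find_spec hex)
  intro m' hm'
  simpa using Nat.find_min hex hm'

theorem DUni.injective_of_pos (U : DUni q A) (hp : q.Pos) : Module.Injective A A := by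
  classical
  choose n σ x hd using fun j => U.exists_death hp j
  have hσ : ∀ j l, σ j = σ l → j = l := by
    intro j l hjl
    have h1 := hd j
    rw [hjl] at h1
    exact h1.inj (hd l)
  -- finite dimensional
  have hfin : Module.Finite k A := by
    obtain ⟨N, hN⟩ : ∃ N, ∀ j, n j ≤ N := ⟨∑ j, n j, fun j =>
      Finset.single_le_sum (f := n) (fun _ _ => Nat.zero_le _) (Finset.mem_univ j)⟩
    have hv : ∀ m, N < m → ∀ y, U.p m y = 0 := by
      intro m hm y
      rw [← U.sum_e_mul (U.p m y)]
      refine Finset.sum_eq_zero fun j _ => ?_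
      exact (hd j).van m (by have := hN j; omega) _ (U.proj_mem_H j m y)
    have hf : ∀ m : Fin (N + 1), Module.Finite k (LinearMap.range (U.p m)) := fun m =>
      Module.Finite.iff_fg.2 (U.finite_p m)
    let F : A →ₗ[k] ((m : Fin (N + 1)) → LinearMap.range (U.p m)) :=
      LinearMap.pi fun m => (U.p m).rangeRestrict
    refine Module.Finite.of_injective F ?_
    rw [← LinearMap.ker_eq_bot, LinearMap.ker_eq_bot']
    intro y hy
    apply U.eq_zero_of_p
    intro m
    by_cases hm : N < m
    · exact hv m hm y
    · exact congrArg Subtype.val (congrFun hy ⟨m, by omega⟩)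
  have hχ : ∀ j, ∃ χ : A →ₗ[k] k, χ (x j) = 1 := by
    intro j
    obtain ⟨χ, hχ⟩ := LinearMap.exists_extend_of_notMem (p := (⊥ : Submodule k A)) (v := x j) 0
      (by simpa using (hd j).ne) (1 : k)
    exact ⟨χ, hχ.2⟩
  choose χ hχ using hχ
  let lam : A →ₗ[k] k := ∑ j, (χ j).comp
    ((LinearMap.mulLeft k (U.e j)).comp (LinearMap.mulRight k (U.e (σ j))))
  have hlam : ∀ z, lam z = ∑ j, χ j (U.e j * (z * U.e (σ j))) := by
    intro z; simp [lam, LinearMap.sum_apply]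
  have hnd : ∀ z, z ≠ 0 → ∃ y, lam (z * y) ≠ 0 := by
    intro z hz
    have : ∃ j, U.e j * z ≠ 0 := by
      by_contra! hc
      apply hz
      rw [← U.sum_e_mul z]
      exact Finset.sum_eq_zero fun j _ => hc j
    obtain ⟨j, hj⟩ := this
    obtain ⟨y, hy⟩ := (hd j).reach (U.e j * z) (by rw [← mul_assoc, U.orth, if_pos rfl]) hj
    refine ⟨y * U.e (σ j), ?_⟩
    rw [hlam, Finset.sum_eq_single j]
    · have : U.e j * (z * (y * U.e (σ j)) * U.e (σ j)) = x j := by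
        calc U.e j * (z * (y * U.e (σ j)) * U.e (σ j))
            = (U.e j * z * y) * (U.e (σ j) * U.e (σ j)) := by noncomm_ring
          _ = x j := by rw [hy, U.orth, if_pos rfl, (hd j).xe]
      rw [this, hχ]; exact one_ne_zero
    · intro l _ hl
      have : z * (y * U.e (σ j)) * U.e (σ l) = z * y * (U.e (σ j) * U.e (σ l)) := by noncomm_ring
      rw [this, U.orth, if_neg (fun h => hl (hσ _ _ h).symm)]
      simp
    · simp
  let B : A →ₗ[k] A →ₗ[k] k := (LinearMap.mul k A).compr₂ lam
  have hB : ∀ a b, B a b = lam (a * b) := fun a b => rfl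
  have hBinj : Function.Injective B := by
    rw [← LinearMap.ker_eq_bot, LinearMap.ker_eq_bot']
    intro z hz
    by_contra h0
    obtain ⟨y, hy⟩ := hnd z h0
    exact hy (by rw [← hB, hz]; rfl)
  have hfs : Function.Surjective B.flip := by
    have h1 : Function.Surjective B.dualMap := LinearMap.dualMap_surjective_of_injective hBinj
    intro μ
    obtain ⟨ν, hν⟩ := h1 μ
    obtain ⟨b, rfl⟩ := (Module.evalEquiv k A).surjective ν
    exact ⟨b, by rw [← hν]; ext a; rfl⟩
  have hfi : Function.Injective B.flip := by
    have : Module.finrank k A = Module.finrank k (A →ₗ[k] k) := (Subspace.dual_finrank_eq).symm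
    exact (LinearMap.injective_iff_surjective_of_finrank_eq_finrank this).2 hfs
  apply Module.Baer.injective
  intro I g
  let gk : (I.restrictScalars k : Submodule k A) →ₗ[k] k := lam.comp
    { toFun := fun y => g ⟨y.1, y.2⟩
      map_add' := fun y z => by rw [← map_add]; rfl
      map_smul' := fun c y => by
        rw [RingHom.id_apply, ← algebraMap_smul A c (g _), ← map_smul]
        congr 1
        apply Subtype.ext
        simp }
  obtain ⟨μ, hμ⟩ := LinearMap.exists_extend gk
  obtain ⟨b, hb⟩ := hfs μ
  refine ⟨LinearMap.toSpanSingleton A A b, fun y hy => ?_⟩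
  rw [LinearMap.toSpanSingleton_apply, smul_eq_mul]
  apply hfi
  ext w
  rw [LinearMap.flip_apply, LinearMap.flip_apply, hB, hB, ← mul_assoc]
  have h1 : lam (w * y * b) = μ (w * y) := by rw [← hb]; rfl
  have h2 : μ (w * y) = lam (g ⟨w * y, I.mul_mem_left w hy⟩) :=
    LinearMap.congr_fun hμ ⟨w * y, I.mul_mem_left w hy⟩
  have h3 : g ⟨w * y, I.mul_mem_left w hy⟩ = w * g ⟨y, hy⟩ := g.map_smul w ⟨y, hy⟩
  rw [h1, h2, h3]

end


section
variable {k V D : Type} [Field k] [Fintype V] [DecidableEq V] [Fintype D] [DecidableEq D]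
  {q : DQ k V D} {A : Type} [Ring A] [Algebra k A]
  (M : Type) [AddCommGroup M] [Module k M] [Module A M] [IsScalarTower k A M]

/-- `x ⊗ m ↦ x a ⊗ b m` -/
noncomputable def rr (k : Type) [Field k] {A : Type} [Ring A] [Algebra k A]
    (M : Type) [AddCommGroup M] [Module k M] [Module A M] [IsScalarTower k A M] (a b : A) :
    A ⊗[k] M →ₗ[A] A ⊗[k] M :=
  TensorProduct.AlgebraTensorModule.map (LinearMap.toSpanSingleton A A a) (Algebra.lsmul k k M b)

theorem rr_tmul {k : Type} [Field k] {A : Type} [Ring A] [Algebra k A]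
    {M : Type} [AddCommGroup M] [Module k M] [Module A M] [IsScalarTower k A M]
    (a b x : A) (m : M) : rr k M a b (x ⊗ₜ m) = (x * a) ⊗ₜ[k] (b • m) := rfl

noncomputable def DUni.E0 (U : DUni q A) : A ⊗[k] M →ₗ[A] A ⊗[k] M :=
  ∑ i, rr k M (U.e i) (U.e i)

noncomputable def DUni.E1 (U : DUni q A) : (D → A ⊗[k] M) →ₗ[A] (D → A ⊗[k] M) :=
  LinearMap.pi fun d => (rr k M (U.e (q.t d)) (U.e (q.s d))).comp (LinearMap.proj d)

noncomputable def DUni.d0 (_U : DUni q A) : A ⊗[k] M →ₗ[A] M :=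
  TensorProduct.AlgebraTensorModule.lift
    { toFun := fun a => Algebra.lsmul k k M a
      map_add' := fun a b => by simp
      map_smul' := fun a b => by ext m; simp }

noncomputable def DUni.d1 (U : DUni q A) : (D → A ⊗[k] M) →ₗ[A] A ⊗[k] M :=
  ∑ d, (rr k M (U.a d) (U.e (q.s d)) - rr k M (U.e (q.t d)) (U.a d)).comp (LinearMap.proj d)

noncomputable def DUni.d2 (U : DUni q A) : A ⊗[k] M →ₗ[A] (D → A ⊗[k] M) :=
  LinearMap.pi fun d => q.ε d • rr k M (U.e (q.t d)) (U.a (q.st d)) +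
    q.ε (q.st d) • rr k M (U.a (q.st d)) (U.e (q.s d))

set_option linter.unusedSectionVars false
variable {M}

theorem DUni.d0_tmul (U : DUni q A) (x : A) (m : M) : U.d0 M (x ⊗ₜ m) = x • m := rfl

theorem DUni.E0_tmul (U : DUni q A) (x : A) (m : M) :
    U.E0 M (x ⊗ₜ m) = ∑ i, (x * U.e i) ⊗ₜ[k] (U.e i • m) := by
  simp [DUni.E0, LinearMap.sum_apply, rr_tmul]

theorem DUni.E1_apply (U : DUni q A) (z : D → A ⊗[k] M) (d : D) :
    U.E1 M z d = rr k M (U.e (q.t d)) (U.e (q.s d)) (z d) := rfl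

theorem DUni.d2_apply (U : DUni q A) (z : A ⊗[k] M) (d : D) :
    U.d2 M z d = q.ε d • rr k M (U.e (q.t d)) (U.a (q.st d)) z +
    q.ε (q.st d) • rr k M (U.a (q.st d)) (U.e (q.s d)) z := rfl

theorem DUni.d1_apply (U : DUni q A) (z : D → A ⊗[k] M) :
    U.d1 M z = ∑ d, (rr k M (U.a d) (U.e (q.s d)) (z d) - rr k M (U.e (q.t d)) (U.a d) (z d)) := by
  simp [DUni.d1, LinearMap.sum_apply]

theorem DUni.d1_single (U : DUni q A) (d : D) (z : A ⊗[k] M) :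
    U.d1 M (Pi.single d z) = rr k M (U.a d) (U.e (q.s d)) z - rr k M (U.e (q.t d)) (U.a d) z := by
  rw [U.d1_apply, Finset.sum_eq_single d]
  · simp
  · intro d' _ h; simp [h]
  · simp

theorem ext1 {N : Type} [AddCommGroup N] [Module A N] {f g : A ⊗[k] M →ₗ[A] N}
    (h : ∀ x m, f (x ⊗ₜ[k] m) = g (x ⊗ₜ[k] m)) (z : A ⊗[k] M) : f z = g z := by
  induction z using TensorProduct.induction_on with
  | zero => simp
  | tmul x m => exact h x m
  | add a b ha hb => rw [map_add, map_add, ha, hb]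

theorem DUni.E0_mul_e (U : DUni q A) (x : A) (m : M) (i : V) :
    U.E0 M ((x * U.e i) ⊗ₜ m) = (x * U.e i) ⊗ₜ[k] (U.e i • m) := by
  rw [U.E0_tmul, Finset.sum_eq_single i]
  · rw [mul_assoc, U.orth, if_pos rfl]
  · intro j _ hj
    rw [mul_assoc, U.orth, if_neg (Ne.symm hj), mul_zero, TensorProduct.zero_tmul]
  · simp

theorem DUni.E0_e_smul (U : DUni q A) (x : A) (m : M) (i : V) :
    U.E0 M (x ⊗ₜ (U.e i • m)) = (x * U.e i) ⊗ₜ[k] (U.e i • m) := by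
  rw [U.E0_tmul, Finset.sum_eq_single i]
  · rw [smul_smul, U.orth, if_pos rfl]
  · intro j _ hj
    rw [smul_smul, U.orth, if_neg hj, zero_smul, TensorProduct.tmul_zero]
  · simp

theorem DUni.a_smul (U : DUni q A) (d : D) (m : M) : U.e (q.t d) • U.a d • m = U.a d • m := by
  rw [smul_smul, U.ht]

theorem DUni.a_st_smul (U : DUni q A) (d : D) (m : M) :
    U.e (q.s d) • U.a (q.st d) • m = U.a (q.st d) • m := by
  rw [smul_smul, ← q.t_st, U.ht]

theorem DUni.E0_a (U : DUni q A) (x : A) (m : M) (d : D) :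
    U.E0 M ((x * U.a d) ⊗ₜ m) = (x * U.a d) ⊗ₜ[k] (U.e (q.s d) • m) := by
  rw [← U.hs d, ← mul_assoc, U.E0_mul_e]

theorem DUni.E0_a_smul (U : DUni q A) (x : A) (m : M) (d : D) :
    U.E0 M (x ⊗ₜ (U.a d • m)) = (x * U.e (q.t d)) ⊗ₜ[k] (U.a d • m) := by
  rw [← U.a_smul, U.E0_e_smul]

theorem DUni.E0_E0 (U : DUni q A) (z : A ⊗[k] M) : U.E0 M (U.E0 M z) = U.E0 M z := by
  refine ext1 (f := (U.E0 M).comp (U.E0 M)) (g := U.E0 M) (fun x m => ?_) z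
  rw [LinearMap.comp_apply]
  conv_lhs => rw [U.E0_tmul, map_sum]
  simp only [U.E0_mul_e, smul_smul, U.orth, if_pos]
  rw [U.E0_tmul]

theorem DUni.E1_E1 (U : DUni q A) (z : D → A ⊗[k] M) : U.E1 M (U.E1 M z) = U.E1 M z := by
  funext d
  rw [U.E1_apply, U.E1_apply]
  refine ext1 (f := (rr k M (U.e (q.t d)) (U.e (q.s d))).comp (rr k M (U.e (q.t d)) (U.e (q.s d))))
    (g := (rr k M (U.e (q.t d)) (U.e (q.s d)))) (fun x m => ?_) (z d)
  rw [LinearMap.comp_apply, rr_tmul, rr_tmul, smul_smul, mul_assoc, U.orth, U.orth, if_pos rfl,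
    if_pos rfl]

theorem DUni.d0_E0 (U : DUni q A) (z : A ⊗[k] M) : U.d0 M (U.E0 M z) = U.d0 M z := by
  refine ext1 (f := (U.d0 M).comp (U.E0 M)) (g := U.d0 M) (fun x m => ?_) z
  rw [LinearMap.comp_apply, U.E0_tmul, map_sum]
  simp only [U.d0_tmul, smul_smul, mul_assoc, U.orth, if_pos]
  rw [← Finset.sum_smul, U.sum_mul_e]

theorem DUni.E0_d1 (U : DUni q A) (z : D → A ⊗[k] M) : U.E0 M (U.d1 M z) = U.d1 M z := by
  rw [U.d1_apply, map_sum]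
  refine Finset.sum_congr rfl fun d _ => ?_
  refine ext1 (f := (U.E0 M).comp (rr k M (U.a d) (U.e (q.s d)) - rr k M (U.e (q.t d)) (U.a d)))
    (g := (rr k M (U.a d) (U.e (q.s d)) - rr k M (U.e (q.t d)) (U.a d))) (fun x m => ?_) (z d)
  rw [LinearMap.comp_apply, LinearMap.sub_apply, map_sub, rr_tmul, rr_tmul, U.E0_a, U.E0_a_smul,
    smul_smul, mul_assoc x, U.orth, U.orth, if_pos rfl, if_pos rfl]

theorem DUni.E1_d2 (U : DUni q A) (z : A ⊗[k] M) : U.E1 M (U.d2 M z) = U.d2 M z := by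
  funext d
  rw [U.E1_apply]
  refine ext1 (f := (rr k M (U.e (q.t d)) (U.e (q.s d))).comp ((LinearMap.proj d).comp (U.d2 M)))
    (g := (LinearMap.proj d).comp (U.d2 M)) (fun x m => ?_) z
  simp only [LinearMap.comp_apply, LinearMap.proj_apply, U.d2_apply, map_add,
    LinearMap.map_smul_of_tower, rr_tmul]
  rw [mul_assoc, U.orth, if_pos rfl, U.a_st_smul, mul_assoc, U.a_e, q.s_st, if_pos rfl, smul_smul,
    U.orth, if_pos rfl]

theorem DUni.d2_E0 (U : DUni q A) (z : A ⊗[k] M) : U.d2 M (U.E0 M z) = U.d2 M z := by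
  refine ext1 (f := (U.d2 M).comp (U.E0 M)) (g := U.d2 M) (fun x m => ?_) z
  funext d
  rw [LinearMap.comp_apply, U.E0_tmul, map_sum, Finset.sum_apply]
  simp only [U.d2_apply, rr_tmul, mul_assoc, U.orth, U.e_a, smul_smul, U.a_e, q.s_st, q.t_st,
    Finset.sum_add_distrib]
  congr 1
  · rw [← Finset.smul_sum, Finset.sum_eq_single (q.t d)]
    · simp
    · intro i _ hi; simp [hi]
    · simp
  · rw [← Finset.smul_sum, Finset.sum_eq_single (q.s d)]
    · simp
    · intro i _ hi; simp [Ne.symm hi]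
    · simp

theorem DUni.d0_d1 (U : DUni q A) (z : D → A ⊗[k] M) : U.d0 M (U.d1 M z) = 0 := by
  rw [U.d1_apply, map_sum]
  refine Finset.sum_eq_zero fun d _ => ?_
  refine ext1 (f := (U.d0 M).comp (rr k M (U.a d) (U.e (q.s d)) - rr k M (U.e (q.t d)) (U.a d)))
    (g := 0) (fun x m => ?_) (z d)
  rw [LinearMap.comp_apply, LinearMap.sub_apply, map_sub, rr_tmul, rr_tmul, U.d0_tmul, U.d0_tmul,
    smul_smul, smul_smul, mul_assoc, U.hs, mul_assoc, U.ht]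
  simp

theorem DUni.d1_d2 (U : DUni q A) (z : A ⊗[k] M) : U.d1 M (U.d2 M z) = 0 := by
  refine ext1 (f := (U.d1 M).comp (U.d2 M)) (g := 0) (fun x m => ?_) z
  rw [LinearMap.comp_apply, U.d1_apply]
  simp only [U.d2_apply, rr_tmul, map_add, LinearMap.map_smul_of_tower, mul_assoc, U.ht, smul_smul,
    U.hs, U.orth, if_pos]
  have hst : ∀ f : D → A ⊗[k] M, ∑ d, f (q.st d) = ∑ d, f d := fun f =>
    Finset.sum_nbij' q.st q.st (by simp) (by simp) (fun d _ => q.st_st d) (fun d _ => q.st_st d)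
      (fun d _ => rfl)
  have h1 : ∑ d, q.ε (q.st d) • ((x * (U.a (q.st d) * U.a d)) ⊗ₜ[k] (U.e (q.s d) • m)) = 0 := by
    have : ∀ d, q.ε (q.st d) • ((x * (U.a (q.st d) * U.a d)) ⊗ₜ[k] (U.e (q.s d) • m))
      = (fun d => q.ε d • ((x * (U.a d * U.a (q.st d))) ⊗ₜ[k] (U.e (q.t d) • m))) (q.st d) := by
      intro d; simp only [q.st_st, q.t_st]
    rw [Finset.sum_congr rfl fun d _ => this d]
    refine (hst (fun d => q.ε d • ((x * (U.a d * U.a (q.st d))) ⊗ₜ[k] (U.e (q.t d) • m)))).trans ?_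
    have h2 : ∀ d, q.ε d • ((x * (U.a d * U.a (q.st d))) ⊗ₜ[k] (U.e (q.t d) • m))
        = ∑ i, (x * U.e i * (q.ε d • (U.a d * U.a (q.st d)))) ⊗ₜ[k] (U.e i • m) := by
      intro d
      rw [Finset.sum_eq_single (q.t d)]
      · rw [mul_smul_comm, mul_assoc, ← mul_assoc (U.e _), U.ht, TensorProduct.smul_tmul']
      · intro i _ hi
        rw [mul_smul_comm, mul_assoc, ← mul_assoc (U.e _), U.e_a, if_neg (Ne.symm hi)]
        simp
      · simp
    simp only [h2]
    rw [Finset.sum_comm]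
    refine Finset.sum_eq_zero fun i _ => ?_
    rw [← TensorProduct.sum_tmul, ← Finset.mul_sum, U.mesh]
    simp
  have h3 : ∑ d, q.ε d • ((x * U.e (q.t d)) ⊗ₜ[k] ((U.a d * U.a (q.st d)) • m)) = 0 := by
    have h2 : ∀ d, q.ε d • ((x * U.e (q.t d)) ⊗ₜ[k] ((U.a d * U.a (q.st d)) • m))
        = ∑ i, (x * U.e i) ⊗ₜ[k] (U.e i • (q.ε d • (U.a d * U.a (q.st d))) • m) := by
      intro d
      rw [Finset.sum_eq_single (q.t d)]
      · rw [smul_smul, mul_smul_comm, ← mul_assoc (U.e _), U.ht, ← TensorProduct.tmul_smul,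
          smul_assoc]
      · intro i _ hi
        rw [smul_smul, mul_smul_comm, ← mul_assoc (U.e _), U.e_a, if_neg (Ne.symm hi)]
        simp
      · simp
    simp only [h2]
    rw [Finset.sum_comm]
    refine Finset.sum_eq_zero fun i _ => ?_
    rw [← TensorProduct.tmul_sum, ← Finset.smul_sum, ← Finset.sum_smul, U.mesh]
    simp
  simp only [Finset.sum_sub_distrib, Finset.sum_add_distrib]
  rw [h1, h3, add_zero, zero_add, LinearMap.zero_apply, sub_eq_zero,
    ← hst (fun d => q.ε d • ((x * U.a d) ⊗ₜ[k] ((U.e (q.s d) * U.a (q.st d)) • m)))]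
  simp only [q.st_st, U.a_e, q.s_st, U.e_a, if_true]

end


section
variable {k V D : Type} [Field k] [Fintype V] [DecidableEq V] [Fintype D] [DecidableEq D]
  {q : DQ k V D} {A : Type} [Ring A] [Algebra k A]
  {M : Type} [AddCommGroup M] [Module k M] [Module A M] [IsScalarTower k A M]
set_option linter.unusedSectionVars false

theorem DUni.exact_P0 (U : DUni q A) (z : A ⊗[k] M) (h0 : U.d0 M z = 0) :
    ∃ w, U.d1 M w = U.E0 M z := by
  have key : ∀ x : A, ∀ m : M,
      U.E0 M (x ⊗ₜ m) - U.E0 M (1 ⊗ₜ (x • m)) ∈ LinearMap.range (U.d1 M) := by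
    intro x
    let W : Submodule k A :=
      { carrier := {x | ∀ m : M,
          U.E0 M (x ⊗ₜ m) - U.E0 M (1 ⊗ₜ (x • m)) ∈ LinearMap.range (U.d1 M)}
        add_mem' := by
          intro a b ha hb m
          have := Submodule.add_mem _ (ha m) (hb m)
          rw [TensorProduct.add_tmul, add_smul, TensorProduct.tmul_add, map_add, map_add]
          convert this using 1; abel
        zero_mem' := by
          intro m
          simp
        smul_mem' := by
          intro c a ha m
          rw [smul_assoc, ← TensorProduct.smul_tmul', TensorProduct.tmul_smul,
            LinearMap.map_smul_of_tower, LinearMap.map_smul_of_tower]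
          have := Submodule.smul_of_tower_mem _ c (ha m)
          rw [smul_sub] at this
          exact this }
    refine U.indR W ?_ ?_ ?_ x
    · intro m
      simp
    · intro x hx i m
      have := hx (U.e i • m)
      rw [U.E0_e_smul, smul_smul] at this
      rw [U.E0_mul_e]
      exact this
    · intro x hx d m
      have h1 := hx (U.a d • m)
      have h2 : U.d1 M (Pi.single d (x ⊗ₜ m)) ∈ LinearMap.range (U.d1 M) := ⟨_, rfl⟩
      rw [U.d1_single, rr_tmul, rr_tmul] at h2
      rw [U.E0_a_smul, smul_smul] at h1
      rw [U.E0_a]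
      have := Submodule.add_mem _ h1 h2
      convert this using 1; abel
  have key2 : ∀ z : A ⊗[k] M, U.E0 M z - U.E0 M (1 ⊗ₜ (U.d0 M z)) ∈ LinearMap.range (U.d1 M) := by
    intro z
    induction z using TensorProduct.induction_on with
    | zero => simp
    | tmul x m => exact key x m
    | add a b ha hb =>
      have := Submodule.add_mem _ ha hb
      rw [map_add, map_add, TensorProduct.tmul_add, map_add]
      convert this using 1; abel
  have := key2 z
  rw [h0] at this
  simpa using this

/-- the action of `A` on `M` as a representation -/
noncomputable def DUni.act (U : DUni q A) (M : Type) [AddCommGroup M] [Module k M] [Module A M]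
    [IsScalarTower k A M] : DRel q (Module.End k M) where
  e i := Algebra.lsmul k k M (U.e i)
  a d := Algebra.lsmul k k M (U.a d)
  orth i j := by
    rw [← map_mul, U.orth]; split_ifs <;> simp
  sum_one := by rw [← map_sum, U.sum_one, map_one]
  ht d := by rw [← map_mul, U.ht]
  hs d := by rw [← map_mul, U.hs]
  mesh := by
    simp_rw [← map_mul, ← map_smul]
    rw [← map_sum, U.mesh, map_zero]

theorem DUni.exact_P1 (U : DUni q A) (z : D → A ⊗[k] M) (h1 : U.d1 M z = 0) :
    ∃ w, U.d2 M w = U.E1 M z := by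
  let N := (D → A ⊗[k] M) ⧸ LinearMap.range (U.d2 M)
  let Q : (D → A ⊗[k] M) →ₗ[A] N := (LinearMap.range (U.d2 M)).mkQ
  let β : D → M →ₗ[k] N := fun d =>
    { toFun := fun m => Q (Pi.single d (U.e (q.t d) ⊗ₜ (U.e (q.s d) • m)))
      map_add' := fun m n => by
        rw [smul_add, TensorProduct.tmul_add, Pi.single_add, map_add]
      map_smul' := fun c m => by
        have : U.e (q.s d) • c • m = c • U.e (q.s d) • m := by
          rw [smul_algebra_smul_comm]
        rw [this, TensorProduct.tmul_smul, Pi.single_smul, LinearMap.map_smul_of_tower]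
        rfl }
  have hβ : ∀ d m, β d m = Q (Pi.single d (U.e (q.t d) ⊗ₜ (U.e (q.s d) • m))) := fun _ _ => rfl
  have hxβ : ∀ (x : A) d m, x • β d m = Q (Pi.single d ((x * U.e (q.t d)) ⊗ₜ (U.e (q.s d) • m))) := by
    intro x d m
    rw [hβ, ← map_smul, ← Pi.single_smul, TensorProduct.smul_tmul', smul_eq_mul]
  obtain ⟨δ, -, h2, h3⟩ := U.ext_module N M (U.act M) β
    (by
      intro d m
      rw [hxβ, U.orth, if_pos rfl, hβ])
    (by
      intro d m
      rw [hβ, hβ]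
      change Q (Pi.single d (U.e (q.t d) ⊗ₜ (U.e (q.s d) • U.e (q.s d) • m))) = _
      rw [smul_smul, U.orth, if_pos rfl])
    (by
      intro m
      have : Q (U.d2 M (1 ⊗ₜ m)) = 0 := by
        rw [Submodule.mkQ_apply, Submodule.Quotient.mk_eq_zero]; exact ⟨_, rfl⟩
      rw [← this]
      have h4 : U.d2 M (1 ⊗ₜ m) = ∑ d, Pi.single d (q.ε d • (U.e (q.t d)) ⊗ₜ[k] (U.a (q.st d) • m))
        + ∑ d, Pi.single d (q.ε (q.st d) • (U.a (q.st d)) ⊗ₜ[k] (U.e (q.s d) • m)) := by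
        rw [← Finset.sum_add_distrib]
        conv_lhs => rw [← Finset.univ_sum_single (U.d2 M (1 ⊗ₜ m))]
        refine Finset.sum_congr rfl fun d _ => ?_
        rw [← Pi.single_add, U.d2_apply, rr_tmul, rr_tmul, one_mul, one_mul]
      rw [h4, map_add, map_sum, map_sum, add_comm]
      simp only [smul_add, Finset.sum_add_distrib]
      congr 1
      · refine Finset.sum_nbij' q.st q.st (by simp) (by simp)
          (fun d _ => q.st_st d) (fun d _ => q.st_st d) (fun d _ => ?_)
        simp only [q.st_st, q.s_st]
        rw [hxβ, q.t_st, q.s_st, U.hs, Pi.single_smul, LinearMap.map_smul_of_tower]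
      · refine Finset.sum_congr rfl fun d _ => ?_
        rw [hβ]
        change _ • Q (Pi.single d (U.e (q.t d) ⊗ₜ (U.e (q.s d) • U.a (q.st d) • m))) = _
        rw [U.a_st_smul, Pi.single_smul, LinearMap.map_smul_of_tower])
  let Δ : A ⊗[k] M →ₗ[k] N := TensorProduct.lift δ
  have hΔ : ∀ d (w : A ⊗[k] M), Δ (U.d1 M (Pi.single d w)) =
      Q (Pi.single d (rr k M (U.e (q.t d)) (U.e (q.s d)) w)) := by
    intro d w
    induction w using TensorProduct.induction_on with
    | zero => simp
    | tmul x m =>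
      rw [U.d1_single, rr_tmul, rr_tmul, rr_tmul, map_sub]
      simp only [Δ, TensorProduct.lift.tmul]
      rw [h2, h3, hxβ]
      change _ + δ x (U.a d • U.e (q.s d) • m) - δ x (U.e (q.t d) • U.a d • m) = _
      rw [U.a_smul, smul_smul, smul_smul, U.orth, if_pos rfl, U.hs, add_sub_cancel_right]
    | add a b ha hb =>
      rw [Pi.single_add, map_add, map_add, ha, hb, map_add, Pi.single_add, map_add]
  have h5 : Δ (U.d1 M z) = Q (U.E1 M z) := by
    rw [← Finset.univ_sum_single (U.E1 M z)]
    conv_lhs => rw [← Finset.univ_sum_single z]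
    rw [map_sum, map_sum, map_sum]
    exact Finset.sum_congr rfl fun d _ => hΔ d _
  rw [h1, map_zero] at h5
  have := h5.symm
  rw [Submodule.mkQ_apply, Submodule.Quotient.mk_eq_zero] at this
  exact this


noncomputable def fcoord {k A M : Type} [Field k] [Ring A] [Algebra k A]
    [AddCommGroup M] [Module k M] (f : M →ₗ[k] k) : A ⊗[k] M →ₗ[k] A :=
  (TensorProduct.rid k A).toLinearMap.comp (f.lTensor A)

theorem fcoord_tmul {k A M : Type} [Field k] [Ring A] [Algebra k A]
    [AddCommGroup M] [Module k M] (f : M →ₗ[k] k) (x : A) (m : M) :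
    fcoord f (x ⊗ₜ[k] m) = f m • x := by
  simp [fcoord]

theorem eq_zero_of_fcoord {k A M : Type} [Field k] [Ring A] [Algebra k A]
    [AddCommGroup M] [Module k M] (z : A ⊗[k] M) (h : ∀ f : M →ₗ[k] k, fcoord f z = 0) : z = 0 := by
  classical
  let b := Module.Basis.ofVectorSpace k M
  let F := TensorProduct.equivFinsuppOfBasisRight (M := A) b
  have key : ∀ i z, F z i = fcoord (b.coord i) z := by
    intro i z
    induction z using TensorProduct.induction_on with
    | zero => simp
    | tmul x m =>
      rw [fcoord_tmul]
      simp [F]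
    | add a b ha hb => rw [map_add, map_add, Finsupp.add_apply, ha, hb]
  apply F.injective
  rw [map_zero]
  ext i
  rw [key, h]
  rfl

noncomputable def DUni.pz (U : DUni q A) (M : Type) [AddCommGroup M] [Module k M] (n : ℕ) :
    A ⊗[k] M →ₗ[k] A ⊗[k] M := (U.p n).rTensor M

theorem ext2 {N : Type} [AddCommGroup N] [Module k N] {f g : A ⊗[k] M →ₗ[k] N}
    (h : ∀ x m, f (x ⊗ₜ[k] m) = g (x ⊗ₜ[k] m)) (z : A ⊗[k] M) : f z = g z := by
  rw [TensorProduct.ext' h]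

theorem DUni.pz_e (U : DUni q A) (n : ℕ) (i : V) (b : A) (z : A ⊗[k] M) :
    U.pz M n (rr k M (U.e i) b z) = rr k M (U.e i) b (U.pz M n z) := by
  refine ext2 (f := (U.pz M n).comp ((rr k M (U.e i) b).restrictScalars k))
    (g := ((rr k M (U.e i) b).restrictScalars k).comp (U.pz M n)) (fun x m => ?_) z
  simp only [LinearMap.comp_apply, LinearMap.restrictScalars_apply, rr_tmul, DUni.pz,
    LinearMap.rTensor_tmul, U.p_mul_e]

theorem DUni.pz_a (U : DUni q A) (n : ℕ) (d : D) (b : A) (z : A ⊗[k] M) :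
    U.pz M (n + 1) (rr k M (U.a d) b z) = rr k M (U.a d) b (U.pz M n z) := by
  refine ext2 (f := (U.pz M (n + 1)).comp ((rr k M (U.a d) b).restrictScalars k))
    (g := ((rr k M (U.a d) b).restrictScalars k).comp (U.pz M n)) (fun x m => ?_) z
  simp only [LinearMap.comp_apply, LinearMap.restrictScalars_apply, rr_tmul, DUni.pz,
    LinearMap.rTensor_tmul, U.p_succ_mul_a]

theorem DUni.pz_f (U : DUni q A) (n : ℕ) (f : M →ₗ[k] k) (z : A ⊗[k] M) :
    fcoord f (U.pz M n z) = U.p n (fcoord f z) := by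
  refine ext2 (f := (fcoord f).comp (U.pz M n)) (g := (U.p n).comp (fcoord f)) (fun x m => ?_) z
  simp only [LinearMap.comp_apply, DUni.pz, LinearMap.rTensor_tmul, fcoord_tmul, map_smul]

theorem fcoord_rr (a : A) (f : M →ₗ[k] k) (z : A ⊗[k] M) :
    fcoord f (rr k M a 1 z) = fcoord f z * a := by
  refine ext2 (f := (fcoord f).comp ((rr k M a 1).restrictScalars k))
    (g := (LinearMap.mulRight k a).comp (fcoord f)) (fun x m => ?_) z
  simp only [LinearMap.comp_apply, LinearMap.restrictScalars_apply, rr_tmul, fcoord_tmul, one_smul,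
    LinearMap.mulRight_apply, smul_mul_assoc]

theorem DUni.rr_E0 (U : DUni q A) (d : D) (z : A ⊗[k] M) :
    rr k M (U.a d) 1 (U.E0 M z) = rr k M (U.a d) (U.e (q.t d)) z := by
  refine ext1 (f := (rr k M (U.a d) 1).comp (U.E0 M)) (g := rr k M (U.a d) (U.e (q.t d)))
    (fun x m => ?_) z
  rw [LinearMap.comp_apply, U.E0_tmul, map_sum, Finset.sum_eq_single (q.t d)]
  · rw [rr_tmul, rr_tmul, mul_assoc, U.ht, one_smul]
  · intro i _ hi
    rw [rr_tmul, mul_assoc, U.e_a, if_neg (Ne.symm hi), mul_zero, TensorProduct.zero_tmul]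
  · simp

theorem DUni.pz_E0 (U : DUni q A) (n : ℕ) (z : A ⊗[k] M) :
    U.pz M n (U.E0 M z) = U.E0 M (U.pz M n z) := by
  simp only [DUni.E0, LinearMap.sum_apply, map_sum, U.pz_e]

theorem DUni.pz_eventually (U : DUni q A) (z : A ⊗[k] M) : ∃ N, ∀ n, N ≤ n → U.pz M n z = 0 := by
  induction z using TensorProduct.induction_on with
  | zero => exact ⟨0, fun n _ => map_zero _⟩
  | tmul x m =>
    obtain ⟨N, h, -⟩ := U.sum_p x
    refine ⟨N, fun n hn => ?_⟩
    rw [DUni.pz, LinearMap.rTensor_tmul, h n hn, TensorProduct.zero_tmul]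
  | add a b ha hb =>
    obtain ⟨N1, h1⟩ := ha
    obtain ⟨N2, h2⟩ := hb
    refine ⟨max N1 N2, fun n hn => ?_⟩
    rw [map_add, h1 n (le_trans (le_max_left _ _) hn), h2 n (le_trans (le_max_right _ _) hn),
      add_zero]

theorem DUni.d2_inj (U : DUni q A) (hns : ∀ x : A, (∀ d, x * U.a d = 0) → x = 0)
    (z : A ⊗[k] M) (hz : U.E0 M z = z) (h : U.d2 M z = 0) : z = 0 := by
  have step : ∀ n, U.pz M (n + 1) z = 0 → U.pz M n z = 0 := by
    intro n hn
    apply eq_zero_of_fcoord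
    intro f
    apply hns
    intro d
    rw [← fcoord_rr, ← hz, U.pz_E0, U.rr_E0]
    have h1 := congrArg (U.pz M (n + 1)) (congrFun h (q.st d))
    rw [U.d2_apply, map_add, map_smul, map_smul, U.pz_e, hn, map_zero, smul_zero, zero_add,
      U.pz_a, q.st_st, q.s_st, Pi.zero_apply, map_zero] at h1
    rw [(smul_eq_zero.1 h1).resolve_left (q.ε_ne d), map_zero]
  obtain ⟨N, hN⟩ := U.pz_eventually z
  have all : ∀ n, U.pz M n z = 0 := by
    intro n
    have : ∀ m, U.pz M (N - m) z = 0 := by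
      intro m
      induction m with
      | zero => exact hN _ le_rfl
      | succ m ih =>
        by_cases hm : m < N
        · apply step
          rw [show N - (m + 1) + 1 = N - m by omega]; exact ih
        · rw [show N - (m + 1) = N - m by omega]; exact ih
    by_cases h : N ≤ n
    · exact hN n h
    · have := this (N - n)
      rwa [show N - (N - n) = n by omega] at this
  apply eq_zero_of_fcoord
  intro f
  apply U.eq_zero_of_p
  intro n
  rw [← U.pz_f, all, map_zero]

theorem DUni.noSoc (U : DUni q A) (h : ∀ j n, ¬ U.Soc j n) (x : A) (hx : ∀ d, x * U.a d = 0) :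
    x = 0 := by
  apply U.eq_zero_of_p
  intro n
  rw [← U.sum_e_mul (U.p n x)]
  refine Finset.sum_eq_zero fun j _ => U.eq_zero_of_notSoc (h j n) (U.proj_mem_H j n x) fun d => ?_
  rw [mul_assoc, ← U.p_succ_mul_a, hx, map_zero, mul_zero]

end


section
variable {C : Type 1} [Category C] [Abelian C]

theorem hasPD_of_pdLe_one {Z : C} (h3 : pdLe 1 Z) : HasProjectiveDimensionLT Z 2 := by
  obtain ⟨P, hP⟩ := h3
  have hz : P.complex.d 2 1 = 0 := (hP 2 (by norm_num)).eq_of_src _ _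
  have hm : Mono (P.complex.d 1 0) := (P.exact_succ 0).mono_g hz
  have hse : (ShortComplex.mk _ _ P.complex_d_comp_π_f_zero).ShortExact :=
    { exact := P.exact₀
      mono_f := hm
      epi_g := epi_of_isColimit_cofork P.isColimitCokernelCofork }
  have hp1 : Projective (P.complex.X 1) := P.projective 1
  have hp0 : Projective (P.complex.X 0) := P.projective 0
  exact (hse.hasProjectiveDimensionLT_X₃_iff 0 hp0).2
    (projective_iff_hasProjectiveDimensionLT_one.1 hp1)

theorem projective_of_pdLe_one {S : ShortComplex C} (hS : S.ShortExact) (h2 : Projective S.X₂)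
    (h3 : pdLe 1 S.X₃) : Projective S.X₁ :=
  projective_iff_hasProjectiveDimensionLT_one.2
    ((hS.hasProjectiveDimensionLT_X₃_iff 0 h2).1 (hasPD_of_pdLe_one h3))
end

section
variable {k V D : Type} [Field k] [Fintype V] [DecidableEq V] [Fintype D] [DecidableEq D]
  {q : DQ k V D} {A : Type} [Ring A] [Algebra k A]
set_option linter.unusedSectionVars false

theorem projective_range {F : Type} [AddCommGroup F] [Module A F] [Module.Projective A F]
    (E : F →ₗ[A] F) (hE : ∀ z, E (E z) = E z) : Module.Projective A (LinearMap.range E) := by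
  refine Module.Projective.of_split (LinearMap.range E).subtype E.rangeRestrict ?_
  ext ⟨z, w, rfl⟩
  simp [hE]

theorem pdLe_two_abs {F0 F1 : Type} [AddCommGroup F0] [AddCommGroup F1] [Module A F0] [Module A F1]
    [Module.Projective A F0] [Module.Projective A F1] (M : ModuleCat.{0} A)
    (E0 : F0 →ₗ[A] F0) (E1 : F1 →ₗ[A] F1) (d0 : F0 →ₗ[A] M) (d1 : F1 →ₗ[A] F0) (d2 : F0 →ₗ[A] F1)
    (E00 : ∀ z, E0 (E0 z) = E0 z) (E11 : ∀ z, E1 (E1 z) = E1 z)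
    (d0E : ∀ z, d0 (E0 z) = d0 z) (Ed1 : ∀ z, E0 (d1 z) = d1 z) (Ed2 : ∀ z, E1 (d2 z) = d2 z)
    (d2E : ∀ z, d2 (E0 z) = d2 z) (d1E : ∀ z, d1 (E1 z) = d1 z)
    (h01 : ∀ z, d0 (d1 z) = 0) (h12 : ∀ z, d1 (d2 z) = 0)
    (surj : Function.Surjective d0) (ex0 : ∀ z, d0 z = 0 → ∃ w, d1 w = E0 z)
    (ex1 : ∀ z, d1 z = 0 → ∃ w, d2 w = E1 z) (inj : ∀ z, E0 z = z → d2 z = 0 → z = 0) :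
    pdLe 2 M := by
  have : Module.Projective A (LinearMap.range E0) := projective_range _ E00
  have : Module.Projective A (LinearMap.range E1) := projective_range _ E11
  have fix0 : ∀ z ∈ LinearMap.range E0, E0 z = z := by
    rintro _ ⟨w, rfl⟩; exact E00 w
  have fix1 : ∀ z ∈ LinearMap.range E1, E1 z = z := by
    rintro _ ⟨w, rfl⟩; exact E11 w
  let D1 : LinearMap.range E1 →ₗ[A] LinearMap.range E0 :=
    LinearMap.codRestrict _ (d1.comp (LinearMap.range E1).subtype) (fun z => ⟨_, Ed1 _⟩)
  let D2 : LinearMap.range E0 →ₗ[A] LinearMap.range E1 :=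
    LinearMap.codRestrict _ (d2.comp (LinearMap.range E0).subtype) (fun z => ⟨_, Ed2 _⟩)
  let D0 : LinearMap.range E0 →ₗ[A] M := d0.comp (LinearMap.range E0).subtype
  have : Mono (ModuleCat.ofHom D2) := by
    rw [ModuleCat.mono_iff_injective]
    refine (injective_iff_map_eq_zero D2).2 ?_
    rintro ⟨z, hz⟩ h
    exact Subtype.ext (inj z (fix0 z hz) (congrArg Subtype.val h))
  have : Epi (ModuleCat.ofHom D0) := by
    rw [ModuleCat.epi_iff_surjective]
    intro m
    obtain ⟨z, hz⟩ := surj m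
    refine ⟨⟨E0 z, _, rfl⟩, ?_⟩
    change d0 (E0 z) = m
    rw [d0E, hz]
  refine pdLe_two_of (M := M) (ModuleCat.ofHom D2) (ModuleCat.ofHom D1) (ModuleCat.ofHom D0)
    ?_ ?_ ?_ ?_
  · ext z
    exact h12 _
  · ext z
    exact h01 _
  · rw [ShortComplex.moduleCat_exact_iff]
    rintro ⟨z, hz⟩ h
    obtain ⟨w, hw⟩ := ex1 z (congrArg Subtype.val h)
    refine ⟨⟨E0 w, w, rfl⟩, Subtype.ext ?_⟩
    change d2 (E0 w) = z
    rw [d2E, hw, fix1 z hz]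
  · rw [ShortComplex.moduleCat_exact_iff]
    rintro ⟨z, hz⟩ h
    obtain ⟨w, hw⟩ := ex0 z h
    refine ⟨⟨E1 w, w, rfl⟩, Subtype.ext ?_⟩
    change d1 (E1 w) = z
    rw [d1E, hw, fix0 z hz]

theorem DUni.pdLe_two (U : DUni q A) (hns : ∀ x : A, (∀ d, x * U.a d = 0) → x = 0)
    (M : ModuleCat.{0} A) : pdLe 2 M := by
  let : Module k M := Module.compHom M (algebraMap k A)
  have : IsScalarTower k A M := ⟨fun c a m => by
    rw [Algebra.smul_def, mul_smul]; rfl⟩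
  refine pdLe_two_abs M (U.E0 M) (U.E1 M) (U.d0 M) (U.d1 M) (U.d2 M) U.E0_E0 U.E1_E1 U.d0_E0
    U.E0_d1 U.E1_d2 U.d2_E0 ?_ U.d0_d1 U.d1_d2 ?_ U.exact_P0 U.exact_P1 (U.d2_inj hns)
  · intro w
    rw [U.d1_apply, U.d1_apply]
    refine Finset.sum_congr rfl fun d _ => ?_
    rw [U.E1_apply]
    refine ext1 (f := (rr k M (U.a d) (U.e (q.s d)) - rr k M (U.e (q.t d)) (U.a d)).comp
      (rr k M (U.e (q.t d)) (U.e (q.s d))))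
      (g := (rr k M (U.a d) (U.e (q.s d)) - rr k M (U.e (q.t d)) (U.a d))) (fun x m => ?_) (w d)
    rw [LinearMap.comp_apply, LinearMap.sub_apply, LinearMap.sub_apply, rr_tmul, rr_tmul, rr_tmul,
      rr_tmul, rr_tmul, smul_smul, smul_smul, mul_assoc, mul_assoc, U.orth, U.orth, if_pos rfl,
      if_pos rfl, U.ht, U.hs]
  · intro m
    exact ⟨1 ⊗ₜ m, by rw [U.d0_tmul, one_smul]⟩

theorem DUni.not_pdLe_one (U : DUni q A) (d0 : D) : ¬ ∀ M : ModuleCat.{0} A, pdLe 1 M := by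
  intro hall
  let J : Submodule A A := Submodule.span A (Set.range U.a)
  have hJ : Module.Projective A J := by
    let S : ShortComplex (ModuleCat.{0} A) :=
      ShortComplex.mk (ModuleCat.ofHom J.subtype) (ModuleCat.ofHom J.mkQ) (by
        ext x; simp)
    have hS : S.ShortExact :=
      { exact := by
          rw [ShortComplex.moduleCat_exact_iff]
          intro x hx
          exact ⟨⟨x, (Submodule.Quotient.mk_eq_zero J).1 hx⟩, rfl⟩
        mono_f := (ModuleCat.mono_iff_injective _).2 J.injective_subtype
        epi_g := (ModuleCat.epi_iff_surjective _).2 J.mkQ_surjective }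
    have h2 : Projective S.X₂ := by
      change Projective (ModuleCat.of A A); infer_instance
    have := projective_of_pdLe_one hS h2 (hall _)
    exact (IsProjective.iff_projective (R := A) J).2 this
  have ha : ∀ d, U.a d ∈ J := fun d => Submodule.subset_span ⟨d, rfl⟩
  let φ0 : (D → A) →ₗ[A] A :=
    ∑ d, (LinearMap.toSpanSingleton A A (q.ε d • U.a (q.st d))).comp (LinearMap.proj d)
  have hφ0 : ∀ y, φ0 y = ∑ d, y d * (q.ε d • U.a (q.st d)) := by
    intro y; simp [φ0, LinearMap.sum_apply]
  let φ : (D → A) →ₗ[A] J := LinearMap.codRestrict J φ0 (by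
    intro y
    rw [hφ0]
    refine Submodule.sum_mem _ fun d _ => ?_
    rw [mul_smul_comm]
    exact Submodule.smul_of_tower_mem _ _ (Submodule.smul_mem _ _ (ha _)))
  have hφ : ∀ y, (φ y : A) = ∑ d, y d * (q.ε d • U.a (q.st d)) := hφ0
  have hsurj : Function.Surjective φ := by
    rw [← LinearMap.range_eq_top, eq_top_iff]
    rintro ⟨x, hx⟩ -
    have : x ∈ (LinearMap.range φ).map J.subtype := by
      refine Submodule.span_le.2 ?_ hx
      rintro _ ⟨d, rfl⟩
      refine ⟨φ (Pi.single (q.st d) (algebraMap k A (q.ε (q.st d))⁻¹)), ⟨_, rfl⟩, ?_⟩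
      rw [Submodule.subtype_apply, hφ, Finset.sum_eq_single (q.st d)]
      · rw [Pi.single_eq_same, q.st_st, ← Algebra.smul_def, smul_smul,
          inv_mul_cancel₀ (q.ε_ne _), one_smul]
      · intro d' _ hd'
        rw [Pi.single_eq_of_ne hd', zero_mul]
      · simp
    obtain ⟨y, hy, hyx⟩ := this
    have : y = ⟨x, hx⟩ := Subtype.ext hyx
    rwa [← this]
  obtain ⟨s, hs⟩ := Module.projective_lifting_property φ LinearMap.id hsurj
  have hs' : ∀ x, φ (s x) = x := fun x => LinearMap.congr_fun hs x
  let pr : (D → A) →ₗ[A] (D → A) := LinearMap.id - s.comp φ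
  have hpr : ∀ y, φ (pr y) = 0 := by
    intro y
    simp [pr, hs']
  have hker : ∀ y, φ y = 0 → ∃ z, ∀ d, y d * U.e (q.s d) = z * U.a d := by
    intro y hy
    refine U.exact_mid (fun d => y d * U.e (q.s d)) (fun d => ?_) ?_
    · rw [mul_assoc, U.orth, if_pos rfl]
    · have := congrArg Subtype.val hy
      rw [hφ] at this
      refine Eq.trans ?_ this
      refine Finset.sum_congr rfl fun d _ => ?_
      rw [mul_assoc, U.e_a, q.t_st, if_pos rfl, mul_smul_comm]
  have hr : φ U.a = 0 := by
    refine Subtype.ext ?_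
    rw [hφ]
    simp only [mul_smul_comm]
    exact U.mesh
  have hr2 : pr U.a = U.a := by simp [pr, hr]
  choose z hz using fun d => hker _ (hpr (Pi.single d 1))
  have h1 : U.a d0 = ∑ d, U.a d * (z d * U.a d0) := by
    have h3 : U.a = ∑ d, U.a d • (Pi.single d 1 : D → A) := by
      conv_lhs => rw [← Finset.univ_sum_single U.a]
      refine Finset.sum_congr rfl fun d _ => ?_
      rw [← Pi.single_smul, smul_eq_mul, mul_one]
    have h4 := congrFun hr2 d0
    rw [h3, map_sum] at h4
    simp only [map_smul] at h4
    rw [← h3] at h4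
    have h6 := congrArg (fun x => x * U.e (q.s d0)) h4
    simp only [U.hs, Finset.sum_apply, Finset.sum_mul, Pi.smul_apply, smul_eq_mul, mul_assoc,
      hz] at h6
    exact h6.symm
  apply U.a_ne d0
  have h5 := congrArg (U.p (0 + 1)) h1
  rw [← one_mul (U.a d0), U.p_succ_mul_a, U.p_one, if_pos rfl, one_mul, map_sum] at h5
  rw [h5]
  refine Finset.sum_eq_zero fun d _ => ?_
  rw [← mul_assoc, U.p_succ_mul_a, U.p_zero_a_mul, zero_mul]

end


section
variable (k : Type) [Field k] (V : Type) [Fintype V] [DecidableEq V]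
    (E : V → V → Type) [∀ i j, Fintype (E i j)]
set_option linter.unusedSectionVars false

/-- all arrows -/
abbrev Arr : Type := Σ i : V, Σ j : V, E i j

/-- the doubled quiver -/
noncomputable def dq : DQ k V (Arr V E ⊕ Arr V E) where
  s := Sum.elim (fun x => x.1) (fun x => x.2.1)
  t := Sum.elim (fun x => x.2.1) (fun x => x.1)
  st := Sum.swap
  st_st d := Sum.swap_swap d
  s_st d := by cases d <;> rfl
  ε := Sum.elim (fun _ => 1) (fun _ => -1)
  ε_ne d := by cases d <;> simp

variable {k V E} {B : Type} [Ring B] [Algebra k B]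

theorem dq_mesh (a : Arr V E ⊕ Arr V E → B) :
    ∑ d, (dq k V E).ε d • (a d * a ((dq k V E).st d)) =
      (∑ i, ∑ j, ∑ α : E i j, a (Sum.inl ⟨i, j, α⟩) * a (Sum.inr ⟨i, j, α⟩)) -
      (∑ i, ∑ j, ∑ α : E i j, a (Sum.inr ⟨i, j, α⟩) * a (Sum.inl ⟨i, j, α⟩)) := by
  rw [Fintype.sum_sum_type, sub_eq_add_neg]
  simp only [Fintype.sum_sigma, dq, Sum.elim_inl, Sum.elim_inr, Sum.swap_inl, Sum.swap_inr,
    one_smul, neg_smul, Finset.sum_neg_distrib]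

noncomputable def toRel (ρ : PreprojectivePresentation k V E B) : DRel (dq k V E) B where
  e := ρ.e
  a := Sum.elim (fun x => ρ.f x.2.2) (fun x => ρ.g x.2.2)
  orth := ρ.orth
  sum_one := ρ.sum_one
  ht := by
    rintro (⟨i, j, α⟩ | ⟨i, j, α⟩)
    · change ρ.e j * ρ.f α = ρ.f α
      rw [← ρ.f_idem α, ← mul_assoc, ← mul_assoc, ρ.orth, if_pos rfl]
    · change ρ.e i * ρ.g α = ρ.g α
      rw [← ρ.g_idem α, ← mul_assoc, ← mul_assoc, ρ.orth, if_pos rfl]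
  hs := by
    rintro (⟨i, j, α⟩ | ⟨i, j, α⟩)
    · change ρ.f α * ρ.e i = ρ.f α
      rw [← ρ.f_idem α, mul_assoc, ρ.orth, if_pos rfl]
    · change ρ.g α * ρ.e j = ρ.g α
      rw [← ρ.g_idem α, mul_assoc, ρ.orth, if_pos rfl]
  mesh := by
    rw [dq_mesh]
    simp only [Sum.elim_inl, Sum.elim_inr]
    rw [Finset.sum_comm, ← Finset.sum_sub_distrib]
    exact Finset.sum_eq_zero fun x _ => ρ.mesh x

noncomputable def ofRel (R : DRel (dq k V E) B) : PreprojectivePresentation k V E B where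
  e := R.e
  f i j α := R.a (Sum.inl ⟨i, j, α⟩)
  g i j α := R.a (Sum.inr ⟨i, j, α⟩)
  orth := R.orth
  sum_one := R.sum_one
  f_idem i j α := by
    have h1 := R.ht (Sum.inl ⟨i, j, α⟩)
    have h2 := R.hs (Sum.inl ⟨i, j, α⟩)
    simp only [dq, Sum.elim_inl] at h1 h2
    rw [h1, h2]
  g_idem i j α := by
    have h1 := R.ht (Sum.inr ⟨i, j, α⟩)
    have h2 := R.hs (Sum.inr ⟨i, j, α⟩)
    simp only [dq, Sum.elim_inr] at h1 h2
    rw [h1, h2]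
  mesh x := by
    have h := congrArg (fun y => R.e x * y) R.mesh
    simp only [dq_mesh, mul_zero, mul_sub, Finset.mul_sum, ← mul_assoc, R.e_a] at h
    simp only [dq, Sum.elim_inl, Sum.elim_inr] at h
    rw [← h]
    congr 1
    · refine Finset.sum_congr rfl fun i _ => ?_
      rw [Finset.sum_eq_single x]
      · simp
      · intro j _ hj; simp [hj]
      · simp
    · refine Eq.symm ((Finset.sum_eq_single x ?_ ?_).trans ?_)
      · intro j _ hj; simp [hj]
      · simp
      · simp

variable {A : Type} [Ring A] [Algebra k A]

noncomputable def toUni (π : PreprojectivePresentation k V E A)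
    (hgen : Algebra.adjoin k
      (Set.range π.e ∪ {a | ∃ (i j : V) (α : E i j), a = π.f α ∨ a = π.g α}) = ⊤)
    (hU : ∀ (B : Type) [Ring B] [Algebra k B]
      (ρ : PreprojectivePresentation k V E B),
      ∃! ψ : A →ₐ[k] B, (∀ i, ψ (π.e i) = ρ.e i) ∧
        (∀ (i j : V) (α : E i j), ψ (π.f α) = ρ.f α) ∧
        (∀ (i j : V) (α : E i j), ψ (π.g α) = ρ.g α)) : DUni (dq k V E) A where
  toDRel := toRel π
  gen := by
    rw [eq_top_iff, ← hgen]
    refine Algebra.adjoin_mono ?_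
    rintro x (⟨i, rfl⟩ | ⟨i, j, α, rfl | rfl⟩)
    · exact Or.inl ⟨i, rfl⟩
    · exact Or.inr ⟨Sum.inl ⟨i, j, α⟩, rfl⟩
    · exact Or.inr ⟨Sum.inr ⟨i, j, α⟩, rfl⟩
  univ B _ _ ρ := by
    obtain ⟨ψ, ⟨h1, h2, h3⟩, -⟩ := hU B (ofRel ρ)
    refine ⟨ψ, h1, ?_⟩
    rintro (⟨i, j, α⟩ | ⟨i, j, α⟩)
    · exact h2 i j α
    · exact h3 i j α

variable (k)

theorem dq_C (x : V → ℝ) (i : V) : (dq k V E).C x i =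
    ∑ j, ((Fintype.card (E i j) : ℝ) + Fintype.card (E j i)) * x j := by
  rw [DQ.C_apply, Finset.sum_filter, Fintype.sum_sum_type]
  simp only [Fintype.sum_sigma, dq, Sum.elim_inl, Sum.elim_inr, add_mul, Finset.sum_add_distrib]
  rw [add_comm]
  congr 1
  · refine (Finset.sum_eq_single i ?_ ?_).trans ?_
    · intro j _ hj; simp [hj]
    · simp
    · simp
  · refine Finset.sum_congr rfl fun a _ => ?_
    rw [Finset.sum_eq_single i]
    · simp
    · intro j _ hj; simp [hj]
    · simp

theorem cartan_mulVec (x : V → ℝ) (i : V) :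
    (((cartanMatrix V E).map ((↑) : ℤ → ℝ)).mulVec x) i = 2 * x i - (dq k V E).C x i := by
  rw [dq_C, Matrix.mulVec, dotProduct]
  simp only [Matrix.map_apply, cartanMatrix, Int.cast_sub, Int.cast_add, Int.cast_natCast, sub_mul,
    Finset.sum_sub_distrib]
  congr 1
  rw [Finset.sum_eq_single i]
  · simp
  · intro j _ hj; simp [Ne.symm hj]
  · simp

theorem dynkin_iff : IsDynkin V E ↔ (dq k V E).Pos := by
  have key : ∀ x : V → ℝ, star x ⬝ᵥ (((cartanMatrix V E).map ((↑) : ℤ → ℝ)).mulVec x)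
      = ∑ i, x i * (2 * x i - (dq k V E).C x i) := by
    intro x
    simp [dotProduct, cartan_mulVec k]
  constructor
  · intro h x hx
    rw [← key]
    exact h.dotProduct_mulVec_pos hx
  · intro h
    refine Matrix.PosDef.of_dotProduct_mulVec_pos ?_ ?_
    · ext i j
      simp [cartanMatrix, eq_comm, add_comm]
    · intro x hx
      rw [key]
      exact h x hx

theorem dq_conn (h : QuiverConnected V E) : (dq k V E).Conn := by
  intro P hP i j hi
  obtain ⟨p⟩ := h i j
  induction p with
  | nil => exact hi
  | cons p e ih =>
    rcases e with α | α
    · exact hP (Sum.inr ⟨_, _, α⟩) ih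
    · exact hP (Sum.inl ⟨_, _, α⟩) ih

theorem dq_nonempty (h : ¬ (dq k V E).Pos) : Nonempty (Arr V E ⊕ Arr V E) := by
  by_contra hn
  rw [not_nonempty_iff] at hn
  apply h
  intro x hx
  obtain ⟨i, hi⟩ := Function.ne_iff.1 hx
  have : ∀ i, x i * (2 * x i - (dq k V E).C x i) = 2 * (x i) ^ 2 := by
    intro i
    rw [DQ.C_apply, Finset.sum_of_isEmpty]; ring
  simp only [this]
  refine Finset.sum_pos' (fun i _ => by positivity) ⟨i, Finset.mem_univ _, ?_⟩
  have : x i ≠ 0 := hi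
  positivity

end

/-- If `Q` is a Dynkin quiver then the preprojective algebra `P_Q = A` is
self-injective, and if `Q` is not of Dynkin type then `A` has global dimension two
(every module has projective dimension at most two, but not every module has projective
dimension at most one). -/
theorem preprojective_selfInjective_or_globalDimension_two
    (k : Type) [Field k]
    (V : Type) [Fintype V] [DecidableEq V]
    (E : V → V → Type) [∀ i j, Fintype (E i j)]
    (hacyclic : QuiverAcyclic V E) (hconn : QuiverConnected V E)
    (A : Type) [Ring A] [Algebra k A]
    (π : PreprojectivePresentation k V E A)
    (hgen : Algebra.adjoin k
      (Set.range π.e ∪ {a | ∃ (i j : V) (α : E i j), a = π.f α ∨ a = π.g α}) = ⊤)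
    (hU : ∀ (B : Type) [Ring B] [Algebra k B]
      (ρ : PreprojectivePresentation k V E B),
      ∃! ψ : A →ₐ[k] B, (∀ i, ψ (π.e i) = ρ.e i) ∧
        (∀ (i j : V) (α : E i j), ψ (π.f α) = ρ.f α) ∧
        (∀ (i j : V) (α : E i j), ψ (π.g α) = ρ.g α)) :
    (IsDynkin V E → Module.Injective A A) ∧
    (¬ IsDynkin V E →
      (∀ M : ModuleCat A, pdLe 2 M) ∧ ¬ (∀ M : ModuleCat A, pdLe 1 M)) := by
  classical
  let U : DUni (dq k V E) A := toUni π hgen hU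
  refine ⟨fun h => U.injective_of_pos ((dynkin_iff k).1 h), fun h => ?_⟩
  rw [dynkin_iff k] at h
  obtain ⟨d⟩ := dq_nonempty k h
  have hns : ∀ j n, ¬ U.Soc j n := fun j n hs => h (U.pos_of_soc (dq_conn k hconn) j ⟨n, hs⟩)
  exact ⟨fun M => U.pdLe_two (U.noSoc hns) M, U.not_pdLe_one d⟩
end
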